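/- arXiv:1711.11176 — 2 statements merged into one kernel-verified Lean document; each statement's English description precedes it below -/
import Mathlib

section
/- Let k be a field, let V be a vector space over k, and let E be a finite subset of V whose span has dimension d. Then for every natural number i with 2i < d, we have w_i(E) ≤ w_{d−i}(E) and w_i(E) ≤ w_{i+1}(E). -/
namespace DowlingWilson

open Module

set_option linter.unusedSectionVars false

universe u

section Ring

/-- Real functions on the subspaces of `V`, the additive group of the graded Möbius algebra of the
lattice of subspaces. -/
def MobiusAlgebra (F V : Type*) [Field F] [AddCommGroup V] [Module F V] : Type _ :=
  Submodule F V → ℝ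

variable (F V : Type*) [Field F] [AddCommGroup V] [Module F V]

noncomputable instance : AddCommGroup (MobiusAlgebra F V) :=
  inferInstanceAs (AddCommGroup (Submodule F V → ℝ))

noncomputable instance : Module ℝ (MobiusAlgebra F V) :=
  inferInstanceAs (Module ℝ (Submodule F V → ℝ))

variable [Finite V]

noncomputable instance : Fintype (Submodule F V) := Fintype.ofFinite _

instance : FiniteDimensional ℝ (MobiusAlgebra F V) :=
  inferInstanceAs (FiniteDimensional ℝ (Submodule F V → ℝ))

/-- The basis of the Möbius algebra indexed by the subspaces. -/
noncomputable def stdBasis : Basis (Submodule F V) ℝ (MobiusAlgebra F V) :=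
  Pi.basisFun ℝ (Submodule F V)

variable {F V}

/-- The basis element of the Möbius algebra attached to a subspace. -/
noncomputable def y (W : Submodule F V) : MobiusAlgebra F V := stdBasis F V W

/-- The coefficient of `a` at the subspace `W`. -/
noncomputable def coef (W : Submodule F V) : MobiusAlgebra F V →ₗ[ℝ] ℝ := (stdBasis F V).coord W

open Classical in
theorem coef_y (W U : Submodule F V) : coef W (y U) = if W = U then 1 else 0 := by
  simp [coef, y, Finsupp.single_apply, eq_comm]

theorem sum_coef (a : MobiusAlgebra F V) : ∑ W, coef W a • y W = a := (stdBasis F V).sum_repr a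

theorem ext_coef {a b : MobiusAlgebra F V} (h : ∀ W, coef W a = coef W b) : a = b :=
  (stdBasis F V).ext_elem h

theorem hom_ext {M : Type*} [AddCommGroup M] [Module ℝ M] {f g : MobiusAlgebra F V →ₗ[ℝ] M}
    (h : ∀ W, f (y W) = g (y W)) : f = g := (stdBasis F V).ext h

open Classical in
/-- The multiplication of the Möbius algebra. -/
noncomputable def mulMap :
    MobiusAlgebra F V →ₗ[ℝ] MobiusAlgebra F V →ₗ[ℝ] MobiusAlgebra F V :=
  (stdBasis F V).constr ℝ fun U => (stdBasis F V).constr ℝ fun W =>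
    if Disjoint U W then y (U ⊔ W) else 0

open Classical in
theorem mulMap_y (U W : Submodule F V) :
    mulMap (y U) (y W) = if Disjoint U W then y (U ⊔ W) else 0 := by
  simp only [mulMap, y, Basis.constr_basis]

theorem mulMap_comm (a b : MobiusAlgebra F V) : mulMap a b = mulMap b a := by
  have : (mulMap : MobiusAlgebra F V →ₗ[ℝ] _) = LinearMap.flip mulMap := by
    refine hom_ext fun U => hom_ext fun W => ?_
    rw [LinearMap.flip_apply, mulMap_y, mulMap_y, disjoint_comm, sup_comm]
  exact LinearMap.congr_fun₂ this a b

theorem mulMap_assoc (a b c : MobiusAlgebra F V) :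
    mulMap (mulMap a b) c = mulMap a (mulMap b c) := by
  have : (LinearMap.compr₂ mulMap mulMap :
      MobiusAlgebra F V →ₗ[ℝ] MobiusAlgebra F V →ₗ[ℝ] MobiusAlgebra F V →ₗ[ℝ] MobiusAlgebra F V) =
      ((LinearMap.llcomp ℝ _ _ _).flip ∘ₗ mulMap).flip ∘ₗ mulMap := by
    refine hom_ext fun U => hom_ext fun W => hom_ext fun T => ?_
    simp only [LinearMap.compr₂_apply, mulMap_y, LinearMap.comp_apply, LinearMap.flip_apply,
      LinearMap.llcomp_apply]
    by_cases h1 : Disjoint U W <;> by_cases h2 : Disjoint W T <;>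
      simp only [h1, h2, if_true, if_false, map_zero, LinearMap.zero_apply, mulMap_y]
    · by_cases h3 : Disjoint (U ⊔ W) T
      · rw [if_pos h3, if_pos (h1.disjoint_sup_right_of_disjoint_sup_left h3), sup_assoc]
      · rw [if_neg h3, if_neg]
        exact fun h => h3 (h2.disjoint_sup_left_of_disjoint_sup_right h)
    · rw [if_neg]
      exact fun h => h2 (h.mono_left le_sup_right)
    · rw [if_neg]
      exact fun h => h1 (h.mono_right le_sup_left)
  have := LinearMap.congr_fun (LinearMap.congr_fun₂ this a b) c
  exact this

theorem mulMap_one (a : MobiusAlgebra F V) : mulMap (y ⊥) a = a := by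
  have : mulMap (y ⊥) = (LinearMap.id : MobiusAlgebra F V →ₗ[ℝ] _) := by
    refine hom_ext fun U => ?_
    simp [mulMap_y]
  rw [this]; rfl

noncomputable instance : CommRing (MobiusAlgebra F V) :=
  { (inferInstance : AddCommGroup (MobiusAlgebra F V)) with
    mul := fun a b => mulMap a b
    one := y ⊥
    mul_assoc := mulMap_assoc
    mul_comm := mulMap_comm
    one_mul := mulMap_one
    mul_one := fun a => (mulMap_comm a _).trans (mulMap_one a)
    zero_mul := fun a => by change mulMap 0 a = 0; simp
    mul_zero := fun a => by change mulMap a 0 = 0; simp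
    left_distrib := fun a b c => by change mulMap a (b + c) = mulMap a b + mulMap a c; simp
    right_distrib := fun a b c => by change mulMap (a + b) c = mulMap a c + mulMap b c; simp
    natCast := fun n => n • y ⊥
    natCast_zero := zero_smul _ _
    natCast_succ := fun n => succ_nsmul _ _
    intCast := fun n => n • y ⊥
    intCast_ofNat := fun n => natCast_zsmul _ _
    intCast_negSucc := fun n => negSucc_zsmul _ _
    npow := @npowRec (MobiusAlgebra F V) ⟨y ⊥⟩ ⟨fun a b => mulMap a b⟩ }

noncomputable instance : Algebra ℝ (MobiusAlgebra F V) :=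
  Algebra.ofModule (fun r a b => by change mulMap (r • a) b = r • mulMap a b; simp)
    (fun r a b => by change mulMap a (r • b) = r • mulMap a b; simp)

theorem one_def : (1 : MobiusAlgebra F V) = y ⊥ := rfl

open Classical in
theorem y_mul_y (U W : Submodule F V) :
    y U * y W = if Disjoint U W then y (U ⊔ W) else 0 := mulMap_y U W

theorem coef_zero' (a : MobiusAlgebra F V) (h : ∀ W, coef W a = 0) : a = 0 :=
  ext_coef fun W => by rw [h, map_zero]

end Ring

section Peeling

variable {F V : Type*} [Field F] [AddCommGroup V] [Module F V] [Finite V]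

open Classical in
/-- The sum of `b` over the subspaces containing `Y` that meet `Z` exactly in `X`. -/
noncomputable def meetSum (b : Submodule F V → ℝ) (X Z Y : Submodule F V) : ℝ :=
  ∑ W, if Y ≤ W ∧ W ⊓ Z = X then b W else 0

theorem card_translate_mem (X Z W : Submodule F V) (hWZ : W ⊓ Z = X) (v : V) (z₀ : V)
    (hz₀ : z₀ ∈ Z) (hv : v + z₀ ∈ W) : Nat.card {z : Z // v + (z : V) ∈ W} = Nat.card X := by
  symm
  have hX : X ≤ Z := hWZ ▸ inf_le_right
  have hXW : X ≤ W := hWZ ▸ inf_le_left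
  refine Nat.card_congr
    { toFun := fun x => ⟨⟨z₀ + x, Z.add_mem hz₀ (hX x.2)⟩, ?_⟩
      invFun := fun z => ⟨z.1 - z₀, ?_⟩
      left_inv := fun x => by simp
      right_inv := fun z => by simp }
  · rw [← add_assoc]
    exact W.add_mem hv (hXW x.2)
  · rw [← hWZ]
    refine ⟨?_, Z.sub_mem z.1.2 hz₀⟩
    have := W.sub_mem z.2 hv
    rwa [add_sub_add_left_eq_sub] at this

theorem inf_sup_span_eq (X Z W : Submodule F V) (hWZ : W ⊓ Z = X) (v : V)
    (h : ∀ z ∈ Z, v + z ∉ W) : W ⊓ (Z ⊔ F ∙ v) = X := by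
  refine le_antisymm ?_ (hWZ ▸ inf_le_inf_left _ le_sup_left)
  rintro w ⟨hw, hw'⟩
  obtain ⟨z, hz, u, hu, rfl⟩ := Submodule.mem_sup.1 hw'
  obtain ⟨c, rfl⟩ := Submodule.mem_span_singleton.1 hu
  by_cases hc : c = 0
  · subst hc
    rw [← hWZ]
    simp only [zero_smul, add_zero] at hw ⊢
    exact ⟨hw, hz⟩
  · refine absurd ?_ (h (c⁻¹ • z) (Z.smul_mem _ hz))
    have := W.smul_mem c⁻¹ hw
    rwa [smul_add, smul_smul, inv_mul_cancel₀ hc, one_smul, add_comm] at this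

open Classical in
theorem sum_meetSum_translate (b : Submodule F V → ℝ) (X Z Y : Submodule F V) [Fintype Z] (hXZ : X ≤ Z)
    (v : V) (hv : v ∉ Z) :
    ∑ z : Z, meetSum b X Z (Y ⊔ F ∙ (v + (z : V))) =
      Nat.card X * (meetSum b X Z Y - meetSum b X (Z ⊔ F ∙ v) Y) := by
  simp only [meetSum]
  rw [Finset.sum_comm, ← Finset.sum_sub_distrib, Finset.mul_sum]
  refine Finset.sum_congr rfl fun W _ => ?_
  by_cases hY : Y ≤ W
  · by_cases hZ : W ⊓ Z = X
    · simp only [sup_le_iff, hY, hZ, true_and, and_true, Submodule.span_singleton_le_iff_mem,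
        if_true]
      by_cases h : ∃ z ∈ Z, v + z ∈ W
      · obtain ⟨z₀, hz₀, hvz⟩ := h
        have hne : W ⊓ (Z ⊔ F ∙ v) ≠ X := by
          intro he
          have : v + z₀ ∈ X := by
            rw [← he]
            exact ⟨hvz, add_comm v z₀ ▸ Submodule.add_mem_sup hz₀
              (Submodule.mem_span_singleton_self v)⟩
          exact hv ((Submodule.add_mem_iff_left _ hz₀).1 (hXZ this))
        rw [if_neg hne, sub_zero, ← card_translate_mem X Z W hZ v z₀ hz₀ hvz,
          ← Finset.sum_filter, Finset.sum_const, nsmul_eq_mul, Nat.card_eq_fintype_card,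
          Fintype.card_subtype]
      · push Not at h
        rw [if_pos (inf_sup_span_eq X Z W hZ v h), sub_self, mul_zero]
        exact Finset.sum_eq_zero fun z _ => if_neg (h z z.2)
    · have : W ⊓ (Z ⊔ F ∙ v) ≠ X := by
        intro he
        refine hZ (le_antisymm ?_ (le_inf (he ▸ inf_le_left) hXZ))
        exact he ▸ inf_le_inf_left _ le_sup_left
      simp [hZ, this]
  · have : ∀ z : Z, ¬ (Y ⊔ F ∙ (v + (z : V)) ≤ W) := fun z hz => hY (le_sup_left.trans hz)
    simp [hY, this]

theorem finrank_sup_span (W : Submodule F V) {v : V} (hv : v ∉ W) :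
    finrank F ↥(W ⊔ F ∙ v) = finrank F W + 1 := by
  have hv0 : v ≠ 0 := fun h => hv (h ▸ W.zero_mem)
  have h := Submodule.finrank_sup_add_finrank_inf_eq W (F ∙ v)
  have hd : W ⊓ F ∙ v = ⊥ := by
    rw [← disjoint_iff]
    exact (Submodule.disjoint_span_singleton' hv0).2 hv
  rw [hd, finrank_bot, finrank_span_singleton hv0] at h
  simpa using h

theorem exists_eq_sup_span (X Z : Submodule F V) (hXZ : X ≤ Z) (n : ℕ)
    (h : finrank F Z = finrank F X + (n + 1)) :
    ∃ Z' v, X ≤ Z' ∧ v ∉ Z' ∧ finrank F Z' = finrank F X + n ∧ Z = Z' ⊔ F ∙ v := by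
  induction n generalizing X with
  | zero =>
    have hne : ¬ Z ≤ X := fun hle => by
      have := Submodule.finrank_mono hle
      omega
    obtain ⟨v, hvZ, hvX⟩ := SetLike.not_le_iff_exists.1 hne
    refine ⟨X, v, le_rfl, hvX, rfl, (Submodule.eq_of_le_of_finrank_eq ?_ ?_).symm⟩
    · exact sup_le hXZ ((Submodule.span_singleton_le_iff_mem _ _).2 hvZ)
    · rw [finrank_sup_span X hvX, h]
  | succ n ih =>
    have hne : ¬ Z ≤ X := fun hle => by
      have := Submodule.finrank_mono hle
      omega
    obtain ⟨v, hvZ, hvX⟩ := SetLike.not_le_iff_exists.1 hne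
    obtain ⟨Z', u, h1, h2, h3, h4⟩ := ih (X ⊔ F ∙ v)
      (sup_le hXZ ((Submodule.span_singleton_le_iff_mem _ _).2 hvZ))
      (by rw [finrank_sup_span X hvX]; omega)
    refine ⟨Z', u, le_sup_left.trans h1, h2, ?_, h4⟩
    rw [h3, finrank_sup_span X hvX]; omega

theorem meetSum_sup_span (b : Submodule F V → ℝ) (X Z Y : Submodule F V) [Fintype Z]
    (hXZ : X ≤ Z) (v : V) (hv : v ∉ Z) :
    meetSum b X (Z ⊔ F ∙ v) Y = meetSum b X Z Y -
      (Nat.card X : ℝ)⁻¹ * ∑ z : Z, meetSum b X Z (Y ⊔ F ∙ (v + (z : V))) := by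
  have hc : (Nat.card X : ℝ) ≠ 0 := Nat.cast_ne_zero.2 Nat.card_pos.ne'
  rw [sum_meetSum_translate b X Z Y hXZ v hv]
  field_simp
  ring

end Peeling

section Vanishing

variable {F V : Type*} [Field F] [AddCommGroup V] [Module F V] [Finite V]

open Classical in
/-- The sum of `b` over the subspaces containing `Y`. -/
noncomputable def upSum (b : Submodule F V → ℝ) (Y : Submodule F V) : ℝ :=
  ∑ W, if Y ≤ W then b W else 0

open Classical in
theorem meetSum_self (b : Submodule F V → ℝ) {X Y : Submodule F V} (h : X ≤ Y) :
    meetSum b X X Y = upSum b Y := by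
  refine Finset.sum_congr rfl fun W _ => if_congr ⟨fun h => h.1, fun h' => ⟨h', ?_⟩⟩ rfl rfl
  exact inf_eq_right.2 (h.trans h')

theorem finrank_sup_span_le (W : Submodule F V) (v : V) :
    finrank F ↥(W ⊔ F ∙ v) ≤ finrank F W + 1 := by
  by_cases hv : v ∈ W
  · rw [sup_eq_left.2 ((Submodule.span_singleton_le_iff_mem _ _).2 hv)]
    omega
  · exact (finrank_sup_span W hv).le

theorem meetSum_eq_zero (b : Submodule F V → ℝ) (X : Submodule F V) (k : ℕ)
    (hg : ∀ Y, X ≤ Y → finrank F Y < k → upSum b Y = 0) (n : ℕ) (Z Y : Submodule F V)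
    (hXZ : X ≤ Z) (hXY : X ≤ Y) (hZ : finrank F Z = finrank F X + n)
    (hn : n + finrank F Y < k) : meetSum b X Z Y = 0 := by
  induction n generalizing Z Y with
  | zero =>
    obtain rfl := Submodule.eq_of_le_of_finrank_eq hXZ hZ.symm
    rw [meetSum_self b hXY]
    exact hg Y hXY (by omega)
  | succ n ih =>
    obtain ⟨Z', v, h1, h2, h3, rfl⟩ := exists_eq_sup_span X Z hXZ n hZ
    have := Fintype.ofFinite Z'
    rw [meetSum_sup_span b X Z' Y h1 v h2, ih Z' Y h1 hXY h3 (by omega), Finset.sum_eq_zero]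
    · simp
    · intro z _
      have := finrank_sup_span_le Y (v + (z : V))
      exact ih Z' _ h1 (hXY.trans le_sup_left) h3 (by omega)

theorem meetSum_eq_upSum (b : Submodule F V → ℝ) (X : Submodule F V) (k : ℕ)
    (hg : ∀ Y, X ≤ Y → finrank F Y < k → upSum b Y = 0) (n : ℕ) (Z Y : Submodule F V)
    (hZY : Z ⊓ Y = X) (hZ : finrank F Z = finrank F X + n)
    (hn : n + finrank F Y = k) :
    ∃ c : ℝ, 0 < c ∧ meetSum b X Z Y = (-1) ^ n * c * upSum b (Z ⊔ Y) := by
  induction n generalizing Z Y with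
  | zero =>
    have hXZ : X ≤ Z := hZY ▸ inf_le_left
    have hXY : X ≤ Y := hZY ▸ inf_le_right
    obtain rfl := Submodule.eq_of_le_of_finrank_eq hXZ hZ.symm
    refine ⟨1, one_pos, ?_⟩
    rw [meetSum_self b hXY, sup_eq_right.2 hXY]
    ring
  | succ n ih =>
    have hXZ : X ≤ Z := hZY ▸ inf_le_left
    have hXY : X ≤ Y := hZY ▸ inf_le_right
    obtain ⟨Z', v, h1, h2, h3, rfl⟩ := exists_eq_sup_span X Z hXZ n hZ
    have := Fintype.ofFinite Z'
    have hZ'Y : Z' ⊓ Y = X := le_antisymm (hZY ▸ inf_le_inf_right _ le_sup_left) (le_inf h1 hXY)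
    have key : ∀ z : Z', ∀ u ∈ Y, v + (z : V) + u ∉ Z' := by
      intro z u hu hmem
      have hvu : v + u ∈ Z' := by
        have := Z'.sub_mem hmem z.2
        rwa [show v + (z : V) + u - z = v + u by abel] at this
      have huX : u ∈ X := by
        rw [← hZY]
        refine ⟨?_, hu⟩
        have := Submodule.sub_mem (Z' ⊔ F ∙ v) (Submodule.mem_sup_left hvu)
          (Submodule.mem_sup_right (Submodule.mem_span_singleton_self v))
        rwa [add_sub_cancel_left] at this
      exact h2 ((Submodule.add_mem_iff_left _ (h1 huX)).1 hvu)
    have hex : ∀ z : Z', ∃ c : ℝ, 0 < c ∧ meetSum b X Z' (Y ⊔ F ∙ (v + (z : V))) =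
        (-1) ^ n * c * upSum b (Z' ⊔ F ∙ v ⊔ Y) := by
      intro z
      have hvY : v + (z : V) ∉ Y := fun h => key z _ (Y.neg_mem h) (by simp)
      obtain ⟨c, hc, h⟩ := ih Z' (Y ⊔ F ∙ (v + (z : V))) (inf_sup_span_eq X Y Z' hZ'Y _ (key z)) h3
        (by rw [finrank_sup_span Y hvY]; omega)
      refine ⟨c, hc, ?_⟩
      rw [h]
      congr 2
      apply le_antisymm
      · refine sup_le (le_sup_left.trans le_sup_left) (sup_le le_sup_right ?_)
        rw [Submodule.span_singleton_le_iff_mem, add_comm]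
        exact Submodule.mem_sup_left (Submodule.add_mem_sup z.2 (Submodule.mem_span_singleton_self v))
      · refine sup_le (sup_le le_sup_left ?_) (le_sup_left.trans le_sup_right)
        rw [Submodule.span_singleton_le_iff_mem]
        have := Submodule.sub_mem (Z' ⊔ (Y ⊔ F ∙ (v + (z : V))))
          (Submodule.mem_sup_right (Submodule.mem_sup_right
            (Submodule.mem_span_singleton_self (v + (z : V))))) (Submodule.mem_sup_left z.2)
        rwa [add_sub_cancel_right] at this
    choose c hc hcz using hex
    refine ⟨(Nat.card X : ℝ)⁻¹ * ∑ z, c z, mul_pos (inv_pos.2 (Nat.cast_pos.2 Nat.card_pos))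
      (Finset.sum_pos (fun z _ => hc z) Finset.univ_nonempty), ?_⟩
    rw [meetSum_sup_span b X Z' Y h1 v h2,
      meetSum_eq_zero b X k hg n Z' Y h1 hXY h3 (by omega)]
    simp only [hcz, ← Finset.sum_mul, ← Finset.mul_sum]
    ring

theorem upSum_eq_zero (b : Submodule F V → ℝ) (X : Submodule F V) (k : ℕ)
    (hh : ∀ U, X ≤ U → finrank F U < k → meetSum b X U X = 0) :
    ∀ Y, X ≤ Y → finrank F Y < k → upSum b Y = 0 := by
  induction k with
  | zero => intro Y _ h; omega
  | succ k ih =>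
    have hg := ih fun U hU hk => hh U hU (by omega)
    intro Y hY hk
    by_cases hk' : finrank F Y < k
    · exact hg Y hY hk'
    · have hle := Submodule.finrank_mono hY
      obtain ⟨c, hc, h⟩ := meetSum_eq_upSum b X k hg (finrank F Y - finrank F X) Y X
        (inf_eq_right.2 hY) (by omega) (by omega)
      rw [hh Y hY hk, sup_eq_left.2 hY] at h
      simpa [hc.ne'] using h.symm

variable [Finite F]

theorem card_submodule (W : Submodule F V) : Nat.card W = Nat.card F ^ finrank F W :=
  Module.natCard_eq_pow_finrank

open Classical in
theorem sum_not_mem_sup (X S U W : Submodule F V) [Fintype S] (hWU : W ⊓ U = X) (hU : U ≤ S)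
    (hW : W ≤ S) :
    (∑ v : S, if (v : V) ∉ U ∧ W ⊓ (U ⊔ F ∙ (v : V)) = X then (1 : ℝ) else 0) =
      (Nat.card F : ℝ) ^ finrank F S -
        (Nat.card F : ℝ) ^ (finrank F U + finrank F W - finrank F X) := by
  have h1 : ∀ v : S, (if (v : V) ∉ U ∧ W ⊓ (U ⊔ F ∙ (v : V)) = X then (1 : ℝ) else 0) =
      1 - if (v : V) ∈ U ⊔ W then 1 else 0 := by
    intro v
    by_cases hv : (v : V) ∈ U ⊔ W
    · rw [if_pos hv, if_neg, sub_self]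
      rintro ⟨hvU, hX⟩
      obtain ⟨u, hu, x, hx, hux⟩ := Submodule.mem_sup.1 hv
      have hxX : x ∈ X := by
        rw [← hX]
        refine ⟨hx, ?_⟩
        rw [← add_sub_cancel_left u x, hux]
        exact Submodule.sub_mem _ (Submodule.mem_sup_right (Submodule.mem_span_singleton_self _))
          (Submodule.mem_sup_left hu)
      have hxU : x ∈ U := (hWU ▸ inf_le_right : X ≤ U) hxX
      exact hvU (hux ▸ U.add_mem hu hxU)
    · rw [if_neg hv, if_pos, sub_zero]
      refine ⟨fun h => hv (Submodule.mem_sup_left h), inf_sup_span_eq X U W hWU _ ?_⟩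
      intro z hz hzW
      refine hv ?_
      rw [← add_sub_cancel_right (v : V) z]
      exact Submodule.sub_mem _ (Submodule.mem_sup_right hzW) (Submodule.mem_sup_left hz)
  have h2 : Nat.card {v : S // (v : V) ∈ U ⊔ W} = Nat.card ↥(U ⊔ W) :=
    Nat.card_congr (Equiv.subtypeSubtypeEquivSubtype fun h => (sup_le hU hW) h)
  have h3 : finrank F ↥(U ⊔ W) = finrank F U + finrank F W - finrank F X := by
    have := Submodule.finrank_sup_add_finrank_inf_eq U W
    rw [inf_comm, hWU] at this
    omega
  rw [Nat.card_eq_fintype_card, Fintype.card_subtype] at h2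
  simp only [h1, Finset.sum_sub_distrib, Finset.sum_const, nsmul_eq_mul, mul_one,
    ← Finset.sum_filter]
  rw [← h3, ← Nat.cast_pow, ← Nat.cast_pow, ← card_submodule, ← card_submodule, ← h2,
    Nat.card_eq_fintype_card, Finset.card_univ]

open Classical in
theorem meetSum_eq_zero_of_sup_span (b : Submodule F V → ℝ) (X S U : Submodule F V) (w : ℕ)
    (hb : ∀ W, X ≤ W → b W ≠ 0 → finrank F W = w ∧ W ≤ S) (hXU : X ≤ U) (hUS : U ≤ S)
    (hlt : finrank F U + w < finrank F X + finrank F S)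
    (h : ∀ v ∈ S, v ∉ U → meetSum b X (U ⊔ F ∙ v) X = 0) : meetSum b X U X = 0 := by
  have := Fintype.ofFinite S
  have hsum : ∑ v : S, (if (v : V) ∉ U then meetSum b X (U ⊔ F ∙ (v : V)) X else 0) = 0 :=
    Finset.sum_eq_zero fun v _ => by
      by_cases hv : (v : V) ∈ U
      · rw [if_neg (not_not.2 hv)]
      · rw [if_pos hv, h v v.2 hv]
  have hmul : ∑ v : S, (if (v : V) ∉ U then meetSum b X (U ⊔ F ∙ (v : V)) X else 0) =
      ((Nat.card F : ℝ) ^ finrank F S - (Nat.card F : ℝ) ^ (finrank F U + w - finrank F X)) *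
        meetSum b X U X := by
    simp only [meetSum]
    rw [Finset.mul_sum]
    simp only [← Finset.sum_filter (fun v : S => (v : V) ∉ U)]
    rw [Finset.sum_comm]
    refine Finset.sum_congr rfl fun W _ => ?_
    rw [Finset.sum_filter]
    by_cases hXW : X ≤ W
    · by_cases hbW : b W = 0
      · simp [hbW]
      obtain ⟨hw, hWS⟩ := hb W hXW hbW
      by_cases hWU : W ⊓ U = X
      · rw [if_pos ⟨hXW, hWU⟩, ← hw, ← sum_not_mem_sup X S U W hWU hUS hWS, Finset.sum_mul]
        refine Finset.sum_congr rfl fun v _ => ?_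
        simp only [hXW, true_and, ite_and, ite_mul, one_mul, zero_mul]
      · have : ∀ v : V, W ⊓ (U ⊔ F ∙ v) ≠ X := fun v hv =>
          hWU (le_antisymm (hv ▸ inf_le_inf_left _ le_sup_left) (le_inf hXW hXU))
        simp [hWU, this]
    · simp [hXW]
  rw [hsum] at hmul
  refine (mul_eq_zero.1 hmul.symm).resolve_left (sub_pos.2 ?_).ne'
  refine pow_lt_pow_right₀ ?_ ?_
  · exact_mod_cast Finite.one_lt_card
  · have := Submodule.finrank_mono hUS
    have := Submodule.finrank_mono hXU
    omega

end Vanishing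

section Grading

variable {F V : Type*} [Field F] [AddCommGroup V] [Module F V] [Finite V]

open Classical in
/-- The projection onto the component of degree `j`. -/
noncomputable def proj (j : ℕ) : MobiusAlgebra F V →ₗ[ℝ] MobiusAlgebra F V :=
  (stdBasis F V).constr ℝ fun W => if finrank F W = j then y W else 0

open Classical in
theorem proj_y (j : ℕ) (W : Submodule F V) :
    proj j (y W) = if finrank F W = j then y W else 0 := by
  simp only [proj, y, Basis.constr_basis]

open Classical in
theorem coef_proj (j : ℕ) (W : Submodule F V) (a : MobiusAlgebra F V) :
    coef W (proj j a) = if finrank F W = j then coef W a else 0 := by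
  have : coef W ∘ₗ proj j = (if finrank F W = j then (1 : ℝ) else 0) • coef W := by
    refine hom_ext fun U => ?_
    simp only [LinearMap.comp_apply, proj_y, LinearMap.smul_apply, coef_y, smul_eq_mul]
    by_cases h : W = U
    · subst h
      by_cases h' : finrank F W = j <;> simp [h', coef_y]
    · by_cases h' : finrank F U = j <;> simp [h, h', coef_y]
  have := LinearMap.congr_fun this a
  simp only [LinearMap.comp_apply, LinearMap.smul_apply, smul_eq_mul] at this
  rw [this]
  split_ifs <;> simp

/-- The homogeneous elements of degree `j`. -/
noncomputable def gr (F V : Type*) [Field F] [AddCommGroup V] [Module F V] [Finite V] (j : ℕ) :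
    Submodule ℝ (MobiusAlgebra F V) := LinearMap.range (proj j)

theorem proj_proj (j : ℕ) (a : MobiusAlgebra F V) : proj j (proj j a) = proj j a :=
  ext_coef fun W => by
    rw [coef_proj, coef_proj]
    split_ifs <;> rfl

theorem proj_proj_of_ne {i j : ℕ} (h : i ≠ j) (a : MobiusAlgebra F V) : proj i (proj j a) = 0 :=
  ext_coef fun W => by
    rw [coef_proj, coef_proj, map_zero]
    split_ifs <;> first | rfl | omega

theorem mem_gr_iff {j : ℕ} {a : MobiusAlgebra F V} : a ∈ gr F V j ↔ proj j a = a := by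
  constructor
  · rintro ⟨b, rfl⟩
    exact proj_proj j b
  · exact fun h => ⟨a, h⟩

theorem finrank_eq_of_coef_ne_zero {j : ℕ} {a : MobiusAlgebra F V} (ha : a ∈ gr F V j)
    {W : Submodule F V} (hW : coef W a ≠ 0) : finrank F W = j := by
  rw [← mem_gr_iff.1 ha, coef_proj] at hW
  by_contra h
  exact hW (if_neg h)

theorem proj_mem_gr (j : ℕ) (a : MobiusAlgebra F V) : proj j a ∈ gr F V j := ⟨a, rfl⟩

theorem y_mem_gr (W : Submodule F V) : y W ∈ gr F V (finrank F W) := by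
  rw [mem_gr_iff, proj_y, if_pos rfl]

theorem sum_proj (a : MobiusAlgebra F V) :
    ∑ j ∈ Finset.range (finrank F V + 1), proj j a = a := by
  refine ext_coef fun W => ?_
  rw [map_sum]
  simp only [coef_proj]
  rw [Finset.sum_ite_eq, if_pos]
  exact Finset.mem_range.2 (Nat.lt_succ_of_le (Submodule.finrank_le W))

theorem finrank_sup_of_disjoint {U W : Submodule F V} (h : Disjoint U W) :
    finrank F ↥(U ⊔ W) = finrank F U + finrank F W := by
  have := Submodule.finrank_sup_add_finrank_inf_eq U W
  rw [disjoint_iff.1 h, finrank_bot] at this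
  simpa using this

theorem mul_mem_gr {i j : ℕ} {a b : MobiusAlgebra F V} (ha : a ∈ gr F V i) (hb : b ∈ gr F V j) :
    a * b ∈ gr F V (i + j) := by
  rw [← sum_coef a, ← sum_coef b, Finset.sum_mul_sum]
  refine Submodule.sum_mem _ fun U _ => Submodule.sum_mem _ fun W _ => ?_
  by_cases hU : coef U a = 0
  · simp [hU]
  by_cases hW : coef W b = 0
  · simp [hW]
  rw [smul_mul_smul_comm]
  refine Submodule.smul_mem _ _ ?_
  rw [y_mul_y]
  split_ifs with hd
  · have := y_mem_gr (U ⊔ W)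
    rwa [finrank_sup_of_disjoint hd, finrank_eq_of_coef_ne_zero ha hU,
      finrank_eq_of_coef_ne_zero hb hW] at this
  · exact Submodule.zero_mem _

theorem one_mem_gr : (1 : MobiusAlgebra F V) ∈ gr F V 0 := by
  have := y_mem_gr (⊥ : Submodule F V)
  rwa [finrank_bot] at this

theorem pow_mem_gr {a : MobiusAlgebra F V} (ha : a ∈ gr F V 1) (n : ℕ) : a ^ n ∈ gr F V n := by
  induction n with
  | zero => simpa using one_mem_gr
  | succ n ih =>
    rw [pow_succ]
    exact mul_mem_gr ih ha

theorem proj_mul {i : ℕ} {a : MobiusAlgebra F V} (ha : a ∈ gr F V i) (j : ℕ)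
    (b : MobiusAlgebra F V) : proj (i + j) (a * b) = a * proj j b := by
  conv_lhs => rw [← sum_proj b, Finset.mul_sum, map_sum]
  by_cases hj : j ∈ Finset.range (finrank F V + 1)
  · rw [Finset.sum_eq_single_of_mem j hj]
    · exact mem_gr_iff.1 (mul_mem_gr ha (proj_mem_gr j b))
    · intro k _ hk
      rw [← mem_gr_iff.1 (mul_mem_gr ha (proj_mem_gr k b)), proj_proj_of_ne (by omega)]
  · have h0 : proj j b = 0 := ext_coef fun W => by
      rw [coef_proj, if_neg, map_zero]
      rintro rfl
      exact hj (Finset.mem_range.2 (Nat.lt_succ_of_le (Submodule.finrank_le W)))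
    rw [h0, mul_zero]
    refine Finset.sum_eq_zero fun k hk => ?_
    rw [← mem_gr_iff.1 (mul_mem_gr ha (proj_mem_gr k b)), proj_proj_of_ne]
    rintro h
    obtain rfl : j = k := by omega
    exact hj hk

/-- The degree map, the coefficient at the whole space. -/
noncomputable def deg : MobiusAlgebra F V →ₗ[ℝ] ℝ := coef ⊤

theorem deg_eq_zero_of_mem_gr {j : ℕ} {a : MobiusAlgebra F V} (ha : a ∈ gr F V j)
    (hj : j ≠ finrank F V) : deg a = 0 := by
  by_contra h
  have := finrank_eq_of_coef_ne_zero ha h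
  rw [finrank_top] at this
  exact hj this.symm

theorem deg_proj_mul {j k : ℕ} (hjk : j + k = finrank F V) (a b : MobiusAlgebra F V) :
    deg (proj j a * b) = deg (a * proj k b) := by
  have h1 : deg (proj j a * b) = deg (proj j a * proj k b) := by
    rw [← proj_mul (proj_mem_gr j a) k b, hjk]
    simp [deg, coef_proj]
  have h2 : deg (a * proj k b) = deg (proj j a * proj k b) := by
    rw [mul_comm, mul_comm (proj j a), ← proj_mul (proj_mem_gr k b) j a, add_comm, hjk]
    simp [deg, coef_proj]
  rw [h1, h2]

open Classical in
theorem deg_mul_y (a : MobiusAlgebra F V) (U : Submodule F V) :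
    deg (a * y U) = ∑ W, if W ⊓ U = ⊥ ∧ W ⊔ U = ⊤ then coef W a else 0 := by
  conv_lhs => rw [← sum_coef a, Finset.sum_mul, map_sum]
  refine Finset.sum_congr rfl fun W _ => ?_
  rw [smul_mul_assoc, y_mul_y, map_smul, disjoint_iff, deg]
  by_cases h1 : W ⊓ U = ⊥ <;> by_cases h2 : W ⊔ U = ⊤ <;> 
    simp [h1, h2, coef_y, eq_comm (a := (⊤ : Submodule F V))]

theorem le_of_coef_y_mul_ne_zero {X W : Submodule F V} {a : MobiusAlgebra F V}
    (h : coef W (y X * a) ≠ 0) : X ≤ W := by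
  by_contra hX
  refine h ?_
  conv_lhs => rw [← sum_coef a, Finset.mul_sum, map_sum]
  refine Finset.sum_eq_zero fun U _ => ?_
  rw [mul_smul_comm, map_smul, y_mul_y]
  split_ifs with hd
  · rw [coef_y, if_neg, smul_zero]
    rintro rfl
    exact hX le_sup_left
  · simp

open Classical in
/-- The degree one element attached to a vector. -/
noncomputable def pt (F : Type*) {V : Type*} [Field F] [AddCommGroup V] [Module F V] [Finite V]
    (v : V) : MobiusAlgebra F V := if v = 0 then 0 else y (F ∙ v)

theorem pt_mem_gr (v : V) : pt F v ∈ gr F V 1 := by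
  rw [pt]
  split_ifs with h
  · exact Submodule.zero_mem _
  · have := y_mem_gr (F ∙ v)
    rwa [finrank_span_singleton h] at this

open Classical in
theorem pt_mul_y (v : V) (W : Submodule F V) :
    pt F v * y W = if v ∈ W then 0 else y (W ⊔ F ∙ v) := by
  by_cases h0 : v = 0
  · simp [pt, h0]
  · rw [pt, if_neg h0, y_mul_y, disjoint_comm, Submodule.disjoint_span_singleton' h0, sup_comm]
    by_cases h : v ∈ W <;> simp [h]

theorem pt_mul_y_of_mem {v : V} {W : Submodule F V} (h : v ∈ W) : pt F v * y W = 0 := by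
  rw [pt_mul_y, if_pos h]

theorem pt_mul_y_of_not_mem {v : V} {W : Submodule F V} (h : v ∉ W) :
    pt F v * y W = y (W ⊔ F ∙ v) := by
  rw [pt_mul_y, if_neg h]

theorem coef_eq_upSum {w : ℕ} {b : Submodule F V → ℝ} {Y : Submodule F V}
    (hb : ∀ W, Y ≤ W → b W ≠ 0 → finrank F W = w) (hY : finrank F Y = w) : upSum b Y = b Y := by
  classical
  rw [upSum, Finset.sum_eq_single Y]
  · rw [if_pos le_rfl]
  · intro W _ hW
    split_ifs with h
    · by_contra hne
      exact hW (Submodule.eq_of_le_of_finrank_eq h (hY.trans (hb W h hne).symm)).symm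
    · rfl
  · simp

variable [Finite F]

theorem eq_zero_of_meetSum {b : Submodule F V → ℝ} {S : Submodule F V} {w : ℕ}
    (hb : ∀ W, b W ≠ 0 → finrank F W = w ∧ W ≤ S)
    (h : ∀ U ≤ S, finrank F U + w = finrank F S → meetSum b ⊥ U ⊥ = 0) (W : Submodule F V) :
    b W = 0 := by
  classical
  have h1 : ∀ n, ∀ U ≤ S, finrank F U + w + n = finrank F S → meetSum b ⊥ U ⊥ = 0 := by
    intro n
    induction n with
    | zero => exact h
    | succ n ih =>
      intro U hU hn
      refine meetSum_eq_zero_of_sup_span b ⊥ S U w (fun W _ => hb W) bot_le hU ?_ ?_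
      · rw [finrank_bot]; omega
      · intro v hv hvU
        refine ih _ (sup_le hU ((Submodule.span_singleton_le_iff_mem _ _).2 hv)) ?_
        rw [finrank_sup_span U hvU]; omega
  have h2 : ∀ U ≤ S, meetSum b ⊥ U ⊥ = 0 := by
    intro U hU
    by_cases hn : finrank F U + w ≤ finrank F S
    · exact h1 (finrank F S - (finrank F U + w)) U hU (by omega)
    · refine Finset.sum_eq_zero fun W _ => ?_
      split_ifs with hW
      · by_contra hne
        obtain ⟨hw, hWS⟩ := hb W hne
        have := finrank_sup_of_disjoint (disjoint_iff.2 hW.2)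
        have := Submodule.finrank_mono (sup_le hWS hU)
        omega
      · rfl
  have h3 : ∀ U, meetSum b ⊥ U ⊥ = 0 := by
    intro U
    rw [← h2 (U ⊓ S) inf_le_right]
    refine Finset.sum_congr rfl fun W _ => ?_
    by_cases hne : b W = 0
    · simp [hne]
    · rw [show W ⊓ (U ⊓ S) = W ⊓ U by
        rw [inf_comm U, ← inf_assoc, inf_eq_left.2 (hb W hne).2]]
  by_contra hne
  have := upSum_eq_zero b ⊥ (w + 1) (fun U _ _ => h3 U) W bot_le (by rw [(hb W hne).1]; omega)
  rw [coef_eq_upSum (fun W _ => fun h => (hb W h).1) (hb W hne).1] at this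
  exact hne this

open Classical in
theorem eq_zero_of_complSum {a : MobiusAlgebra F V} {S : Submodule F V}
    (ha : ∀ W, coef W a ≠ 0 → W ≤ S)
    (h : ∀ U ≤ S, ∑ W, (if W ⊓ U = ⊥ ∧ W ⊔ U = S then coef W a else 0) = 0) : a = 0 := by
  refine coef_zero' a fun W => ?_
  have := eq_zero_of_meetSum (b := fun T => coef T (proj (finrank F W) a)) (S := S)
    (w := finrank F W) ?_ ?_ W
  · simpa [coef_proj] using this
  · intro U hU
    rw [coef_proj] at hU
    split_ifs at hU with hr
    · exact ⟨hr, ha U hU⟩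
    · exact absurd rfl hU
  · intro U hU hr
    rw [← h U hU, meetSum]
    refine Finset.sum_congr rfl fun T _ => ?_
    rw [coef_proj]
    by_cases hT : coef T a = 0
    · simp [hT]
    by_cases hd : T ⊓ U = ⊥
    · have hrk := finrank_sup_of_disjoint (disjoint_iff.2 hd)
      have hiff : finrank F T = finrank F W ↔ T ⊔ U = S := by
        constructor
        · intro hTW
          exact Submodule.eq_of_le_of_finrank_eq (sup_le (ha T hT) hU) (by omega)
        · intro hS
          rw [hS] at hrk
          omega
      simp [hd, hiff]
    · simp [hd]

/-- The degree pairing is nondegenerate. -/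
theorem eq_zero_of_deg_mul {a : MobiusAlgebra F V} (h : ∀ b, deg (a * b) = 0) : a = 0 :=
  eq_zero_of_complSum (S := ⊤) (fun _ _ => le_top) fun U _ => (deg_mul_y a U).symm.trans (h _)

end Grading

section Uniform

variable {F V : Type*} [Field F] [AddCommGroup V] [Module F V] [Finite V]

/-- The degree one element with coefficients `x` on `E`. -/
noncomputable def lin (F : Type*) {V : Type*} [Field F] [AddCommGroup V] [Module F V] [Finite V]
    (E : Finset V) (x : V → ℝ) : MobiusAlgebra F V := ∑ v ∈ E, x v • pt F v

theorem lin_mem_gr (E : Finset V) (x : V → ℝ) : lin F E x ∈ gr F V 1 :=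
  Submodule.sum_mem _ fun v _ => Submodule.smul_mem _ _ (pt_mem_gr v)

/-- The Hodge–Riemann relations for `L` on the image of `I` under multiplication by `y X`. -/
def HodgeRiemann (I : Submodule ℝ (MobiusAlgebra F V)) (L : MobiusAlgebra F V)
    (X : Submodule F V) (j : ℕ) : Prop :=
  ∀ n a, a ∈ I → a ∈ gr F V j → 2 * j + n + finrank F X = finrank F V →
    L ^ (n + 1) * (y X * a) = 0 → y X * a ≠ 0 → 0 < (-1) ^ j * deg (L ^ n * (y X * a) * a)

variable [Finite F]

theorem exists_deg_pow_mul_y [Fintype V] (k : ℕ) : ∃ C : ℝ, 0 < C ∧ ∀ U : Submodule F V,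
    finrank F U + k = finrank F V → deg (lin F (Finset.univ : Finset V) 1 ^ k * y U) = C := by
  classical
  induction k with
  | zero =>
    refine ⟨1, one_pos, fun U hU => ?_⟩
    have : U = ⊤ := Submodule.eq_top_of_finrank_eq (by simpa using hU)
    rw [pow_zero, one_mul, this, deg, coef_y, if_pos rfl]
  | succ k ih =>
    obtain ⟨C, hC, h⟩ := ih
    by_cases hk : k + 1 ≤ finrank F V
    · refine ⟨((Nat.card F : ℝ) ^ finrank F V - (Nat.card F : ℝ) ^ (finrank F V - (k + 1))) * C,
        mul_pos (sub_pos.2 (pow_lt_pow_right₀ ?_ (by omega))) hC, fun U hU => ?_⟩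
      · exact_mod_cast Finite.one_lt_card
      · have h1 : ∀ v : V, deg (lin F (Finset.univ : Finset V) 1 ^ k * (pt F v * y U)) =
            C - if v ∈ U then C else 0 := by
          intro v
          by_cases hv : v ∈ U
          · rw [pt_mul_y_of_mem hv, mul_zero, map_zero, if_pos hv, sub_self]
          · rw [pt_mul_y_of_not_mem hv, if_neg hv, sub_zero]
            exact h _ (by rw [finrank_sup_span U hv]; omega)
        have h2 : lin F (Finset.univ : Finset V) 1 ^ (k + 1) * y U =
            ∑ v : V, lin F (Finset.univ : Finset V) 1 ^ k * (pt F v * y U) := by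
          rw [pow_succ, mul_assoc, ← Finset.mul_sum, ← Finset.sum_mul]
          congr 2
          simp [lin]
        rw [h2, map_sum]
        simp only [h1, Finset.sum_sub_distrib, Finset.sum_const, nsmul_eq_mul,
          ← Finset.sum_filter]
        have h3 : (Finset.univ.filter fun v : V => v ∈ U).card = Nat.card F ^ finrank F U := by
          rw [← card_submodule, ← Fintype.card_subtype, Nat.card_eq_fintype_card]
        have h4 : (Finset.univ : Finset V).card = Nat.card F ^ finrank F V := by
          rw [Finset.card_univ, ← Nat.card_eq_fintype_card, Module.natCard_eq_pow_finrank (K := F)]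
        rw [h3, h4, show finrank F V - (k + 1) = finrank F U by omega]
        push_cast
        ring
    · exact ⟨1, one_pos, fun U hU => absurd hU (by omega)⟩

open Classical in
theorem deg_mul_mul_y {L b : MobiusAlgebra F V} {w k : ℕ} {C : ℝ} {Z : Submodule F V}
    (hL : ∀ U : Submodule F V, finrank F U + k = finrank F V → deg (L * y U) = C)
    (hb : b ∈ gr F V w) (hZ : finrank F Z + w + k = finrank F V) :
    deg (L * (b * y Z)) = C * ∑ W, if W ⊓ Z = ⊥ then coef W b else 0 := by
  conv_lhs => rw [← sum_coef b, Finset.sum_mul, Finset.mul_sum, map_sum]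
  rw [Finset.mul_sum]
  refine Finset.sum_congr rfl fun W _ => ?_
  by_cases hW : coef W b = 0
  · simp [hW]
  rw [smul_mul_assoc, mul_smul_comm, map_smul, smul_eq_mul, y_mul_y, disjoint_iff]
  split_ifs with hd
  · rw [hL, mul_comm]
    rw [finrank_sup_of_disjoint (disjoint_iff.2 hd), finrank_eq_of_coef_ne_zero hb hW]
    omega
  · simp

theorem deg_mul_mul_y_eq_meetSum {L b : MobiusAlgebra F V} {w k : ℕ} {C : ℝ}
    {X Z : Submodule F V}
    (hL : ∀ U : Submodule F V, finrank F U + k = finrank F V → deg (L * y U) = C)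
    (hb : b ∈ gr F V w) (hZ : finrank F Z + w + k = finrank F V)
    (hX : ∀ W, coef W b ≠ 0 → X ≤ W) (hXZ : Disjoint X Z) :
    deg (L * (b * y Z)) = C * meetSum (fun W => coef W b) X (X ⊔ Z) X := by
  classical
  rw [deg_mul_mul_y hL hb hZ, meetSum]
  congr 1
  refine Finset.sum_congr rfl fun W _ => ?_
  by_cases hW : coef W b = 0
  · simp [hW]
  have hXW := hX W hW
  refine if_congr ?_ rfl rfl
  have h1 : W ⊓ (X ⊔ Z) = X ⊔ W ⊓ Z := by
    rw [inf_comm, sup_inf_assoc_of_le Z hXW, inf_comm]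
  rw [h1, sup_eq_left]
  constructor
  · intro h
    exact ⟨hXW, h ▸ bot_le⟩
  · rintro ⟨-, h⟩
    exact le_bot_iff.1 ((le_inf h inf_le_right).trans (disjoint_iff.1 hXZ).le)

theorem hodgeRiemann_uniform [Fintype V] (X : Submodule F V) (j : ℕ) :
    HodgeRiemann ⊤ (lin F (Finset.univ : Finset V) 1) X j := by
  classical
  intro n a _ ha hn hprim hne
  set L := lin F (Finset.univ : Finset V) 1 with hLdef
  set b := y X * a with hbdef
  have hb : b ∈ gr F V (finrank F X + j) := mul_mem_gr (y_mem_gr X) ha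
  have hXb : ∀ W, coef W b ≠ 0 → X ≤ W := fun W => le_of_coef_y_mul_ne_zero
  have hdesc : ∀ i, ∀ U, X ≤ U → finrank F U + 1 + i = finrank F X + j →
      meetSum (fun W => coef W b) X U X = 0 := by
    intro i
    induction i with
    | zero =>
      intro U hU hr
      obtain ⟨Z, hd, rfl⟩ := IsModularLattice.exists_disjoint_and_sup_eq hU
      have hrk := finrank_sup_of_disjoint hd
      obtain ⟨C, hC, h⟩ := exists_deg_pow_mul_y (F := F) (V := V) (n + 1)
      have := deg_mul_mul_y_eq_meetSum h hb (Z := Z) (by omega) hXb hd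
      rw [← hLdef, ← mul_assoc, hprim, zero_mul, map_zero] at this
      exact (mul_eq_zero.1 this.symm).resolve_left hC.ne'
    | succ i ih =>
      intro U hU hr
      refine meetSum_eq_zero_of_sup_span _ X ⊤ U (finrank F X + j)
        (fun W _ hW => ⟨finrank_eq_of_coef_ne_zero hb hW, le_top⟩) hU le_top ?_ ?_
      · rw [finrank_top]; omega
      · intro v _ hv
        exact ih _ (hU.trans le_sup_left) (by rw [finrank_sup_span U hv]; omega)
  have hg := upSum_eq_zero (fun W => coef W b) X (finrank F X + j)
    fun U hU hr => hdesc (finrank F X + j - (finrank F U + 1)) U hU (by omega)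
  have hkey : ∀ U, ∃ c : ℝ, 0 < c ∧ (X ≤ U → finrank F U = finrank F X + j →
      meetSum (fun W => coef W b) X U X = (-1) ^ j * c * coef U b) := by
    intro U
    by_cases h : X ≤ U ∧ finrank F U = finrank F X + j
    · obtain ⟨c, hc, h'⟩ := meetSum_eq_upSum _ X _ hg j U X (inf_eq_right.2 h.1) h.2 (by omega)
      refine ⟨c, hc, fun _ _ => ?_⟩
      rw [h', sup_eq_left.2 h.1,
        coef_eq_upSum (fun W _ hW => finrank_eq_of_coef_ne_zero hb hW) h.2]
    · exact ⟨1, one_pos, fun h1 h2 => absurd ⟨h1, h2⟩ h⟩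
  choose c hc hcU using hkey
  obtain ⟨C, hC, hCU⟩ := exists_deg_pow_mul_y (F := F) (V := V) n
  let Φ : MobiusAlgebra F V →ₗ[ℝ] ℝ :=
    ∑ U, (C * meetSum (fun W => coef W b) X U X) • coef U
  have hΦ : ∀ t ∈ gr F V j, deg (L ^ n * b * t) = Φ (y X * t) := by
    intro t ht
    conv_lhs => rw [← sum_coef t, Finset.mul_sum, map_sum]
    conv_rhs => rw [← sum_coef t, Finset.mul_sum, map_sum]
    refine Finset.sum_congr rfl fun T _ => ?_
    by_cases hT : coef T t = 0
    · simp [hT]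
    have hrT := finrank_eq_of_coef_ne_zero ht hT
    rw [mul_smul_comm, mul_smul_comm, map_smul, map_smul, mul_assoc]
    congr 1
    by_cases hd : Disjoint X T
    · rw [y_mul_y, if_pos hd, deg_mul_mul_y_eq_meetSum hCU hb (by omega) hXb hd]
      simp [Φ, coef_y]
    · rw [y_mul_y, if_neg hd, map_zero, deg_mul_mul_y hCU hb (by omega),
        Finset.sum_eq_zero, mul_zero]
      intro W _
      split_ifs with hW
      · by_contra hne
        exact hd ((disjoint_iff.2 hW).mono_left (hXb W hne))
      · rfl
  rw [hΦ a ha, ← hbdef]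
  have hΦb : Φ b = ∑ U, (-1) ^ j * C * (c U * coef U b ^ 2) := by
    simp only [Φ, LinearMap.sum_apply, LinearMap.smul_apply, smul_eq_mul]
    refine Finset.sum_congr rfl fun U _ => ?_
    by_cases hU : coef U b = 0
    · simp [hU]
    rw [hcU U (hXb U hU) (finrank_eq_of_coef_ne_zero hb hU)]
    ring
  rw [hΦb, ← Finset.mul_sum, ← mul_assoc, ← mul_assoc, ← mul_pow]
  norm_num
  refine mul_pos hC ?_
  have hnn : ∀ U, 0 ≤ c U * coef U b ^ 2 := fun U => mul_nonneg (hc U).le (sq_nonneg _)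
  refine lt_of_le_of_ne (Finset.sum_nonneg fun U _ => hnn U) fun h0 => hne ?_
  refine coef_zero' b fun U => ?_
  have := (Finset.sum_eq_zero_iff_of_nonneg fun U _ => hnn U).1 h0.symm U (Finset.mem_univ U)
  simpa [(hc U).ne'] using this

end Uniform

section Split

variable {M : Type*} [AddCommGroup M] [Module ℝ M] [FiniteDimensional ℝ M]

/-- The form `B` is nondegenerate on the subspace `I`. -/
def NondegOn (B : LinearMap.BilinForm ℝ M) (I : Submodule ℝ M) : Prop :=
  ∀ a ∈ I, (∀ b ∈ I, B a b = 0) → a = 0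

theorem NondegOn.exists_proj {B : LinearMap.BilinForm ℝ M} {N : Submodule ℝ M}
    (hN : NondegOn B N) :
    ∃ P : M →ₗ[ℝ] N, (∀ x : N, P x = x) ∧ ∀ x, ∀ b ∈ N, B (P x) b = B x b := by
  let R : M →ₗ[ℝ] Dual ℝ N := LinearMap.lcomp ℝ ℝ N.subtype ∘ₗ B
  have hinj : Function.Injective (R ∘ₗ N.subtype) := by
    rw [← LinearMap.ker_eq_bot, LinearMap.ker_eq_bot']
    intro a ha
    exact Subtype.ext (hN a a.2 fun b hb => LinearMap.congr_fun ha ⟨b, hb⟩)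
  let e := LinearMap.linearEquivOfInjective (R ∘ₗ N.subtype) hinj Subspace.dual_finrank_eq.symm
  have he : ∀ x : M, R (e.symm (R x) : N) = R x := fun x => e.apply_symm_apply (R x)
  refine ⟨e.symm.toLinearMap ∘ₗ R, fun x => ?_, fun x b hb => ?_⟩
  · exact e.symm_apply_apply x
  · exact LinearMap.congr_fun (he x) ⟨b, hb⟩

theorem NondegOn.exists_split {B : LinearMap.BilinForm ℝ M} (hB : ∀ a b, B a b = B b a)
    {I N : Submodule ℝ M} (hI : NondegOn B I) (hN : NondegOn B N) (ops : Set (M →ₗ[ℝ] M))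
    (hops : ∀ s ∈ ops, ∃ s' ∈ ops, ∀ a b, B (s a) b = B a (s' b))
    (hIs : ∀ s ∈ ops, ∀ a ∈ I, s a ∈ I) (hNs : ∀ s ∈ ops, ∀ a ∈ N, s a ∈ N)
    {a : M} (haI : a ∈ I) (haN : a ∈ N) (ha : a ≠ 0) :
    ∃ I' ≤ I, (∀ s ∈ ops, ∀ b ∈ I', s b ∈ I') ∧ NondegOn B I' ∧ a ∉ I' ∧
      ∀ b ∈ I, (∀ c ∈ N, B b c = 0) → b ∈ I' := by
  obtain ⟨Q, hQ, hQB⟩ := hI.exists_proj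
  obtain ⟨P, hP, hPB⟩ := hN.exists_proj
  have hcomm : ∀ (K : Submodule ℝ M) (R : M →ₗ[ℝ] K), NondegOn B K →
      (∀ s ∈ ops, ∀ a ∈ K, s a ∈ K) → (∀ x, ∀ b ∈ K, B (R x) b = B x b) →
      ∀ s ∈ ops, ∀ x, (R (s x) : M) = s (R x) := by
    intro K R hK hKs hR s hs x
    obtain ⟨s', hs', hadj⟩ := hops s hs
    refine sub_eq_zero.1 (hK _ (K.sub_mem (R _).2 (hKs s hs _ (R x).2)) fun b hb => ?_)
    rw [map_sub, LinearMap.sub_apply, hR _ b hb, hadj, hadj, hR _ _ (hKs s' hs' b hb), sub_self]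
  let T : Module.End ℝ I := Q ∘ₗ N.subtype ∘ₗ P ∘ₗ I.subtype
  have hTB : ∀ x z : I, B (T x) z = B x (T z) := by
    intro x z
    have h1 : ∀ x z : I, B (T x) z = B (P x) (P z) := by
      intro x z
      calc B (T x) z = B (P x) z := hQB (P x : M) z z.2
        _ = B z (P x) := hB _ _
        _ = B (P z) (P x) := (hPB z _ (P x).2).symm
        _ = B (P x) (P z) := hB _ _
    rw [h1, hB (x : M), h1, hB]
  have hTnB : ∀ (n : ℕ) (x z : I), B ((T ^ n) x) z = B x ((T ^ n) z) := by
    intro n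
    induction n with
    | zero => simp
    | succ n ih =>
      intro x z
      rw [pow_succ', Module.End.mul_apply, hTB, ih, ← Module.End.mul_apply, ← pow_succ, pow_succ']
  have hTs : ∀ s (hs : s ∈ ops) (x : I), T ⟨s x, hIs s hs x x.2⟩ = ⟨s (T x), hIs s hs _ (T x).2⟩ := by
    intro s hs x
    refine Subtype.ext ?_
    change (Q (P (s x) : M) : M) = s (Q (P x : M) : M)
    rw [hcomm N P hN hNs hPB s hs, hcomm I Q hI hIs hQB s hs]
  have hTns : ∀ (n : ℕ) s (hs : s ∈ ops) (x : I),
      (T ^ n) ⟨s x, hIs s hs x x.2⟩ = ⟨s ((T ^ n) x), hIs s hs _ ((T ^ n) x).2⟩ := by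
    intro n s hs
    induction n with
    | zero => simp
    | succ n ih =>
      intro x
      rw [pow_succ, Module.End.mul_apply, hTs s hs x, ih, ← Module.End.mul_apply]
  obtain ⟨n, hn, hn1⟩ := ((LinearMap.eventually_isCompl_ker_pow_range_pow T).and
    (Filter.eventually_ge_atTop 1)).exists
  obtain ⟨m, rfl⟩ : ∃ m, n = m + 1 := ⟨n - 1, by omega⟩
  refine ⟨(LinearMap.ker (T ^ (m + 1))).map I.subtype, Submodule.map_subtype_le _ _, ?_, ?_, ?_, ?_⟩
  · rintro s hs _ ⟨x, hx, rfl⟩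
    refine ⟨⟨s x, hIs s hs x x.2⟩, ?_, rfl⟩
    rw [SetLike.mem_coe, LinearMap.mem_ker] at hx ⊢
    rw [hTns (m + 1) s hs x, hx]
    exact Subtype.ext (by simp)
  · rintro _ ⟨x, hx, rfl⟩ h
    refine hI _ x.2 fun b hb => ?_
    obtain ⟨u, hu, v, ⟨t, rfl⟩, huv⟩ := Submodule.mem_sup.1
      (hn.sup_eq_top ▸ Submodule.mem_top : (⟨b, hb⟩ : I) ∈ _)
    have hb' : b = (u : M) + ((T ^ (m + 1)) t : I) := (congrArg Subtype.val huv).symm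
    have hx' : (T ^ (m + 1)) x = 0 := hx
    rw [hb', map_add]
    have h1 := h u ⟨u, hu, rfl⟩
    have h2 := hTnB (m + 1) x t
    rw [hx'] at h2
    simp only [Submodule.subtype_apply] at h1 ⊢
    rw [h1, ← h2]
    simp
  · rintro ⟨x, hx, rfl⟩
    have hTx : T x = x := by
      change Q (P (x : M) : M) = x
      have h1 : P (x : M) = ⟨x, haN⟩ := hP ⟨x, haN⟩
      rw [h1]
      exact hQ x
    have : ∀ k, (T ^ k) x = x := by
      intro k
      induction k with
      | zero => rfl
      | succ k ih => rw [pow_succ, Module.End.mul_apply, hTx, ih]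
    have hx' : (T ^ (m + 1)) x = 0 := hx
    rw [this] at hx'
    exact ha (by rw [hx']; rfl)
  · intro b hb hbN
    refine ⟨⟨b, hb⟩, ?_, rfl⟩
    have hPb : P b = 0 := Subtype.ext (hN _ (P b).2 fun c hc => by rw [hPB b c hc, hbN c hc])
    have hTb : T ⟨b, hb⟩ = 0 := by
      change Q (P b : M) = 0
      rw [hPb]
      simp
    rw [SetLike.mem_coe, LinearMap.mem_ker, pow_succ, Module.End.mul_apply, hTb, map_zero]

end Split

section Path

open Matrix

variable {T κ ι : Type*} [TopologicalSpace T] [PreconnectedSpace T] [Fintype κ] [Fintype ι]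

theorem exists_neg_of_nonpos {W : Type*} [AddCommGroup W] [Module ℝ W]
    (B : LinearMap.BilinForm ℝ W) (hB : ∀ a b, B a b = B b a) {P : Submodule ℝ W} {w p : W}
    (hw : w ∈ P) (hp : p ∈ P) (hwp : B w p ≠ 0) (hww : B w w ≤ 0) : ∃ v ∈ P, B v v < 0 := by
  set s : ℝ := (|B p p| + 1)⁻¹ with hs
  have hs0 : 0 < s := by positivity
  have hs1 : s * B p p ≤ 1 := by
    have h1 : s * (|B p p| + 1) = 1 := inv_mul_cancel₀ (by positivity)
    have h2 := mul_le_mul_of_nonneg_left (le_abs_self (B p p)) hs0.le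
    linarith
  refine ⟨w + (-(s * B w p)) • p, P.add_mem hw (P.smul_mem _ hp), ?_⟩
  simp only [map_add, map_smul, LinearMap.add_apply, LinearMap.smul_apply, smul_eq_mul, hB p w]
  have h3 : 0 < s * (B w p) ^ 2 := by positivity
  nlinarith [mul_le_mul_of_nonneg_left hs1 h3.le]

theorem posDef_path_matrix [DecidableEq ι] (S : T → Matrix κ κ ℝ) (U : T → Matrix κ ι ℝ)
    (hS : Continuous S) (hU : Continuous U)
    (hsymm : ∀ t, (S t)ᵀ = S t)
    (hnd : ∀ t w, S t *ᵥ w = 0 → w = 0)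
    (hdet : ∀ t, ((U t)ᵀ * S t * U t).det ≠ 0) (t₀ t₁ : T)
    (h₁ : ∀ w, (U t₁)ᵀ *ᵥ (S t₁ *ᵥ w) = 0 → w ≠ 0 → 0 < w ⬝ᵥ (S t₁ *ᵥ w)) :
    ∀ w, (U t₀)ᵀ *ᵥ (S t₀ *ᵥ w) = 0 → w ≠ 0 → 0 < w ⬝ᵥ (S t₀ *ᵥ w) := by
  classical
  have hsw : ∀ t v w, v ⬝ᵥ (S t *ᵥ w) = w ⬝ᵥ (S t *ᵥ v) := by
    intro t v w
    rw [dotProduct_mulVec, ← mulVec_transpose, hsymm, dotProduct_comm]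
  let bad : Set T := {t | ∃ w, (U t)ᵀ *ᵥ (S t *ᵥ w) = 0 ∧ w ≠ 0 ∧ w ⬝ᵥ (S t *ᵥ w) ≤ 0}
  have hclosed : IsClosed bad := by
    let K : Set (T × Metric.sphere (0 : κ → ℝ) 1) :=
      {p | (U p.1)ᵀ *ᵥ (S p.1 *ᵥ p.2.1) = 0 ∧ p.2.1 ⬝ᵥ (S p.1 *ᵥ p.2.1) ≤ 0}
    have hK : IsClosed K := by
      have h1 : IsClosed {p : T × Metric.sphere (0 : κ → ℝ) 1 |
          (U p.1)ᵀ *ᵥ (S p.1 *ᵥ p.2.1) = 0} := isClosed_eq (by fun_prop) (by fun_prop)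
      have h2 : IsClosed {p : T × Metric.sphere (0 : κ → ℝ) 1 |
          p.2.1 ⬝ᵥ (S p.1 *ᵥ p.2.1) ≤ 0} := isClosed_le (by fun_prop) (by fun_prop)
      exact h1.inter h2
    have : bad = Prod.fst '' K := by
      ext t
      constructor
      · rintro ⟨w, hw, hw0, hle⟩
        have hn : 0 < ‖w‖ := norm_pos_iff.2 hw0
        refine ⟨(t, ⟨‖w‖⁻¹ • w, ?_⟩), ⟨?_, ?_⟩, rfl⟩
        · rw [mem_sphere_zero_iff_norm, norm_smul, norm_inv, norm_norm, inv_mul_cancel₀ hn.ne']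
        · simp only [mulVec_smul, hw, smul_zero]
        · simp only [mulVec_smul, smul_dotProduct, dotProduct_smul, smul_eq_mul]
          have : 0 < ‖w‖⁻¹ := inv_pos.2 hn
          exact mul_nonpos_of_nonneg_of_nonpos this.le
            (mul_nonpos_of_nonneg_of_nonpos this.le hle)
      · rintro ⟨⟨t, w⟩, ⟨h1, h2⟩, rfl⟩
        refine ⟨w, h1, ?_, h2⟩
        intro h0
        have := mem_sphere_zero_iff_norm.1 w.2
        rw [h0, norm_zero] at this
        exact zero_ne_one this
    rw [this]
    exact isClosedMap_fst_of_compactSpace _ hK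
  have hopen : IsOpen bad := by
    rw [isOpen_iff_mem_nhds]
    rintro t ⟨w, hw, hw0, hle⟩
    let B : LinearMap.BilinForm ℝ (κ → ℝ) := Matrix.toLinearMap₂' ℝ (S t)
    have hBdef : ∀ v w, B v w = v ⬝ᵥ (S t *ᵥ w) := fun v w => by
      simp [B, Matrix.toLinearMap₂'_apply']
    let P : Submodule ℝ (κ → ℝ) := LinearMap.ker ((U t)ᵀ.mulVecLin ∘ₗ (S t).mulVecLin)
    let ext : T → (κ → ℝ) → (κ → ℝ) := fun t v =>
      ((U t)ᵀ * S t * U t).det • v -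
        U t *ᵥ (((U t)ᵀ * S t * U t).adjugate *ᵥ ((U t)ᵀ *ᵥ (S t *ᵥ v)))
    have hext : ∀ t v, (U t)ᵀ *ᵥ (S t *ᵥ ext t v) = 0 := by
      intro t v
      simp only [ext, mulVec_sub, mulVec_smul]
      rw [sub_eq_zero]
      have h := Matrix.mul_adjugate ((U t)ᵀ * S t * U t)
      have h2 := congrArg (fun A => A *ᵥ ((U t)ᵀ *ᵥ (S t *ᵥ v))) h
      simp only [smul_mulVec, one_mulVec] at h2
      rw [← h2]
      simp only [mulVec_mulVec, Matrix.mul_assoc]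
    obtain ⟨p, hp, hwp⟩ : ∃ p ∈ P, B w p ≠ 0 := by
      by_contra! hcon
      refine hw0 (hnd t w ?_)
      refine dotProduct_eq_zero _ fun v => ?_
      have h1 := hcon (ext t v) (hext t v)
      rw [hBdef, hsw] at h1
      simp only [ext, sub_dotProduct, smul_dotProduct] at h1
      rw [dotProduct_comm (U t *ᵥ _), dotProduct_mulVec (S t *ᵥ w) (U t), ← mulVec_transpose, hw, zero_dotProduct,
        sub_zero, smul_eq_zero] at h1
      rw [dotProduct_comm]
      exact h1.resolve_left (hdet t)
    obtain ⟨v, hv, hvneg⟩ := exists_neg_of_nonpos B (fun a b => by rw [hBdef, hBdef, hsw])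
      (P := P) hw hp hwp (by rw [hBdef]; exact hle)
    have hv' : (U t)ᵀ *ᵥ (S t *ᵥ v) = 0 := hv
    have hcont : Continuous fun t => ext t v ⬝ᵥ (S t *ᵥ ext t v) := by
      have h1 : Continuous fun t => ext t v := by
        have hG : Continuous fun t => (U t)ᵀ * S t * U t := by fun_prop
        have := hG.matrix_det
        have := hG.matrix_adjugate
        simp only [ext]
        fun_prop
      fun_prop
    have hneg : ext t v ⬝ᵥ (S t *ᵥ ext t v) < 0 := by
      have : ext t v = ((U t)ᵀ * S t * U t).det • v := by
        simp only [ext, hv', mulVec_zero, sub_zero]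
      rw [this, mulVec_smul, smul_dotProduct, dotProduct_smul, ← hBdef, smul_eq_mul, smul_eq_mul,
        ← mul_assoc]
      exact mul_neg_of_pos_of_neg (mul_self_pos.2 (hdet t)) hvneg
    filter_upwards [hcont.continuousAt.eventually (Iio_mem_nhds hneg)] with t' ht'
    refine ⟨ext t' v, hext t' v, ?_, le_of_lt ht'⟩
    intro h0
    have h : ext t' v ⬝ᵥ (S t' *ᵥ ext t' v) < 0 := ht'
    rw [h0, zero_dotProduct] at h
    exact lt_irrefl _ h
  intro w hw hw0
  by_contra hle
  rcases isClopen_iff.1 ⟨hclosed, hopen⟩ with h | h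
  · have : t₀ ∈ bad := ⟨w, hw, hw0, not_lt.1 hle⟩
    rw [h] at this
    exact this
  · have : t₁ ∈ bad := h ▸ Set.mem_univ _
    obtain ⟨v, hv, hv0, hvle⟩ := this
    exact absurd (h₁ v hv hv0) (not_lt.2 hvle)

theorem posDef_path {W A : Type*} [AddCommGroup W] [Module ℝ W] [FiniteDimensional ℝ W]
    [AddCommGroup A] [Module ℝ A] [FiniteDimensional ℝ A]
    (B : T → LinearMap.BilinForm ℝ W) (U : T → A →ₗ[ℝ] W)
    (hBc : ∀ v w, Continuous fun t => B t v w)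
    (hUc : ∀ (a : A) (φ : W →ₗ[ℝ] ℝ), Continuous fun t => φ (U t a))
    (hsymm : ∀ t v w, B t v w = B t w v)
    (hnd : ∀ t w, (∀ v, B t v w = 0) → w = 0)
    (hnd' : ∀ t a, (∀ a', B t (U t a') (U t a) = 0) → a = 0) (t₀ t₁ : T)
    (h₁ : ∀ w, (∀ a, B t₁ (U t₁ a) w = 0) → w ≠ 0 → 0 < B t₁ w w) (w : W)
    (hw : ∀ a, B t₀ (U t₀ a) w = 0) (hw0 : w ≠ 0) : 0 < B t₀ w w := by
  let b := Module.finBasis ℝ W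
  let c := Module.finBasis ℝ A
  let S := fun t => LinearMap.toMatrix₂ b b (B t)
  let M := fun t => LinearMap.toMatrix c b (U t)
  have hB : ∀ t v w, B t v w = b.equivFun v ⬝ᵥ (S t *ᵥ b.equivFun w) := fun t v w =>
    apply_eq_dotProduct_toMatrix₂_mulVec b b (B t) v w
  have hM : ∀ t a, b.equivFun (U t a) = M t *ᵥ c.equivFun a := fun t a =>
    (LinearMap.toMatrix_mulVec_repr c b (U t) a).symm
  have hBU : ∀ t a w, B t (U t a) w = c.equivFun a ⬝ᵥ ((M t)ᵀ *ᵥ (S t *ᵥ b.equivFun w)) := by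
    intro t a w
    rw [hB, hM, dotProduct_comm, dotProduct_mulVec, ← mulVec_transpose, dotProduct_comm]
  have hker : ∀ t w, (∀ a, B t (U t a) w = 0) ↔ (M t)ᵀ *ᵥ (S t *ᵥ b.equivFun w) = 0 := by
    intro t w
    constructor
    · intro h
      refine dotProduct_eq_zero _ fun x => ?_
      rw [dotProduct_comm, ← c.equivFun.apply_symm_apply x, ← hBU, h]
    · intro h a
      rw [hBU, h, dotProduct_zero]
  have key := posDef_path_matrix S M (continuous_matrix fun i j => ?_)
    (continuous_matrix fun i j => ?_) (fun t => ?_) (fun t x hx => ?_) (fun t hdet => ?_) t₀ t₁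
    (fun x hx hx0 => ?_) (b.equivFun w) ((hker t₀ w).1 hw)
    (fun h => hw0 (b.equivFun.map_eq_zero_iff.1 h))
  · rwa [hB]
  · simpa [S, LinearMap.toMatrix₂_apply] using hBc (b i) (b j)
  · simpa [M, LinearMap.toMatrix_apply] using hUc (c j) (b.coord i)
  · ext i j
    simp only [S, transpose_apply, LinearMap.toMatrix₂_apply]
    exact hsymm t _ _
  · have := hnd t (b.equivFun.symm x) fun v => by
      rw [hB, b.equivFun.apply_symm_apply, hx, dotProduct_zero]
    exact b.equivFun.symm.map_eq_zero_iff.1 this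
  · obtain ⟨x, hx0, hx⟩ := exists_mulVec_eq_zero_iff.2 hdet
    refine hx0 ?_
    have := hnd' t (c.equivFun.symm x) fun a' => by
      rw [hBU, hM, c.equivFun.apply_symm_apply, mulVec_mulVec, mulVec_mulVec, hx, dotProduct_zero]
    exact c.equivFun.symm.map_eq_zero_iff.1 this
  · have := h₁ (b.equivFun.symm x) ((hker t₁ _).2 (by rwa [b.equivFun.apply_symm_apply]))
      (fun h => hx0 (b.equivFun.symm.map_eq_zero_iff.1 h))
    rwa [hB, b.equivFun.apply_symm_apply] at this

end Path

section Lefschetz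

variable {F V : Type*} [Field F] [AddCommGroup V] [Module F V] [Finite V]

/-- The hard Lefschetz property for `L` on the image of `I` under multiplication by `y X`. -/
def HardLefschetz (I : Submodule ℝ (MobiusAlgebra F V)) (L : MobiusAlgebra F V)
    (X : Submodule F V) (j : ℕ) : Prop :=
  ∀ n a, a ∈ I → a ∈ gr F V j → 2 * j + n + finrank F X = finrank F V →
    L ^ n * (y X * a) = 0 → y X * a = 0

variable {I : Submodule ℝ (MobiusAlgebra F V)} {L : MobiusAlgebra F V} {X : Submodule F V} {j : ℕ}

theorem HodgeRiemann.hardLefschetz (h : HodgeRiemann I L X j) : HardLefschetz I L X j := by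
  intro n a haI ha hn h0
  by_contra hne
  have := h n a haI ha hn (by rw [pow_succ', mul_assoc, h0, mul_zero]) hne
  rw [h0, zero_mul, map_zero, mul_zero] at this
  exact lt_irrefl _ this

theorem lin_mul_y (E : Finset V) (x : V → ℝ) (c : MobiusAlgebra F V) :
    lin F E x * c = ∑ f ∈ E, x f • (pt F f * c) := by
  simp only [lin, Finset.sum_mul, smul_mul_assoc]

theorem eq_zero_of_lefschetz_of_socle {E : Finset V} {x : V → ℝ} (hx : ∀ v ∈ E, 0 < x v) {n : ℕ}
    {a : MobiusAlgebra F V} (haI : a ∈ I) (ha : a ∈ gr F V j)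
    (hn : 2 * j + (n + 1) + finrank F X = finrank F V)
    (hsoc : (∀ f ∈ E, pt F f * (y X * a) = 0) → y X * a = 0)
    (hHR : ∀ f ∈ E, f ∉ X → HodgeRiemann I (lin F E x) (X ⊔ F ∙ f) j)
    (h : lin F E x ^ (n + 1) * (y X * a) = 0) : y X * a = 0 := by
  set L := lin F E x with hL
  have hterm : ∀ f ∈ E, pt F f * (y X * a) ≠ 0 →
      0 < (-1) ^ j * deg (L ^ n * (pt F f * (y X * a)) * a) := by
    intro f hf hne
    have hfX : f ∉ X := fun hfX => hne (by rw [← mul_assoc, pt_mul_y_of_mem hfX, zero_mul])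
    have hfy : pt F f * (y X * a) = y (X ⊔ F ∙ f) * a := by
      rw [← mul_assoc, pt_mul_y_of_not_mem hfX]
    rw [hfy] at hne ⊢
    refine hHR f hf hfX n a haI ha (by rw [finrank_sup_span X hfX]; omega) ?_ hne
    rw [← hfy, mul_left_comm, h, mul_zero]
  have hterm' : ∀ f ∈ E, 0 ≤ x f * ((-1) ^ j * deg (L ^ n * (pt F f * (y X * a)) * a)) := by
    intro f hf
    by_cases h0 : pt F f * (y X * a) = 0
    · simp [h0]
    · exact (mul_pos (hx f hf) (hterm f hf h0)).le
  have hsum : ∑ f ∈ E, x f * ((-1) ^ j * deg (L ^ n * (pt F f * (y X * a)) * a)) = 0 := by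
    have h1 : L ^ n * (L * (y X * a)) * a = 0 := by
      rw [← mul_assoc (L ^ n), ← pow_succ, h, zero_mul]
    have h2 := congrArg (fun z => (-1) ^ j * deg z) h1
    simp only [map_zero, mul_zero] at h2
    rw [← h2, hL, lin_mul_y, Finset.mul_sum, Finset.sum_mul, map_sum, Finset.mul_sum]
    refine Finset.sum_congr rfl fun f _ => ?_
    rw [mul_smul_comm, smul_mul_assoc, map_smul, smul_eq_mul]
    ring
  refine hsoc fun f hf => ?_
  by_contra hne
  have h1 := (Finset.sum_eq_zero_iff_of_nonneg hterm').1 hsum f hf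
  exact h1.not_gt (mul_pos (hx f hf) (hterm f hf hne))

/-- The degree pairing as a bilinear form. -/
noncomputable def degForm (F V : Type*) [Field F] [AddCommGroup V] [Module F V] [Finite V] :
    LinearMap.BilinForm ℝ (MobiusAlgebra F V) := (LinearMap.mul ℝ _).compr₂ deg

theorem degForm_apply (a b : MobiusAlgebra F V) : degForm F V a b = deg (a * b) := rfl

theorem degForm_comm (a b : MobiusAlgebra F V) : degForm F V a b = degForm F V b a := by
  rw [degForm_apply, degForm_apply, mul_comm]

theorem eq_zero_of_gr_of_nondegOn (hI : NondegOn (degForm F V) I)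
    (hproj : ∀ k, ∀ a ∈ I, proj k a ∈ I) {i k : ℕ} (hik : i + k = finrank F V)
    {z : MobiusAlgebra F V} (hzI : z ∈ I) (hz : z ∈ gr F V k)
    (h : ∀ a ∈ I, a ∈ gr F V i → deg (a * z) = 0) : z = 0 := by
  refine hI z hzI fun b hb => ?_
  rw [degForm_apply, mul_comm, ← mem_gr_iff.1 hz, ← deg_proj_mul hik]
  exact h _ (hproj i b hb) (proj_mem_gr i b)

theorem continuous_line_pow (L₀ L₁ : MobiusAlgebra F V) (n : ℕ) (φ : MobiusAlgebra F V →ₗ[ℝ] ℝ)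
    (c : MobiusAlgebra F V) :
    Continuous fun t : unitInterval => φ ((L₀ + (t : ℝ) • L₁) ^ n * c) := by
  induction n generalizing c with
  | zero => simpa using continuous_const
  | succ n ih =>
    have h : ∀ t : unitInterval, φ ((L₀ + (t : ℝ) • L₁) ^ (n + 1) * c) =
        φ ((L₀ + (t : ℝ) • L₁) ^ n * (L₀ * c)) +
          (t : ℝ) * φ ((L₀ + (t : ℝ) • L₁) ^ n * (L₁ * c)) := by
      intro t
      rw [pow_succ, mul_assoc, add_mul, mul_add, map_add, smul_mul_assoc, mul_smul_comm, map_smul,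
        smul_eq_mul]
    simp only [h]
    exact (ih _).add (continuous_subtype_val.mul (ih _))

theorem pow_mul_mem {L : MobiusAlgebra F V} (hL : ∀ a ∈ I, L * a ∈ I) (n : ℕ)
    {a : MobiusAlgebra F V} (ha : a ∈ I) : L ^ n * a ∈ I := by
  induction n with
  | zero => simpa using ha
  | succ n ih =>
    rw [pow_succ', mul_assoc]
    exact hL _ ih

theorem hodgeRiemann_path_aux (hI : NondegOn (degForm F V) I)
    (hproj : ∀ k, ∀ a ∈ I, proj k a ∈ I) (hX : ∀ a ∈ I, y X * a ∈ I) {L₀ L₁ : MobiusAlgebra F V}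
    (hL₀ : L₀ ∈ gr F V 1) (hL₁ : L₁ ∈ gr F V 1) (hL₀I : ∀ a ∈ I, L₀ * a ∈ I)
    (hL₁I : ∀ a ∈ I, L₁ * a ∈ I)
    (hHL : ∀ t : unitInterval, HardLefschetz I (L₀ + (t : ℝ) • L₁) X j)
    (G : Submodule ℝ (MobiusAlgebra F V))
    (hG : ∀ e ∈ G, ∀ L ∈ gr F V 1, L * e ∈ gr F V j)
    (hG' : ∀ k z, k + j = finrank F V + 1 → z ∈ I → z ∈ gr F V k →
      (∀ e ∈ I, e ∈ G → deg (e * z) = 0) → z = 0)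
    (hGHL : ∀ t : unitInterval, ∀ n e, e ∈ I → e ∈ G →
      2 * j + n + finrank F X = finrank F V → (L₀ + (t : ℝ) • L₁) ^ (n + 2) * (y X * e) = 0 →
      y X * e = 0)
    (hHR : HodgeRiemann I (L₀ + L₁) X j) : HodgeRiemann I L₀ X j := by
  intro n a haI ha hn hprim hne
  let L : unitInterval → MobiusAlgebra F V := fun t => L₀ + (t : ℝ) • L₁
  have hL : ∀ t, L t ∈ gr F V 1 := fun t => Submodule.add_mem _ hL₀ (Submodule.smul_mem _ _ hL₁)
  have hLI : ∀ t, ∀ a ∈ I, L t * a ∈ I := fun t a ha => by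
    simp only [L, add_mul, smul_mul_assoc]
    exact I.add_mem (hL₀I a ha) (I.smul_mem _ (hL₁I a ha))
  let W : Submodule ℝ (MobiusAlgebra F V) := (I ⊓ gr F V j).map (LinearMap.mulLeft ℝ (y X))
  let f : ↥(I ⊓ gr F V j) →ₗ[ℝ] W :=
    (LinearMap.mulLeft ℝ (y X)).submoduleMap (I ⊓ gr F V j)
  obtain ⟨σ, hσ⟩ := f.exists_rightInverse_of_surjective
    (LinearMap.range_eq_top.2 (LinearMap.submoduleMap_surjective _ _))
  have hσ' : ∀ w : W, y X * (σ w : MobiusAlgebra F V) = w := fun w =>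
    congrArg Subtype.val (LinearMap.congr_fun hσ w)
  let B : unitInterval → LinearMap.BilinForm ℝ W := fun t =>
    (-1 : ℝ) ^ j • (degForm F V).compl₁₂
      (LinearMap.mulLeft ℝ (L t ^ n) ∘ₗ W.subtype) (Submodule.subtype _ ∘ₗ σ)
  have hB : ∀ t (v w : W), B t v w =
      (-1) ^ j * deg (L t ^ n * (v : MobiusAlgebra F V) * (σ w : MobiusAlgebra F V)) :=
    fun t v w => rfl
  have hB' : ∀ t (v w : W), B t v w =
      (-1) ^ j * deg ((σ v : MobiusAlgebra F V) * (L t ^ n * (w : MobiusAlgebra F V))) := by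
    intro t v w
    rw [hB]
    congr 2
    conv_lhs => rw [← hσ' v]
    conv_rhs => rw [← hσ' w]
    ring
  let A : Submodule ℝ (MobiusAlgebra F V) := (I ⊓ G).map (LinearMap.mulLeft ℝ (y X))
  have hUmem : ∀ t (c : A), L t * (c : MobiusAlgebra F V) ∈ W := by
    rintro t ⟨_, e, he, rfl⟩
    exact ⟨L t * e, ⟨hLI t _ he.1, hG e he.2 _ (hL t)⟩, mul_left_comm _ _ _⟩
  let U : unitInterval → A →ₗ[ℝ] W := fun t =>
    (LinearMap.mulLeft ℝ (L t) ∘ₗ A.subtype).codRestrict W (hUmem t)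
  have hU : ∀ t (c : A), (U t c : MobiusAlgebra F V) = L t * c := fun t c => rfl
  have hBU : ∀ t (c : A) (e : MobiusAlgebra F V) (w : W), y X * e = c → B t (U t c) w =
      (-1) ^ j * deg (e * (L t ^ (n + 1) * (w : MobiusAlgebra F V))) := by
    intro t c e w hc
    rw [hB, hU, ← hc]
    congr 2
    conv_rhs => rw [← hσ' w]
    ring
  have hsign : ((-1 : ℝ) ^ j) ≠ 0 := pow_ne_zero _ (by norm_num)
  have hWI : ∀ w : W, (w : MobiusAlgebra F V) ∈ I := fun w => by
    rw [← hσ' w]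
    exact hX _ (σ w).2.1
  have hWgr : ∀ w : W, (w : MobiusAlgebra F V) ∈ gr F V (finrank F X + j) := fun w => by
    rw [← hσ' w]
    exact mul_mem_gr (y_mem_gr X) (σ w).2.2
  have hprimU : ∀ t (w : W), (∀ e, B t (U t e) w = 0) ↔ L t ^ (n + 1) * (w : MobiusAlgebra F V) = 0 := by
    intro t w
    constructor
    · intro h
      refine hG' (n + 1 + (finrank F X + j)) _ (by omega) (pow_mul_mem (hLI t) _ (hWI w))
        (mul_mem_gr (pow_mem_gr (hL t) _) (hWgr w)) fun e he heG => ?_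
      have := h ⟨y X * e, e, ⟨he, heG⟩, rfl⟩
      rw [hBU _ _ e _ rfl] at this
      exact (mul_eq_zero.1 this).resolve_left hsign
    · rintro h ⟨_, e, he, rfl⟩
      rw [hBU _ _ e _ rfl, h, mul_zero, map_zero, mul_zero]
  have key := posDef_path B U ?_ ?_ ?_ ?_ ?_ 0 1 ?_ ⟨y X * a, ⟨a, ⟨haI, ha⟩, rfl⟩⟩ ?_
    (fun h => hne (congrArg Subtype.val h))
  · rw [hB'] at key
    convert key using 3
    have h0 : L 0 = L₀ := by simp [L]
    rw [h0]
    have : y X * a = y X * (σ ⟨y X * a, ⟨a, ⟨haI, ha⟩, rfl⟩⟩ : MobiusAlgebra F V) :=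
      (hσ' ⟨y X * a, ⟨a, ⟨haI, ha⟩, rfl⟩⟩).symm
    calc L₀ ^ n * (y X * a) * a = L₀ ^ n * a * (y X * a) := by ring
      _ = L₀ ^ n * a * (y X * (σ ⟨y X * a, ⟨a, ⟨haI, ha⟩, rfl⟩⟩ : MobiusAlgebra F V)) := by
        rw [← this]
      _ = _ := by ring
  · intro v w
    simp only [hB]
    refine continuous_const.mul ?_
    have := continuous_line_pow L₀ L₁ n deg (v * (σ w : MobiusAlgebra F V))
    simpa only [mul_assoc] using this
  · intro e φ
    obtain ⟨ψ, hψ⟩ := φ.exists_extend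
    have := continuous_line_pow L₀ L₁ 1 ψ (e : MobiusAlgebra F V)
    convert this using 2 with t
    rw [← hψ, LinearMap.comp_apply, Submodule.subtype_apply, hU, pow_one]
  · intro t v w
    rw [hB, hB', mul_comm (σ w : MobiusAlgebra F V)]
  · intro t w h
    refine Subtype.ext ?_
    rw [← hσ' w]
    refine hHL t n _ (σ w).2.1 (σ w).2.2 hn ?_
    rw [hσ']
    refine eq_zero_of_gr_of_nondegOn hI hproj (i := j) (k := n + (finrank F X + j)) (by omega)
      (pow_mul_mem (hLI t) _ (hWI w)) (mul_mem_gr (pow_mem_gr (hL t) _) (hWgr w)) fun b hb hbj => ?_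
    have h1 := h ⟨y X * b, ⟨b, ⟨hb, hbj⟩, rfl⟩⟩
    rw [hB] at h1
    have h2 := (mul_eq_zero.1 h1).resolve_left hsign
    rw [← h2]
    conv_lhs => rw [← hσ' w]
    congr 1
    simp only
    ring
  · rintro t ⟨_, e, he, rfl⟩ h
    refine Subtype.ext (hGHL t n e he.1 he.2 hn ?_)
    have h1 := (hprimU t _).1 h
    rw [hU] at h1
    rw [pow_succ, mul_assoc]
    exact h1
  · intro w hw hw0
    have h1 : L 1 = L₀ + L₁ := by simp [L]
    rw [hprimU, h1] at hw
    rw [hB, h1]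
    have := hHR n (σ w) (σ w).2.1 (σ w).2.2 hn (by rw [hσ']; exact hw)
      (by rw [hσ']; exact fun h => hw0 (Subtype.ext h))
    rwa [hσ'] at this
  · rw [hprimU]
    have h0 : L 0 = L₀ := by simp [L]
    rw [h0]
    exact hprim

theorem hodgeRiemann_path (hI : NondegOn (degForm F V) I)
    (hproj : ∀ k, ∀ a ∈ I, proj k a ∈ I) (hX : ∀ a ∈ I, y X * a ∈ I) {L₀ L₁ : MobiusAlgebra F V}
    (hL₀ : L₀ ∈ gr F V 1) (hL₁ : L₁ ∈ gr F V 1) (hL₀I : ∀ a ∈ I, L₀ * a ∈ I)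
    (hL₁I : ∀ a ∈ I, L₁ * a ∈ I)
    (hHL : ∀ t : unitInterval, ∀ j, HardLefschetz I (L₀ + (t : ℝ) • L₁) X j)
    (hHR : HodgeRiemann I (L₀ + L₁) X j) : HodgeRiemann I L₀ X j := by
  cases j with
  | zero =>
    refine hodgeRiemann_path_aux hI hproj hX hL₀ hL₁ hL₀I hL₁I (fun t => hHL t _) ⊥ ?_ ?_ ?_ hHR
    · intro e he L _
      rw [(Submodule.mem_bot ℝ).1 he, mul_zero]
      exact Submodule.zero_mem _
    · intro k z hk _ hz _
      refine coef_zero' z fun W => ?_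
      by_contra h
      have := finrank_eq_of_coef_ne_zero hz h
      have := Submodule.finrank_le W
      omega
    · intro t n e _ he _ _
      rw [(Submodule.mem_bot ℝ).1 he, mul_zero]
  | succ j =>
    refine hodgeRiemann_path_aux hI hproj hX hL₀ hL₁ hL₀I hL₁I (fun t => hHL t _) (gr F V j)
      ?_ ?_ ?_ hHR
    · intro e he L hL
      rw [add_comm]
      exact mul_mem_gr hL he
    · intro k z hk hzI hz h
      exact eq_zero_of_gr_of_nondegOn hI hproj (i := j) (k := k) (by omega) hzI hz h
    · intro t n e he heG hn h
      exact hHL t j (n + 2) e he heG (by omega) h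

end Lefschetz

section Flats

variable {F V : Type*} [Field F] [AddCommGroup V] [Module F V]

/-- The subspaces spanned by subsets of `E`. -/
def IsFlat (E : Finset V) (X : Submodule F V) : Prop :=
  ∃ S : Set V, S ⊆ (E : Set V) ∧ X = Submodule.span F S

theorem IsFlat.mono {E E' : Finset V} (h : E ⊆ E') {X : Submodule F V} (hX : IsFlat E X) :
    IsFlat E' X := by
  obtain ⟨S, hS, rfl⟩ := hX
  exact ⟨S, hS.trans (by exact_mod_cast h), rfl⟩

theorem IsFlat.sup_span {E : Finset V} {X : Submodule F V} (hX : IsFlat E X) {f : V}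
    (hf : f ∈ E) : IsFlat E (X ⊔ F ∙ f) := by
  obtain ⟨S, hS, rfl⟩ := hX
  exact ⟨insert f S, Set.insert_subset hf hS, by rw [Submodule.span_insert, sup_comm]⟩

theorem isFlat_bot (E : Finset V) : IsFlat E (⊥ : Submodule F V) :=
  ⟨∅, Set.empty_subset _, by simp⟩

theorem IsFlat.induction {E : Finset V} {p : Submodule F V → Prop} (h0 : p ⊥)
    (h1 : ∀ X, p X → ∀ f ∈ E, f ∉ X → p (X ⊔ F ∙ f)) {X : Submodule F V} (hX : IsFlat E X) :
    p X := by
  obtain ⟨S, hS, rfl⟩ := hX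
  have hfin : S.Finite := E.finite_toSet.subset hS
  induction S, hfin using Set.Finite.induction_on with
  | empty => simpa using h0
  | @insert f S _ _ ih =>
    have h2 := ih ((Set.subset_insert _ _).trans hS)
    by_cases hf : f ∈ Submodule.span F S
    · rwa [Submodule.span_insert_eq_span hf]
    · rw [Submodule.span_insert, sup_comm]
      exact h1 _ h2 f (hS (Set.mem_insert _ _)) hf

variable [Finite V] {I : Submodule ℝ (MobiusAlgebra F V)} {E : Finset V}

theorem y_mul_mem (hI : ∀ f ∈ E, ∀ a ∈ I, pt F f * a ∈ I) {X : Submodule F V} (hX : IsFlat E X)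
    {a : MobiusAlgebra F V} (ha : a ∈ I) : y X * a ∈ I := by
  refine hX.induction (p := fun X => y X * a ∈ I) ?_ ?_
  · rwa [← one_def, one_mul]
  · intro X hX f hf hfX
    rw [← pt_mul_y_of_not_mem hfX, mul_assoc]
    exact hI f hf _ hX

theorem lin_mul_mem (hI : ∀ f ∈ E, ∀ a ∈ I, pt F f * a ∈ I) (x : V → ℝ)
    {a : MobiusAlgebra F V} (ha : a ∈ I) : lin F E x * a ∈ I := by
  rw [lin_mul_y]
  exact I.sum_mem fun f hf => I.smul_mem _ (hI f hf a ha)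

theorem y_mul_eq_zero {z : MobiusAlgebra F V} (hz : ∀ f ∈ E, pt F f * z = 0)
    {X : Submodule F V} (hX : IsFlat E X) (hX0 : X ≠ ⊥) : y X * z = 0 := by
  refine (hX.induction (p := fun X => X ≠ ⊥ → y X * z = 0) ?_ ?_) hX0
  · exact fun h => (h rfl).elim
  · intro X _ f hf hfX _
    rw [← pt_mul_y_of_not_mem hfX, mul_right_comm, hz f hf, zero_mul]

theorem isFlat_univ [Fintype V] (X : Submodule F V) : IsFlat (Finset.univ : Finset V) X :=
  ⟨X, by simp, by simp⟩

theorem proj_eq_zero_of_mem_gr {i k : ℕ} (hik : k ≠ i) {a : MobiusAlgebra F V}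
    (ha : a ∈ gr F V i) : proj k a = 0 := by
  rw [← mem_gr_iff.1 ha, proj_proj_of_ne hik]

theorem proj_eq_zero {k : ℕ} (hk : finrank F V < k) (a : MobiusAlgebra F V) : proj k a = 0 := by
  refine coef_zero' _ fun W => ?_
  rw [coef_proj, if_neg]
  have := Submodule.finrank_le W
  omega

theorem exists_not_mem (hE : Submodule.span F (E : Set V) = ⊤) {X : Submodule F V}
    (hX : X ≠ ⊤) : ∃ f ∈ E, f ∉ X := by
  by_contra! h
  exact hX (top_le_iff.1 (hE ▸ Submodule.span_le.2 h))

end Flats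

section Transfer

variable {F V : Type*} [Field F] [AddCommGroup V] [Module F V] [Finite V]
  {I : Submodule ℝ (MobiusAlgebra F V)} {E : Finset V}

/-- Submodules of the Möbius algebra that are stable under multiplication by the points of `E`,
are compatible with the grading, contain `1` and on which the degree pairing is nondegenerate. -/
structure IsStable (E : Finset V) (I : Submodule ℝ (MobiusAlgebra F V)) : Prop where
  pt_mul_mem : ∀ f ∈ E, ∀ a ∈ I, pt F f * a ∈ I
  proj_mem : ∀ k, ∀ a ∈ I, proj k a ∈ I
  one_mem : 1 ∈ I
  nondeg : NondegOn (degForm F V) I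

/-- Stable submodules satisfying the Hodge–Riemann relations and having no socle in low degree. -/
structure IsHodge (E : Finset V) (I : Submodule ℝ (MobiusAlgebra F V)) : Prop
    extends IsStable E I where
  socle : ∀ X, IsFlat E X → X ≠ ⊤ → ∀ j a, a ∈ I → a ∈ gr F V j →
    2 * j + finrank F X ≤ finrank F V → (∀ f ∈ E, pt F f * (y X * a) = 0) → y X * a = 0
  hodge : ∀ X, IsFlat E X → ∀ x : V → ℝ, (∀ v ∈ E, 0 < x v) → ∀ j, HodgeRiemann I (lin F E x) X j

theorem hodgeRiemann_of_path (hI : IsStable E I)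
    (hsoc : ∀ X, IsFlat E X → X ≠ ⊤ → ∀ j a, a ∈ I → a ∈ gr F V j →
      2 * j + finrank F X < finrank F V → (∀ f ∈ E, pt F f * (y X * a) = 0) → y X * a = 0)
    (hpath : ∀ x : V → ℝ, (∀ v ∈ E, 0 < x v) → ∃ L ∈ gr F V 1, (∀ a ∈ I, L * a ∈ I) ∧
      ∀ X, IsFlat E X → (∀ j, HodgeRiemann I (lin F E x + L) X j) ∧
        ∀ t : unitInterval, (∃ x' : V → ℝ, (∀ v ∈ E, 0 < x' v) ∧
            lin F E x + (t : ℝ) • L = lin F E x') ∨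
          ∀ j, HodgeRiemann I (lin F E x + (t : ℝ) • L) X j) :
    ∀ X, IsFlat E X → ∀ x : V → ℝ, (∀ v ∈ E, 0 < x v) → ∀ j, HodgeRiemann I (lin F E x) X j := by
  have key : ∀ m, ∀ X, IsFlat E X → m + finrank F X = finrank F V →
      ∀ x : V → ℝ, (∀ v ∈ E, 0 < x v) → ∀ j, HodgeRiemann I (lin F E x) X j := by
    intro m
    induction m with
    | zero | succ m ih =>
      intro X hX hm x hx j
      have hHL : ∀ x : V → ℝ, (∀ v ∈ E, 0 < x v) → ∀ j, HardLefschetz I (lin F E x) X j := by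
        intro x hx j n a haI ha hn h
        cases n with
        | zero => simpa using h
        | succ n =>
          first
          | omega
          | refine eq_zero_of_lefschetz_of_socle hx haI ha hn (hsoc X hX ?_ j a haI ha (by omega))
              (fun f hf hfX => ih _ (hX.sup_span hf) (by rw [finrank_sup_span X hfX]; omega) x hx j)
              h
            rintro rfl
            rw [finrank_top] at hm
            omega
      obtain ⟨L, hL, hLI, h⟩ := hpath x hx
      refine hodgeRiemann_path hI.nondeg hI.proj_mem (fun a ha => y_mul_mem hI.pt_mul_mem hX ha)
        (lin_mem_gr E x) hL (fun a ha => lin_mul_mem hI.pt_mul_mem x ha) hLI (fun t j => ?_)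
        ((h X hX).1 j)
      rcases (h X hX).2 t with ⟨x', hx', h'⟩ | h'
      · rw [h']
        exact hHL x' hx' j
      · exact (h' j).hardLefschetz
  exact fun X hX => key (finrank F V - finrank F X) X hX
    (Nat.sub_add_cancel (Submodule.finrank_le X))

theorem isHodge_univ [Finite F] [Fintype V] :
    IsHodge (Finset.univ : Finset V) (⊤ : Submodule ℝ (MobiusAlgebra F V)) := by
  have hst : IsStable (Finset.univ : Finset V) (⊤ : Submodule ℝ (MobiusAlgebra F V)) :=
    { pt_mul_mem := fun _ _ _ _ => trivial
      proj_mem := fun _ _ _ => trivial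
      one_mem := trivial
      nondeg := fun a _ h => eq_zero_of_deg_mul fun b => h b trivial }
  have hsoc : ∀ X : Submodule F V, IsFlat (Finset.univ : Finset V) X → X ≠ ⊤ → ∀ j a,
      a ∈ (⊤ : Submodule ℝ (MobiusAlgebra F V)) → a ∈ gr F V j →
      2 * j + finrank F X ≤ finrank F V →
      (∀ f ∈ (Finset.univ : Finset V), pt F f * (y X * a) = 0) → y X * a = 0 := by
    intro X _ hX j a _ ha hj h
    have hrX : finrank F X < finrank F V := Submodule.finrank_lt (lt_top_iff_ne_top.2 hX).ne
    refine eq_zero_of_deg_mul fun b => ?_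
    rw [← sum_coef b, Finset.mul_sum, map_sum]
    refine Finset.sum_eq_zero fun U _ => ?_
    rw [mul_smul_comm, map_smul, mul_comm _ (y U)]
    by_cases hU : U = ⊥
    · rw [hU, ← one_def, one_mul,
        deg_eq_zero_of_mem_gr (mul_mem_gr (y_mem_gr X) ha) (by omega), smul_zero]
    · rw [y_mul_eq_zero h (isFlat_univ U) hU, map_zero, smul_zero]
  refine { hst with
    socle := hsoc
    hodge := hodgeRiemann_of_path hst
      (fun X hX hXt j a haI ha hj => hsoc X hX hXt j a haI ha hj.le) fun x hx => ?_ }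
  refine ⟨lin F Finset.univ 1 - lin F Finset.univ x, Submodule.sub_mem _ (lin_mem_gr _ _)
    (lin_mem_gr _ _), fun _ _ => trivial, fun X _ => ⟨fun j => ?_, fun t => Or.inl ?_⟩⟩
  · rw [add_sub_cancel]
    exact hodgeRiemann_uniform X j
  · refine ⟨fun v => (1 - (t : ℝ)) * x v + t, fun v hv => ?_, ?_⟩
    · have h0 := t.2.1
      have h1 := t.2.2
      have h2 := hx v hv
      rcases eq_or_lt_of_le h0 with h | h
      · rw [← h]; simpa using h2
      · have := mul_nonneg (sub_nonneg.2 h1) h2.le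
        linarith
    · simp only [lin, smul_sub, Finset.smul_sum, ← Finset.sum_sub_distrib, ← Finset.sum_add_distrib]
      refine Finset.sum_congr rfl fun v _ => ?_
      simp only [Pi.one_apply]
      module

theorem socle_of_insert [DecidableEq V] {e : V} (hI : IsHodge (insert e E) I)
    (hE : Submodule.span F (E : Set V) = ⊤) (X : Submodule F V) (hX : IsFlat E X) (hXt : X ≠ ⊤)
    (j : ℕ) (a : MobiusAlgebra F V) (haI : a ∈ I) (ha : a ∈ gr F V j)
    (hj : 2 * j + finrank F X < finrank F V) (h : ∀ f ∈ E, pt F f * (y X * a) = 0) :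
    y X * a = 0 := by
  have hX' := hX.mono (Finset.subset_insert e E)
  refine hI.socle X hX' hXt j a haI ha hj.le fun f hf => ?_
  rcases Finset.mem_insert.1 hf with rfl | hf
  swap
  · exact h f hf
  by_cases hfX : f ∈ X
  · rw [← mul_assoc, pt_mul_y_of_mem hfX, zero_mul]
  have hfy : pt F f * (y X * a) = y (X ⊔ F ∙ f) * a := by
    rw [← mul_assoc, pt_mul_y_of_not_mem hfX]
  rw [hfy]
  have hr := finrank_sup_span X hfX
  by_cases ht : X ⊔ F ∙ f = ⊤
  · rw [ht, finrank_top] at hr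
    obtain ⟨g, hg, hgX⟩ := exists_not_mem hE hXt
    have hgt : X ⊔ F ∙ g = ⊤ := Submodule.eq_top_of_finrank_eq (by
      rw [finrank_sup_span X hgX, hr])
    rw [ht, ← hgt, ← pt_mul_y_of_not_mem hgX, mul_assoc, h g hg]
  · refine hI.socle _ (hX'.sup_span (Finset.mem_insert_self _ _)) ht j a haI ha (by omega) ?_
    intro g hg
    rcases Finset.mem_insert.1 hg with rfl | hg
    · rw [← mul_assoc, pt_mul_y_of_mem (Submodule.mem_sup_right
        (Submodule.mem_span_singleton_self g)), zero_mul]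
    · rw [← hfy, mul_left_comm, h g hg, mul_zero]

theorem hodge_of_insert [DecidableEq V] {e : V} (he : e ∉ E) (hI : IsHodge (insert e E) I)
    (hE : Submodule.span F (E : Set V) = ⊤) :
    ∀ X, IsFlat E X → ∀ x : V → ℝ, (∀ v ∈ E, 0 < x v) →
      ∀ j, HodgeRiemann I (lin F E x) X j := by
  have hst : IsStable E I :=
    { hI.toIsStable with pt_mul_mem := fun f hf => hI.pt_mul_mem f (Finset.mem_insert_of_mem hf) }
  refine hodgeRiemann_of_path hst (socle_of_insert hI hE) fun x hx => ?_
  have hpos : ∀ t : ℝ, 0 < t → ∀ X, IsFlat E X → ∀ j,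
      HodgeRiemann I (lin F E x + t • pt F e) X j := by
    intro t ht X hX j
    have h1 : lin F E x + t • pt F e = lin F (insert e E) (Function.update x e t) := by
      rw [lin, lin, Finset.sum_insert he, Function.update_self, add_comm]
      congr 1
      refine Finset.sum_congr rfl fun v hv => ?_
      rw [Function.update_of_ne (by rintro rfl; exact he hv)]
    rw [h1]
    refine hI.hodge X (hX.mono (Finset.subset_insert e E)) _ (fun v hv => ?_) j
    by_cases hve : v = e
    · rw [hve, Function.update_self]
      exact ht
    · rw [Function.update_of_ne hve]
      exact hx v ((Finset.mem_insert.1 hv).resolve_left hve)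
  refine ⟨pt F e, pt_mem_gr e, hI.pt_mul_mem e (Finset.mem_insert_self _ _), fun X hX =>
    ⟨fun j => ?_, fun t => ?_⟩⟩
  · simpa using hpos 1 one_pos X hX j
  · rcases eq_or_lt_of_le t.2.1 with h | h
    · exact Or.inl ⟨x, hx, by rw [← h]; simp⟩
    · exact Or.inr (hpos t h X hX)

end Transfer

section Socle

variable {F V : Type*} [Field F] [AddCommGroup V] [Module F V] [Finite V] [Finite F]
  {I : Submodule ℝ (MobiusAlgebra F V)} {E : Finset V}

theorem exists_deg_eq (φ : MobiusAlgebra F V →ₗ[ℝ] ℝ) : ∃ r, ∀ a, φ a = deg (r * a) := by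
  have hinj : Function.Injective (degForm F V) := by
    rw [← LinearMap.ker_eq_bot, LinearMap.ker_eq_bot']
    exact fun a ha => eq_zero_of_deg_mul fun b => LinearMap.congr_fun ha b
  obtain ⟨r, hr⟩ := (LinearMap.linearEquivOfInjective (degForm F V) hinj
    Subspace.dual_finrank_eq.symm).surjective φ
  exact ⟨r, fun a => by rw [← hr]; rfl⟩

theorem mem_of_forall_deg {N : Submodule ℝ (MobiusAlgebra F V)} {z : MobiusAlgebra F V}
    (h : ∀ r, (∀ a ∈ N, deg (r * a) = 0) → deg (r * z) = 0) : z ∈ N := by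
  by_contra hz
  obtain ⟨φ, hφz, hφ⟩ := Submodule.exists_dual_map_eq_bot_of_notMem hz inferInstance
  obtain ⟨r, hr⟩ := exists_deg_eq φ
  refine hφz ((hr z).trans (h r fun a ha => ?_))
  rw [← hr, ← Submodule.mem_bot ℝ, ← hφ]
  exact Submodule.mem_map_of_mem ha

theorem exists_colon {X : Submodule F V} {s : MobiusAlgebra F V}
    (hs : ∀ f ∈ E, f ∉ X → pt F f * (y X * s) = 0) :
    ∃ a, (∀ f ∈ E, f ∉ X → pt F f * a = 0) ∧ y X * a = y X * s := by
  let K : Submodule ℝ (MobiusAlgebra F V) :=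
    { carrier := {a | ∀ f ∈ E, f ∉ X → pt F f * a = 0}
      zero_mem' := fun f _ _ => mul_zero _
      add_mem' := fun {a b} ha hb f hf hfX => by rw [mul_add, ha f hf hfX, hb f hf hfX, add_zero]
      smul_mem' := fun c a ha f hf hfX => by rw [mul_smul_comm, ha f hf hfX, smul_zero] }
  suffices h : y X * s ∈ K.map (LinearMap.mulLeft ℝ (y X)) by
    obtain ⟨a, ha, h⟩ := h
    exact ⟨a, ha, h⟩
  refine mem_of_forall_deg fun r hr => ?_
  let J : Submodule ℝ (MobiusAlgebra F V) :=
    Submodule.span ℝ {z | ∃ f ∈ E, f ∉ X ∧ ∃ b, z = pt F f * b}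
  have hJ : ∀ z ∈ J, ∀ W, coef W z ≠ 0 → ∃ f ∈ E, f ∉ X ∧ f ∈ W := by
    intro z hz W
    induction hz using Submodule.span_induction with
    | mem z hz =>
      obtain ⟨f, hf, hfX, b, rfl⟩ := hz
      intro h
      have hf0 : f ≠ 0 := fun h0 => hfX (h0 ▸ X.zero_mem)
      rw [pt, if_neg hf0] at h
      exact ⟨f, hf, hfX, le_of_coef_y_mul_ne_zero h (Submodule.mem_span_singleton_self f)⟩
    | zero => simp
    | add a b _ _ ha hb =>
      intro h
      by_cases h1 : coef W a = 0
      · refine hb fun h2 => h ?_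
        rw [map_add, h1, h2, add_zero]
      · exact ha h1
    | smul c a _ ha =>
      intro h
      refine ha fun h1 => h ?_
      rw [map_smul, h1, smul_zero]
  have hrJ : r * y X ∈ J := by
    refine mem_of_forall_deg fun c hc => ?_
    have hcK : c ∈ K := by
      intro f hf hfX
      refine eq_zero_of_deg_mul fun b => ?_
      rw [mul_comm (pt F f), mul_assoc]
      exact hc _ (Submodule.subset_span ⟨f, hf, hfX, b, rfl⟩)
    rw [mul_left_comm, mul_comm c]
    exact hr _ (Submodule.mem_map_of_mem hcK)
  have h0 : r * y X * s = 0 := by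
    rw [← sum_coef (r * y X), Finset.sum_mul]
    refine Finset.sum_eq_zero fun U _ => ?_
    by_cases hU : coef U (r * y X) = 0
    · rw [hU, zero_smul, zero_mul]
    obtain ⟨f, hf, hfX, hfU⟩ := hJ _ hrJ U hU
    rw [mul_comm] at hU
    have hle : X ⊔ F ∙ f ≤ U := sup_le (le_of_coef_y_mul_ne_zero hU)
      ((Submodule.span_singleton_le_iff_mem _ _).2 hfU)
    obtain ⟨C, hC⟩ := exists_isCompl (X ⊔ F ∙ f)
    have hCU : (X ⊔ F ∙ f) ⊔ C ⊓ U = U := by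
      rw [← sup_inf_assoc_of_le _ hle, hC.sup_eq_top, top_inf_eq]
    have hy : y U = y (C ⊓ U) * (pt F f * y X) := by
      rw [pt_mul_y_of_not_mem hfX, y_mul_y, if_pos (hC.disjoint.symm.mono_left inf_le_left),
        sup_comm, hCU]
    rw [hy, smul_mul_assoc, mul_assoc, mul_assoc, hs f hf hfX, mul_zero, smul_zero]
  rw [← mul_assoc, h0, map_zero]

theorem exists_lt_isStable (hI : IsStable E I) {X : Submodule F V} (hX : IsFlat E X)
    (hXt : X ≠ ⊤) {j : ℕ} {s : MobiusAlgebra F V} (hsI : s ∈ I) (hs : s ∈ gr F V j)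
    (hj : 2 * j + finrank F X = finrank F V) (h : ∀ f ∈ E, pt F f * (y X * s) = 0)
    (hdeg : deg (y X * s * s) ≠ 0) : ∃ I' < I, IsStable E I' := by
  classical
  have hXlt : finrank F X < finrank F V := Submodule.finrank_lt (lt_top_iff_ne_top.2 hXt).ne
  obtain ⟨a, haE, haX⟩ := exists_colon (E := E) (fun f hf _ => h f hf)
  obtain ⟨P, hP, hPB⟩ := hI.nondeg.exists_proj
  obtain ⟨b, hbI, hbgr, hbE, hbX⟩ : ∃ b ∈ I, b ∈ gr F V j ∧ (∀ f ∈ E, f ∉ X → pt F f * b = 0) ∧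
      y X * b = y X * s := by
    have hPE : ∀ f ∈ E, f ∉ X → pt F f * (P a : MobiusAlgebra F V) = 0 := by
      intro f hf hfX
      refine hI.nondeg _ (hI.pt_mul_mem f hf _ (P a).2) fun c hc => ?_
      have := hPB a _ (hI.pt_mul_mem f hf c hc)
      rw [degForm_apply] at this ⊢
      rw [mul_assoc, mul_left_comm, this, degForm_apply, mul_left_comm, ← mul_assoc, haE f hf hfX,
        zero_mul, map_zero]
    have hPX : y X * (P a : MobiusAlgebra F V) = y X * s := by
      refine sub_eq_zero.1 (hI.nondeg _ (I.sub_mem (y_mul_mem hI.pt_mul_mem hX (P a).2)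
        (y_mul_mem hI.pt_mul_mem hX hsI)) fun c hc => ?_)
      have := hPB a _ (y_mul_mem hI.pt_mul_mem hX hc)
      rw [degForm_apply] at this ⊢
      rw [sub_mul, map_sub, mul_assoc, mul_left_comm, this, degForm_apply, mul_left_comm,
        ← mul_assoc, haX, sub_self]
    refine ⟨proj j (P a), hI.proj_mem j _ (P a).2, proj_mem_gr _ _, fun f hf hfX => ?_, ?_⟩
    · rw [← proj_mul (pt_mem_gr f), hPE f hf hfX, map_zero]
    · rw [← proj_mul (y_mem_gr X), hPX, mem_gr_iff.1 (mul_mem_gr (y_mem_gr X) hs)]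
  let N : Submodule ℝ (MobiusAlgebra F V) := Submodule.span ℝ ((fun W => y W * b) '' Set.Iic X)
  have hNmem : ∀ W ≤ X, y W * b ∈ N := fun W hW => Submodule.subset_span ⟨W, hW, rfl⟩
  have hNind : ∀ T : MobiusAlgebra F V →ₗ[ℝ] MobiusAlgebra F V, (∀ W ≤ X, T (y W * b) ∈ N) →
      ∀ c ∈ N, T c ∈ N := by
    intro T hT c hc
    have : N ≤ N.comap T := Submodule.span_le.2 (by rintro _ ⟨W, hW, rfl⟩; exact hT W hW)
    exact this hc
  have hNpt : ∀ f ∈ E, ∀ c ∈ N, pt F f * c ∈ N := by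
    intro f hf
    refine hNind (LinearMap.mulLeft ℝ (pt F f)) fun W hW => ?_
    rw [LinearMap.mulLeft_apply]
    by_cases hfX : f ∈ X
    · rw [← mul_assoc, pt_mul_y]
      split_ifs
      · rw [zero_mul]
        exact N.zero_mem
      · exact hNmem _ (sup_le hW ((Submodule.span_singleton_le_iff_mem _ _).2 hfX))
    · rw [mul_left_comm, hbE f hf hfX, mul_zero]
      exact N.zero_mem
  have hNproj : ∀ k, ∀ c ∈ N, proj k c ∈ N := by
    intro k
    refine hNind (proj k) fun W hW => ?_
    have hgr := mul_mem_gr (y_mem_gr W) hbgr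
    by_cases hk : k = finrank F W + j
    · rw [hk, mem_gr_iff.1 hgr]
      exact hNmem W hW
    · rw [proj_eq_zero_of_mem_gr hk hgr]
      exact N.zero_mem
  have hpair : ∀ T ≤ X, ∀ W ≤ X, deg (y T * b * (y W * b)) =
      if T ⊓ W = ⊥ ∧ T ⊔ W = X then deg (y X * s * s) else 0 := by
    intro T hT W hW
    rw [mul_mul_mul_comm, y_mul_y, disjoint_iff]
    by_cases h1 : T ⊓ W = ⊥
    swap
    · simp [h1]
    by_cases h2 : T ⊔ W = X
    · rw [if_pos h1, if_pos ⟨h1, h2⟩, h2, ← mul_assoc, hbX, mul_right_comm, hbX, mul_right_comm]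
    · rw [if_pos h1, if_neg (fun h => h2 h.2)]
      have : finrank F ↥(T ⊔ W) < finrank F X :=
        Submodule.finrank_lt_finrank_of_lt (lt_of_le_of_ne (sup_le hT hW) h2)
      exact deg_eq_zero_of_mem_gr (mul_mem_gr (y_mem_gr _) (mul_mem_gr hbgr hbgr)) (by omega)
  have hNnd : NondegOn (degForm F V) N := by
    intro z hz hzN
    obtain ⟨r, hr, rfl⟩ : ∃ r : MobiusAlgebra F V, (∀ W, coef W r ≠ 0 → W ≤ X) ∧ r * b = z := by
      clear hzN
      induction hz using Submodule.span_induction with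
      | mem z hz =>
        obtain ⟨W, hW, rfl⟩ := hz
        refine ⟨y W, fun U hU => ?_, rfl⟩
        rw [coef_y] at hU
        split_ifs at hU with h
        · exact h ▸ hW
        · exact (hU rfl).elim
      | zero => exact ⟨0, by simp, zero_mul _⟩
      | add z z' _ _ hz hz' =>
        obtain ⟨r, hr, rfl⟩ := hz
        obtain ⟨r', hr', rfl⟩ := hz'
        refine ⟨r + r', fun W hW => ?_, add_mul _ _ _⟩
        by_cases h1 : coef W r = 0
        · exact hr' W (by rwa [map_add, h1, zero_add] at hW)
        · exact hr W h1
      | smul c z _ hz =>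
        obtain ⟨r, hr, rfl⟩ := hz
        refine ⟨c • r, fun W hW => hr W fun h => hW ?_, smul_mul_assoc _ _ _⟩
        rw [map_smul, h, smul_zero]
    have hr0 : r = 0 := by
      refine eq_zero_of_complSum hr fun U hU => ?_
      have h1 := hzN _ (hNmem U hU)
      rw [degForm_apply] at h1
      have h2 : deg (r * b * (y U * b)) =
          (∑ W, if W ⊓ U = ⊥ ∧ W ⊔ U = X then coef W r else 0) * deg (y X * s * s) := by
        conv_lhs => rw [← sum_coef r]
        rw [Finset.sum_mul, Finset.sum_mul, Finset.sum_mul, map_sum]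
        refine Finset.sum_congr rfl fun W _ => ?_
        rw [smul_mul_assoc, smul_mul_assoc, map_smul, smul_eq_mul]
        by_cases hW : coef W r = 0
        · simp [hW]
        · rw [hpair W (hr W hW) U hU]
          split_ifs <;> simp
      rw [h2] at h1
      exact (mul_eq_zero.1 h1).resolve_right hdeg
    rw [hr0, zero_mul]
  have hbN : b ∈ N := by
    have := hNmem ⊥ bot_le
    rwa [← one_def, one_mul] at this
  have hb0 : b ≠ 0 := by
    rintro rfl
    rw [← hbX, mul_zero, zero_mul, map_zero] at hdeg
    exact hdeg rfl
  let ops : Set (MobiusAlgebra F V →ₗ[ℝ] MobiusAlgebra F V) :=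
    {T | (∃ f ∈ E, T = LinearMap.mulLeft ℝ (pt F f)) ∨ ∃ k ≤ finrank F V, T = proj k}
  have hops : ∀ T ∈ ops, ∃ T' ∈ ops, ∀ c c', degForm F V (T c) c' = degForm F V c (T' c') := by
    rintro _ (⟨f, hf, rfl⟩ | ⟨k, hk, rfl⟩)
    · refine ⟨_, Or.inl ⟨f, hf, rfl⟩, fun c c' => ?_⟩
      simp only [degForm_apply, LinearMap.mulLeft_apply]
      rw [mul_assoc, mul_left_comm]
    · exact ⟨proj (finrank F V - k), Or.inr ⟨_, Nat.sub_le _ _, rfl⟩, fun c c' =>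
        deg_proj_mul (by omega) c c'⟩
  have hIops : ∀ T ∈ ops, ∀ c ∈ I, T c ∈ I := by
    rintro _ (⟨f, hf, rfl⟩ | ⟨k, hk, rfl⟩)
    · exact hI.pt_mul_mem f hf
    · exact hI.proj_mem k
  have hNops : ∀ T ∈ ops, ∀ c ∈ N, T c ∈ N := by
    rintro _ (⟨f, hf, rfl⟩ | ⟨k, hk, rfl⟩)
    · exact hNpt f hf
    · exact hNproj k
  obtain ⟨I', hle, hst, hnd, hbI', horth⟩ := hI.nondeg.exists_split (N := N) degForm_comm hNnd ops
    hops hIops hNops hbI hbN hb0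
  · refine ⟨I', lt_of_le_of_ne hle (by rintro rfl; exact hbI' hbI), ?_⟩
    refine ⟨fun f hf => hst _ (Or.inl ⟨f, hf, rfl⟩), fun k c hc => ?_, ?_, hnd⟩
    · by_cases hk : k ≤ finrank F V
      · exact hst _ (Or.inr ⟨k, hk, rfl⟩) c hc
      · rw [proj_eq_zero (not_le.1 hk)]
        exact I'.zero_mem
    · refine horth 1 hI.one_mem fun c hc => ?_
      have : N ≤ LinearMap.ker (degForm F V 1) := by
        refine Submodule.span_le.2 ?_
        rintro _ ⟨W, hW, rfl⟩
        have hWX : finrank F W ≤ finrank F X := Submodule.finrank_mono hW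
        change degForm F V 1 (y W * b) = 0
        rw [degForm_apply, one_mul]
        exact deg_eq_zero_of_mem_gr (mul_mem_gr (y_mem_gr _) hbgr) (by omega)
      exact this hc

end Socle

section Existence

variable {F V : Type*} [Field F] [AddCommGroup V] [Module F V] [Finite V] [Finite F]

theorem HodgeRiemann.mono {I I' : Submodule ℝ (MobiusAlgebra F V)} (hle : I' ≤ I)
    {L : MobiusAlgebra F V} {X : Submodule F V} {j : ℕ} (h : HodgeRiemann I L X j) :
    HodgeRiemann I' L X j := fun n a ha => h n a (hle ha)

theorem exists_isHodge_of_insert [DecidableEq V] {E : Finset V} {e : V} (he : e ∉ E)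
    (hE : Submodule.span F (E : Set V) = ⊤)
    {I : Submodule ℝ (MobiusAlgebra F V)} (hI : IsHodge (insert e E) I) :
    ∃ I' : Submodule ℝ (MobiusAlgebra F V), IsHodge E I' := by
  have hst : IsStable E I :=
    { hI.toIsStable with pt_mul_mem := fun f hf => hI.pt_mul_mem f (Finset.mem_insert_of_mem hf) }
  obtain ⟨K, hK, hmin⟩ := exists_minimal_of_wellFoundedLT (fun K => K ≤ I ∧ IsStable E K)
    ⟨I, le_rfl, hst⟩
  have hhodge : ∀ X, IsFlat E X → ∀ x : V → ℝ, (∀ v ∈ E, 0 < x v) →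
      ∀ j, HodgeRiemann K (lin F E x) X j :=
    fun X hX x hx j => (hodge_of_insert he hI hE X hX x hx j).mono hK.1
  refine ⟨K, { hK.2 with socle := fun X hX hXt j s hsK hs hj h => ?_, hodge := hhodge }⟩
  rcases hj.lt_or_eq with hj | hj
  · exact socle_of_insert hI hE X hX hXt j s (hK.1 hsK) hs hj h
  by_contra hne
  have hdeg : deg (y X * s * s) ≠ 0 := by
    have h1 : lin F E 1 ^ (0 + 1) * (y X * s) = 0 := by
      rw [zero_add, pow_one, lin_mul_y]
      exact Finset.sum_eq_zero fun f hf => by rw [h f hf, smul_zero]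
    have h2 := hhodge X hX 1 (fun _ _ => one_pos) j 0 s hsK hs (by omega) h1 hne
    rw [pow_zero, one_mul] at h2
    exact (right_ne_zero_of_mul h2.ne')
  obtain ⟨K', hlt, hK'⟩ := exists_lt_isStable hK.2 hX hXt hsK hs hj h hdeg
  exact hlt.not_ge (hmin ⟨hlt.le.trans hK.1, hK'⟩ hlt.le)

theorem exists_isHodge [Fintype V] (E : Finset V) (hE : Submodule.span F (E : Set V) = ⊤) :
    ∃ I : Submodule ℝ (MobiusAlgebra F V), IsHodge E I := by
  classical
  induction hn : Eᶜ.card generalizing E with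
  | zero =>
    rw [Finset.card_eq_zero, Finset.compl_eq_empty_iff] at hn
    exact ⟨⊤, hn ▸ isHodge_univ⟩
  | succ n ih =>
    obtain ⟨e, he⟩ : Eᶜ.Nonempty := Finset.card_pos.1 (hn.symm.subst n.succ_pos)
    have he' := Finset.mem_compl.1 he
    obtain ⟨I, hI⟩ := ih (insert e E) (top_le_iff.1 (hE.symm.le.trans (Submodule.span_mono (by
      exact_mod_cast Finset.subset_insert e E)))) (by
        rw [Finset.compl_insert, Finset.card_erase_of_mem he, hn, Nat.add_sub_cancel])
    exact exists_isHodge_of_insert he' hE hI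

end Existence

section Count

variable {F V : Type*} [Field F] [AddCommGroup V] [Module F V]

/-- The flats of `E` of dimension `i`. -/
def flats (F : Type*) {V : Type*} [Field F] [AddCommGroup V] [Module F V] (E : Finset V) (i : ℕ) :
    Set (Submodule F V) := {X | finrank F X = i ∧ IsFlat E X}

variable [Finite V]

/-- The span of the basis elements attached to the flats of `E` of dimension `i`. -/
noncomputable def flatSpan (F : Type*) {V : Type*} [Field F] [AddCommGroup V] [Module F V]
    [Finite V] (E : Finset V) (i : ℕ) : Submodule ℝ (MobiusAlgebra F V) :=
  Submodule.span ℝ (y '' flats F E i)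

theorem finrank_flatSpan (E : Finset V) (i : ℕ) :
    finrank ℝ (flatSpan F E i) = (flats F E i).ncard := by
  classical
  have := Fintype.ofFinite (flats F E i)
  have hli : LinearIndependent ℝ (fun X : flats F E i => y (X : Submodule F V)) :=
    (stdBasis F V).linearIndependent.comp _ Subtype.val_injective
  have := finrank_span_eq_card hli
  rw [flatSpan, Set.image_eq_range, this, ← Nat.card_coe_set_eq, Nat.card_eq_fintype_card]

theorem pow_mul_mem_flatSpan {E : Finset V} {x : V → ℝ} {i : ℕ} (n : ℕ) {a : MobiusAlgebra F V}
    (ha : a ∈ flatSpan F E i) : lin F E x ^ n * a ∈ flatSpan F E (i + n) := by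
  have h1 : ∀ k, ∀ a ∈ flatSpan F E k, lin F E x * a ∈ flatSpan F E (k + 1) := by
    intro k a ha
    have : flatSpan F E k ≤ (flatSpan F E (k + 1)).comap (LinearMap.mulLeft ℝ (lin F E x)) := by
      refine Submodule.span_le.2 ?_
      rintro _ ⟨X, ⟨hXk, hX⟩, rfl⟩
      change lin F E x * y X ∈ flatSpan F E (k + 1)
      rw [lin_mul_y]
      refine Submodule.sum_mem _ fun f hf => Submodule.smul_mem _ _ ?_
      rw [pt_mul_y]
      split_ifs with hfX
      · exact Submodule.zero_mem _
      · exact Submodule.subset_span ⟨_, ⟨by rw [finrank_sup_span X hfX, hXk], hX.sup_span hf⟩, rfl⟩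
    exact this ha
  induction n with
  | zero => simpa using ha
  | succ n ih =>
    rw [pow_succ', mul_assoc]
    exact h1 _ _ ih

theorem ncard_flats_le_of_injOn {E : Finset V} {x : V → ℝ} {i n : ℕ}
    (h : ∀ a ∈ flatSpan F E i, lin F E x ^ n * a = 0 → a = 0) :
    (flats F E i).ncard ≤ (flats F E (i + n)).ncard := by
  rw [← finrank_flatSpan, ← finrank_flatSpan]
  let T : flatSpan F E i →ₗ[ℝ] flatSpan F E (i + n) :=
    (LinearMap.mulLeft ℝ (lin F E x ^ n)).restrict fun a ha => pow_mul_mem_flatSpan n ha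
  refine LinearMap.finrank_le_finrank_of_injective (f := T) ?_
  rw [← LinearMap.ker_eq_bot, LinearMap.ker_eq_bot']
  exact fun a ha => Subtype.ext (h a a.2 (congrArg Subtype.val ha))

theorem ncard_flats_le_of_finite [Finite F] {E : Finset V}
    (hE : Submodule.span F (E : Set V) = ⊤) {i : ℕ} (hi : 2 * i < finrank F V) :
    (flats F E i).ncard ≤ (flats F E (finrank F V - i)).ncard ∧
      (flats F E i).ncard ≤ (flats F E (i + 1)).ncard := by
  classical
  have := Fintype.ofFinite V
  obtain ⟨I, hI⟩ := exists_isHodge E hE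
  have hHL := (hI.hodge ⊥ (isFlat_bot E) 1 (fun _ _ => one_pos) i).hardLefschetz
  have hle : flatSpan F E i ≤ I ⊓ gr F V i := by
    refine Submodule.span_le.2 ?_
    rintro _ ⟨X, ⟨hXi, hX⟩, rfl⟩
    refine ⟨?_, hXi ▸ y_mem_gr X⟩
    have := y_mul_mem hI.pt_mul_mem hX hI.one_mem
    rwa [mul_one] at this
  have hinj : ∀ a ∈ flatSpan F E i, lin F E 1 ^ (finrank F V - 2 * i) * a = 0 → a = 0 := by
    intro a ha h
    have := hHL (finrank F V - 2 * i) a (hle ha).1 (hle ha).2 (by rw [finrank_bot]; omega)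
    rw [← one_def, one_mul] at this
    exact this h
  constructor
  · have := ncard_flats_le_of_injOn hinj
    rwa [show i + (finrank F V - 2 * i) = finrank F V - i by omega] at this
  · refine ncard_flats_le_of_injOn (x := 1) (n := 1) fun a ha h => hinj a ha ?_
    rw [pow_one] at h
    rw [← Nat.sub_add_cancel (show 1 ≤ finrank F V - 2 * i by omega), pow_succ, mul_assoc, h,
      mul_zero]

end Count

section FiniteType

instance isJacobsonRing_int : IsJacobsonRing ℤ := by
  rw [isJacobsonRing_iff_prime_eq]
  intro P hP
  by_cases hP0 : P = ⊥
  · subst hP0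
    refine le_antisymm (fun x hx => ?_) Ideal.le_jacobson
    have h := Ideal.mem_jacobson_bot.1 hx x
    rcases Int.isUnit_iff.1 h with h | h
    · exact mul_self_eq_zero.1 (by linarith : x * x = 0)
    · nlinarith [mul_self_nonneg x]
  · have := IsPrime.to_maximal_ideal hP0
    exact Ideal.jacobson_eq_self_of_isMaximal

theorem finite_of_finiteType_int (K : Type*) [Field K] [Algebra.FiniteType ℤ K] : Finite K := by
  have hfin : Module.Finite ℤ K := finite_of_finite_type_of_isJacobsonRing ℤ K
  have hinj : ¬ Function.Injective (algebraMap ℤ K) := fun h =>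
    Int.not_isField ((Algebra.IsIntegral.isField_iff_isField h).2 (Field.toIsField K))
  rw [injective_iff_map_eq_zero] at hinj
  push Not at hinj
  obtain ⟨n, hn, hn0⟩ := hinj
  refine Module.finite_of_fg_torsion K fun {x} => ⟨⟨n, mem_nonZeroDivisors_of_ne_zero hn0⟩, ?_⟩
  change n • x = 0
  rw [Algebra.smul_def, hn, zero_mul]

theorem exists_ringHom_finite_field {R : Type u} [CommRing R] [Nontrivial R]
    [Algebra.FiniteType ℤ R] : ∃ (F : Type u) (_ : Field F) (_ : Finite F), Nonempty (R →+* F) := by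
  obtain ⟨m, hm⟩ := Ideal.exists_maximal R
  obtain ⟨F, hF, φ, hφ⟩ : ∃ (F : Type u) (_ : Field F) (φ : R →+* F), Function.Surjective φ :=
    ⟨R ⧸ m, Ideal.Quotient.field m, Ideal.Quotient.mk m, Ideal.Quotient.mk_surjective⟩
  have : Algebra.FiniteType ℤ F := .of_surjective φ.toIntAlgHom hφ
  exact ⟨F, hF, finite_of_finiteType_int F, ⟨φ⟩⟩

end FiniteType

section Witness

variable {ι : Type*} {n : ℕ}

/-- Explicit data showing that the subfamily of `v` indexed by `T` is a basis of the span of the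
subfamily indexed by `S`. -/
structure IsRankWitness {R : Type*} [CommRing R] [DecidableEq ι] (v : ι → Fin n → R) (S : Set ι)
    (T : Finset ι) (c : ι → ι → R) (d : ι → Fin n → R) : Prop where
  subset : (T : Set ι) ⊆ S
  eq_sum : ∀ s ∈ S, v s = ∑ t ∈ T, c s t • v t
  dual : ∀ t ∈ T, ∀ t' ∈ T, ∑ i, d t i * v t' i = if t = t' then 1 else 0

variable [DecidableEq ι]

theorem IsRankWitness.map {R R' : Type*} [CommRing R] [CommRing R'] (φ : R →+* R')
    {v : ι → Fin n → R} {S : Set ι} {T : Finset ι} {c : ι → ι → R} {d : ι → Fin n → R}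
    (h : IsRankWitness v S T c d) : IsRankWitness (fun s i => φ (v s i)) S T
      (fun s t => φ (c s t)) (fun s i => φ (d s i)) where
  subset := h.subset
  eq_sum s hs := by
    ext i
    rw [h.eq_sum s hs]
    simp [Finset.sum_apply, map_sum]
  dual t ht t' ht' := by
    simp only [← map_mul, ← map_sum]
    rw [h.dual t ht t' ht']
    split_ifs <;> simp

theorem IsRankWitness.of_map {R R' : Type*} [CommRing R] [CommRing R'] {φ : R →+* R'}
    (hφ : Function.Injective φ)
    {v : ι → Fin n → R} {S : Set ι} {T : Finset ι} {c : ι → ι → R} {d : ι → Fin n → R}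
    (h : IsRankWitness (fun s i => φ (v s i)) S T
      (fun s t => φ (c s t)) (fun s i => φ (d s i))) : IsRankWitness v S T c d where
  subset := h.subset
  eq_sum s hs := by
    ext i
    apply hφ
    have := congrFun (h.eq_sum s hs) i
    simpa [Finset.sum_apply, map_sum] using this
  dual t ht t' ht' := by
    apply hφ
    have := h.dual t ht t' ht'
    simp only [← map_mul, ← map_sum] at this
    rw [this]
    split_ifs <;> simp

theorem IsRankWitness.finrank_eq {K : Type*} [Field K]
    {v : ι → Fin n → K} {S : Set ι} {T : Finset ι} {c : ι → ι → K} {d : ι → Fin n → K}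
    (h : IsRankWitness v S T c d) : finrank K (Submodule.span K (v '' S)) = T.card := by
  have hli : LinearIndependent K (fun t : T => v t) := by
    rw [Fintype.linearIndependent_iff]
    intro g hg t
    have h1 : ∑ i, d t i * (∑ t' : T, g t' • v t') i = 0 := by
      rw [hg]
      simp
    simp only [Finset.sum_apply, Pi.smul_apply, smul_eq_mul, Finset.mul_sum] at h1
    rw [Finset.sum_comm] at h1
    have h2 : ∀ t' : T, ∑ i, d t i * (g t' * v t' i) = if t = t' then g t' else 0 := by
      intro t'
      have h3 := h.dual t t.2 t' t'.2
      calc ∑ i, d t i * (g t' * v t' i) = g t' * ∑ i, d t i * v t' i := by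
            rw [Finset.mul_sum]
            exact Finset.sum_congr rfl fun i _ => by ring
        _ = _ := by
            rw [h3]
            by_cases h4 : t = t'
            · subst h4
              simp
            · rw [if_neg fun h5 => h4 (Subtype.ext h5), if_neg h4, mul_zero]
    simpa [h2] using h1
  have hspan : Submodule.span K (v '' S) = Submodule.span K (Set.range fun t : T => v t) := by
    refine le_antisymm (Submodule.span_le.2 ?_) (Submodule.span_mono ?_)
    · rintro _ ⟨s, hs, rfl⟩
      rw [SetLike.mem_coe, h.eq_sum s hs]
      exact Submodule.sum_mem _ fun t ht =>
        Submodule.smul_mem _ _ (Submodule.subset_span ⟨⟨t, ht⟩, rfl⟩)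
    · rintro _ ⟨t, rfl⟩
      exact ⟨t, h.subset t.2, rfl⟩
  rw [hspan, finrank_span_eq_card hli, Fintype.card_coe]

theorem exists_isRankWitness [Finite ι] {K : Type*} [Field K] (v : ι → Fin n → K) (S : Set ι) :
    ∃ T c d, IsRankWitness v S T c d := by
  obtain ⟨b, hbS, -, hspan, hli⟩ := exists_linearIndepOn_extension
    (linearIndepOn_empty K v) (Set.empty_subset S)
  obtain ⟨T, rfl⟩ := b.toFinite.exists_finset_coe
  have hc : ∀ s, ∃ c : ι → K, s ∈ S → v s = ∑ t ∈ T, c t • v t := by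
    intro s
    by_cases hs : s ∈ S
    · obtain ⟨c, hc⟩ := (Submodule.mem_span_image_finset_iff_exists_fun K).1
        (hspan (Set.mem_image_of_mem v hs))
      refine ⟨fun t => if h : t ∈ T then c ⟨t, h⟩ else 0, fun _ => ?_⟩
      rw [← hc, ← Finset.sum_coe_sort T]
      exact Finset.sum_congr rfl fun t _ => by simp
    · exact ⟨0, fun h => (hs h).elim⟩
  choose c hc using hc
  obtain ⟨g, hg⟩ := LinearMap.exists_leftInverse_of_injective
    (Finsupp.linearCombination K fun t : (T : Set ι) => v t) (LinearMap.ker_eq_bot.2 hli)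
  have hg' : ∀ t : (T : Set ι), g (v t) = Finsupp.single t 1 := fun t => by
    have := LinearMap.congr_fun hg (Finsupp.single t 1)
    simpa using this
  refine ⟨T, c, fun t i => if h : t ∈ (T : Set ι) then g (Pi.single i 1) ⟨t, h⟩ else 0, hbS,
    fun s hs => hc s hs, fun t ht t' ht' => ?_⟩
  have ht1 : t ∈ (T : Set ι) := ht
  simp only [ht1, dif_pos]
  have h1 := congrArg (fun z => z ⟨t, ht1⟩) (hg' ⟨t', ht'⟩)
  rw [LinearMap.pi_apply_eq_sum_univ g (v t')] at h1
  simp only [Finsupp.coe_finsetSum, Finset.sum_apply, Finsupp.smul_apply, smul_eq_mul,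
    Finsupp.single_apply, Subtype.mk.injEq] at h1
  rw [if_congr (eq_comm (a := t)) rfl rfl, ← h1]
  refine Finset.sum_congr rfl fun i _ => ?_
  rw [mul_comm]
  congr 3
  ext j
  simp [Pi.single_apply, eq_comm]

/-- A finite configuration of vectors has the same ranks as one over a finite field. -/
theorem exists_finite_field_finrank_eq [Finite ι] {K : Type u} [Field K] (v : ι → Fin n → K) :
    ∃ (F : Type u) (_ : Field F) (_ : Finite F) (v' : ι → Fin n → F), ∀ S : Set ι,
      finrank F (Submodule.span F (v' '' S)) = finrank K (Submodule.span K (v '' S)) := by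
  choose T c d h using exists_isRankWitness v
  let C : Set K := Set.range (fun p : ι × Fin n => v p.1 p.2) ∪
    (Set.range (fun p : Set ι × ι × ι => c p.1 p.2.1 p.2.2) ∪
      Set.range (fun p : Set ι × ι × Fin n => d p.1 p.2.1 p.2.2))
  have hC : C.Finite := (Set.finite_range _).union ((Set.finite_range _).union (Set.finite_range _))
  let A := Algebra.adjoin ℤ C
  have hft : Algebra.FiniteType ℤ A := .adjoin_of_finite hC
  have hA : ∀ z ∈ C, z ∈ A := fun z hz => Algebra.subset_adjoin hz
  let v₁ : ι → Fin n → A := fun s i => ⟨v s i, hA _ (Or.inl ⟨(s, i), rfl⟩)⟩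
  let c₁ : Set ι → ι → ι → A := fun S s t => ⟨c S s t, hA _ (Or.inr (Or.inl ⟨(S, s, t), rfl⟩))⟩
  let d₁ : Set ι → ι → Fin n → A := fun S s i =>
    ⟨d S s i, hA _ (Or.inr (Or.inr ⟨(S, s, i), rfl⟩))⟩
  have h₁ : ∀ S, IsRankWitness v₁ S (T S) (c₁ S) (d₁ S) := fun S =>
    IsRankWitness.of_map (φ := (A.val : A →+* K)) Subtype.val_injective (h S)
  obtain ⟨F, hF, hFfin, ⟨φ⟩⟩ := exists_ringHom_finite_field (R := A)
  exact ⟨F, hF, hFfin, fun s i => φ (v₁ s i), fun S => by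
    rw [((h₁ S).map φ).finrank_eq, (h S).finrank_eq]⟩

end Witness

section Transfer

variable {ι : Type*} [Finite ι] {K V K' V' : Type*} [Field K] [AddCommGroup V] [Module K V]
  [Field K'] [AddCommGroup V'] [Module K' V']

theorem mem_span_image_iff (v : ι → V) (S : Set ι) (e : ι) :
    v e ∈ Submodule.span K (v '' S) ↔
      finrank K (Submodule.span K (v '' insert e S)) = finrank K (Submodule.span K (v '' S)) := by
  have hle : Submodule.span K (v '' S) ≤ Submodule.span K (v '' insert e S) :=
    Submodule.span_mono (Set.image_mono (Set.subset_insert _ _))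
  have := FiniteDimensional.span_of_finite K ((insert e S).toFinite.image v)
  constructor
  · intro h
    rw [Set.image_insert_eq, Submodule.span_insert_eq_span h]
  · intro h
    rw [Submodule.eq_of_le_of_finrank_eq hle h.symm]
    exact Submodule.subset_span ⟨e, Set.mem_insert _ _, rfl⟩

/-- The subspaces of dimension `i` spanned by subfamilies of `v`. -/
def familyFlats (K : Type*) {ι V : Type*} [Field K] [AddCommGroup V] [Module K V] (v : ι → V)
    (i : ℕ) : Set (Submodule K V) :=
  {X | finrank K X = i ∧ ∃ S : Set ι, X = Submodule.span K (v '' S)}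

theorem ncard_familyFlats_le {v : ι → V} {v' : ι → V'}
    (h : ∀ S : Set ι, finrank K (Submodule.span K (v '' S)) =
      finrank K' (Submodule.span K' (v' '' S))) (i : ℕ) :
    (familyFlats K v i).ncard ≤ (familyFlats K' v' i).ncard := by
  have hcl : ∀ S : Set ι, Submodule.span K (v '' {e | v e ∈ Submodule.span K (v '' S)}) =
      Submodule.span K (v '' S) := by
    refine fun S => le_antisymm (Submodule.span_le.2 ?_) (Submodule.span_mono
      (Set.image_mono fun e he => Submodule.subset_span ⟨e, he, rfl⟩))
    rintro _ ⟨e, he, rfl⟩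
    exact he
  have hmem : ∀ (S : Set ι) e, v e ∈ Submodule.span K (v '' S) ↔
      v' e ∈ Submodule.span K' (v' '' S) := fun S e => by
    rw [mem_span_image_iff, mem_span_image_iff, h, h]
  refine Set.ncard_le_ncard_of_injOn (fun X => Submodule.span K' (v' '' {e | v e ∈ X})) ?_ ?_ ?_
  · rintro _ ⟨hi, S, rfl⟩
    exact ⟨by rw [← h, hcl, hi], _, rfl⟩
  · rintro _ ⟨_, S, rfl⟩ _ ⟨_, S', rfl⟩ hSS'
    simp only at hSS'
    rw [← hcl S, ← hcl S']
    have h1 : ∀ e, v e ∈ Submodule.span K (v '' S) ↔ v e ∈ Submodule.span K (v '' S') := by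
      intro e
      rw [← hcl S, ← hcl S', hmem, hmem, hSS']
    simp only [h1]
  · refine (Set.finite_range fun S : Set ι => Submodule.span K' (v' '' S)).subset ?_
    rintro _ ⟨_, S, rfl⟩
    exact ⟨S, rfl⟩

end Transfer

theorem finrank_span_image_comp {ι K V V' : Type*} [Field K] [AddCommGroup V] [Module K V]
    [AddCommGroup V'] [Module K V'] {f : V →ₗ[K] V'} (hf : Function.Injective f) (v : ι → V)
    (S : Set ι) : finrank K (Submodule.span K ((fun e => f (v e)) '' S)) =
      finrank K (Submodule.span K (v '' S)) := by
  rw [← Set.image_image (fun x => f x) v S, ← Submodule.map_span]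
  exact (LinearEquiv.finrank_eq (Submodule.equivMapOfInjective f hf _)).symm

theorem flats_eq_familyFlats {ι K V : Type*} [Field K] [AddCommGroup V] [Module K V]
    {E : Finset V} {v : ι → V} (h : Set.range v = E) (i : ℕ) :
    flats K E i = familyFlats K v i := by
  ext X
  refine and_congr_right fun _ => ⟨?_, ?_⟩
  · rintro ⟨S, hS, rfl⟩
    exact ⟨v ⁻¹' S, by rw [Set.image_preimage_eq_of_subset (h ▸ hS)]⟩
  · rintro ⟨S, rfl⟩
    exact ⟨v '' S, h ▸ Set.image_subset_range v S, rfl⟩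

/-- The numbers of flats of a finite configuration of vectors are realised over a finite field. -/
theorem exists_finite_field_ncard_flats {K : Type u} {V : Type*} [Field K] [AddCommGroup V]
    [Module K V] (E : Finset V) {n : ℕ}
    (hn : finrank K (Submodule.span K (E : Set V)) = n) :
    ∃ (F : Type u) (_ : Field F) (_ : Finite F) (E' : Finset (Fin n → F)),
      Submodule.span F (E' : Set (Fin n → F)) = ⊤ ∧
        ∀ i, (flats K E i).ncard = (flats F E' i).ncard := by
  classical
  have := FiniteDimensional.span_finset K E
  let e := (finBasisOfFinrankEq K (Submodule.span K (E : Set V)) hn).equivFun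
  let v : E → Fin n → K := fun x => e ⟨x, Submodule.subset_span x.2⟩
  let f : (Fin n → K) →ₗ[K] V := (Submodule.subtype _).comp e.symm.toLinearMap
  have hfv : (fun x : E => f (v x)) = Subtype.val := funext fun x =>
    congrArg Subtype.val (e.symm_apply_apply _)
  have hv : ∀ S : Set E, finrank K (Submodule.span K (Subtype.val '' S)) =
      finrank K (Submodule.span K (v '' S)) := fun S => by
    rw [← hfv, finrank_span_image_comp (Subtype.val_injective.comp e.symm.injective) v S]
  obtain ⟨F, hF, hFfin, v', hv'⟩ := exists_finite_field_finrank_eq v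
  have hr : ∀ S : Set E, finrank K (Submodule.span K (Subtype.val '' S)) =
      finrank F (Submodule.span F (v' '' S)) := fun S => by rw [hv, hv']
  have hE' : Set.range v' = (Finset.univ.image v' : Finset (Fin n → F)) := by simp
  refine ⟨F, hF, hFfin, Finset.univ.image v', ?_, fun i => ?_⟩
  · refine Submodule.eq_top_of_finrank_eq ?_
    rw [finrank_fin_fun, ← hE', ← Set.image_univ, ← hr, ← hn, Set.image_univ,
      Subtype.range_coe_subtype]
    simp
  · rw [flats_eq_familyFlats hE', flats_eq_familyFlats (v := (Subtype.val : E → V)) (by simp)]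
    exact le_antisymm (ncard_familyFlats_le hr i)
      (ncard_familyFlats_le (fun S => (hr S).symm) i)

end DowlingWilson

/-- Dowling–Wilson conjecture, proved by Huh–Wang: let `E` be a finite subset
of a vector space `V` over a field `k` whose span has dimension `d`, and let `w i` be the
number of `i`-dimensional subspaces of `V` spanned by subsets of `E`. Then for every `i` with
`2i < d`, `w i ≤ w (d − i)` and `w i ≤ w (i + 1)`. -/
theorem dowling_wilson {k V : Type*} [Field k] [AddCommGroup V] [Module k V]
    (E : Finset V) (d : ℕ)
    (hd : Module.finrank k (Submodule.span k (E : Set V)) = d)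
    (w : ℕ → ℕ)
    (hw : ∀ i, w i = Set.ncard {W : Submodule k V |
      Module.finrank k W = i ∧ ∃ S : Set V, S ⊆ (E : Set V) ∧ W = Submodule.span k S})
    (i : ℕ) (hi : 2 * i < d) :
    w i ≤ w (d - i) ∧ w i ≤ w (i + 1) := by
  obtain ⟨F, _, _, E', hE', h⟩ := DowlingWilson.exists_finite_field_ncard_flats E hd
  have hw' : ∀ j, w j = (DowlingWilson.flats F E' j).ncard := fun j => (hw j).trans (h j)
  have hdF : Module.finrank F (Fin d → F) = d := Module.finrank_fin_fun F
  rw [hw', hw', hw']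
  have := DowlingWilson.ncard_flats_le_of_finite hE' (hdF.symm ▸ hi)
  rwa [hdF] at this
end

section
/- Let Q be a finite partially ordered set with n elements. For x ∈ Q and 1 ≤ i ≤ n, let N_i(x) be the number of linear extensions e of Q in which x is the i-th largest element, i.e., e(x) = n+1−i. Then for every x ∈ Q and every i with 2 ≤ i ≤ n−1, N_i(x)^2 ≥ N_{i−1}(x) · N_{i+1}(x). -/
open Finset in
/-- The slack in the AM-GM bound of a quadratic form by its diagonal part relative to `h`. -/
theorem quad_form_gap {ι : Type*} (s : Finset ι) (A : ι → ι → ℝ) (h : ι → ℝ)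
    (hsymm : ∀ x ∈ s, ∀ y ∈ s, A x y = A y x) (hh : ∀ x ∈ s, 0 < h x) (v : ι → ℝ) :
    ∑ x ∈ s, (∑ y ∈ s, A x y * h y) / h x * v x ^ 2 - ∑ x ∈ s, v x * ∑ y ∈ s, A x y * v y =
      (∑ x ∈ s, ∑ y ∈ s, A x y * h x * h y * (v x / h x - v y / h y) ^ 2) / 2 := by
  have e1 : ∑ x ∈ s, (∑ y ∈ s, A x y * h y) / h x * v x ^ 2 =
      ∑ x ∈ s, ∑ y ∈ s, A x y * h y / h x * v x ^ 2 :=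
    sum_congr rfl fun x _ => by rw [sum_div, sum_mul]
  have e2 : ∑ x ∈ s, ∑ y ∈ s, A x y * h y / h x * v x ^ 2 =
      ∑ x ∈ s, ∑ y ∈ s, A x y * h x / h y * v y ^ 2 := by
    rw [sum_comm]
    exact sum_congr rfl fun x hx => sum_congr rfl fun y hy => by rw [hsymm x hx y hy]
  have e3 : ∑ x ∈ s, ∑ y ∈ s, A x y * h x * h y * (v x / h x - v y / h y) ^ 2 =
      ∑ x ∈ s, ∑ y ∈ s, A x y * h y / h x * v x ^ 2 +
      ∑ x ∈ s, ∑ y ∈ s, A x y * h x / h y * v y ^ 2 -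
      2 * ∑ x ∈ s, v x * ∑ y ∈ s, A x y * v y := by
    rw [mul_sum, ← sum_add_distrib, ← sum_sub_distrib]
    refine sum_congr rfl fun x hx => ?_
    rw [mul_sum, mul_sum, ← sum_add_distrib, ← sum_sub_distrib]
    refine sum_congr rfl fun y hy => ?_
    have := (hh x hx).ne'
    have := (hh y hy).ne'
    field_simp
    ring
  rw [e3, ← e2, e1]
  ring

open Finset in
/-- If every eigenvector of `A` relative to the diagonal form `d` with positive eigenvalue is a
multiple of `h`, then `A` is negative semidefinite on the `d`-orthogonal complement of `h`. -/
theorem nonpos_of_eigen {ι : Type*} [Fintype ι] [DecidableEq ι] (A : ι → ι → ℝ) (d h : ι → ℝ)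
    (hsymm : ∀ x y, A x y = A y x) (hd : ∀ x, 0 < d x)
    (heig : ∀ (l : ℝ) (v : ι → ℝ), v ≠ 0 → (∀ x, ∑ y, A x y * v y = l * (d x * v x)) → 0 < l →
      ∃ c, ∀ x, v x = c * h x)
    (v : ι → ℝ) (hv : ∑ x, d x * v x * h x = 0) :
    ∑ x, v x * ∑ y, A x y * v y ≤ 0 := by
  have hs : ∀ x, 0 < √(d x) := fun x => Real.sqrt_pos.2 (hd x)
  have hss : ∀ x, √(d x) * √(d x) = d x := fun x => Real.mul_self_sqrt (hd x).le
  let C : Matrix ι ι ℝ := fun x y => A x y / (√(d x) * √(d y))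
  have hCs : ∀ x y, C x y = C y x := fun x y => by simp only [C, hsymm x y, mul_comm]
  have hC : C.IsHermitian := by
    ext x y
    rw [Matrix.conjTranspose_apply, star_trivial, hCs]
  let b := hC.eigenvectorBasis
  let u : EuclideanSpace ℝ ι := WithLp.toLp 2 fun x => √(d x) * v x
  let Cu : EuclideanSpace ℝ ι := WithLp.toLp 2 (C.mulVec u.ofLp)
  have hb : ∀ k x, ∑ y, C x y * b k y = hC.eigenvalues k * b k x := by
    intro k x
    have := congrFun (hC.mulVec_eigenvectorBasis k) x
    simpa [Matrix.mulVec, dotProduct] using this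
  have e1 : ∑ x, v x * ∑ y, A x y * v y = inner ℝ u Cu := by
    simp only [PiLp.inner_apply, u, Cu, Matrix.mulVec, dotProduct, C]
    refine sum_congr rfl fun x _ => ?_
    simp only [RCLike.inner_apply, conj_trivial, sum_mul, mul_sum]
    refine sum_congr rfl fun y _ => ?_
    have := (hs x).ne'
    have := (hs y).ne'
    field_simp
  have e2 : ∀ k, inner ℝ (b k) Cu = hC.eigenvalues k * inner ℝ (b k) u := by
    intro k
    simp only [PiLp.inner_apply, RCLike.inner_apply, conj_trivial, Cu, Matrix.mulVec, dotProduct,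
      sum_mul, mul_sum]
    rw [sum_comm]
    refine sum_congr rfl fun y _ => ?_
    have := hb k y
    calc _ = u.ofLp y * ∑ x, C y x * b k x := by
          rw [mul_sum]
          refine sum_congr rfl fun x _ => ?_
          rw [hCs]; ring
      _ = _ := by rw [this]; ring
  rw [e1, ← b.sum_inner_mul_inner u Cu]
  refine sum_nonpos fun k _ => ?_
  rw [e2, real_inner_comm]
  rcases le_or_gt (hC.eigenvalues k) 0 with hl | hl
  · nlinarith [mul_self_nonneg (inner ℝ (b k) u : ℝ)]
  · obtain ⟨c, hc⟩ := heig (hC.eigenvalues k) (fun x => b k x / √(d x)) (by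
      intro h0
      apply b.orthonormal.ne_zero k
      ext x
      have := congrFun h0 x
      simp only [Pi.zero_apply, div_eq_zero_iff, (hs x).ne', or_false] at this
      simpa using this) (by
      intro x
      have := hb k x
      calc _ = √(d x) * ∑ y, C x y * b k y := by
            rw [mul_sum]
            refine sum_congr rfl fun y _ => ?_
            have := (hs x).ne'
            simp only [C]
            field_simp
        _ = hC.eigenvalues k * (√(d x) * √(d x) * (b k x / √(d x))) := by
            rw [this, mul_assoc, mul_div_cancel₀ _ (hs x).ne']
            ring
        _ = _ := by rw [hss x]) hl
    have : inner ℝ (b k) u = 0 := by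
      calc inner ℝ (b k) u = c * ∑ x, d x * v x * h x := by
            simp only [PiLp.inner_apply, RCLike.inner_apply, conj_trivial, u, mul_sum]
            refine sum_congr rfl fun x _ => ?_
            have h1 := hc x
            have h2 : b k x = c * h x * √(d x) := by
              rw [← h1, div_mul_cancel₀ _ (hs x).ne']
            rw [h2, ← hss x]
            have := hss x
            simp only [Real.sqrt_mul_self (hs x).le]
            ring
        _ = 0 := by rw [hv, mul_zero]
    rw [this]; simp

open Finset in
/-- A nonnegative irreducible symmetric form satisfying a Bochner-type inequality relative to a
positive vector `h` is negative semidefinite on the orthogonal complement of `h`. -/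
theorem nonpos_of_bochner {ι : Type*} (s : Finset ι) (A : ι → ι → ℝ) (h : ι → ℝ)
    (hsymm : ∀ x ∈ s, ∀ y ∈ s, A x y = A y x) (hA : ∀ x ∈ s, ∀ y ∈ s, 0 ≤ A x y)
    (hh : ∀ x ∈ s, 0 < h x) (hAh : ∀ x ∈ s, 0 < ∑ y ∈ s, A x y * h y)
    (hconn : ∀ u : ι → ℝ, (∀ x ∈ s, ∀ y ∈ s, 0 < A x y → u x = u y) →
      ∀ x ∈ s, ∀ y ∈ s, u x = u y)
    (hboch : ∀ v : ι → ℝ, ∑ x ∈ s, v x * ∑ y ∈ s, A x y * v y ≤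
      ∑ x ∈ s, h x / (∑ y ∈ s, A x y * h y) * (∑ y ∈ s, A x y * v y) ^ 2)
    (v : ι → ℝ) (hv : ∑ x ∈ s, v x * ∑ y ∈ s, A x y * h y = 0) :
    ∑ x ∈ s, v x * ∑ y ∈ s, A x y * v y ≤ 0 := by
  classical
  have hd : ∀ x ∈ s, 0 < (∑ y ∈ s, A x y * h y) / h x := fun x hx => div_pos (hAh x hx) (hh x hx)
  have key := nonpos_of_eigen (ι := s) (fun x y => A x y)
    (fun x => (∑ y ∈ s, A x y * h y) / h x) (fun x => h x)
    (fun x y => hsymm x x.2 y y.2) (fun x => hd x x.2) ?_ (fun x => v x) ?_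
  · rw [← sum_coe_sort s]
    simpa only [← sum_coe_sort s (fun y => A _ y * v y)] using key
  · intro l w hw0 hw hl
    let W : ι → ℝ := fun x => if hx : x ∈ s then w ⟨x, hx⟩ else 0
    have hWw : ∀ x : s, W x = w x := fun x => by simp [W]
    have hW : ∀ x ∈ s, ∑ y ∈ s, A x y * W y = l * ((∑ y ∈ s, A x y * h y) / h x * W x) := by
      intro x hx
      rw [← sum_coe_sort s (fun y => A x y * W y)]
      simp only [hWw]
      rw [hw ⟨x, hx⟩, ← hWw ⟨x, hx⟩]
    have hpos : 0 < ∑ x ∈ s, (∑ y ∈ s, A x y * h y) / h x * W x ^ 2 := by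
      obtain ⟨x, hx⟩ := Function.ne_iff.1 hw0
      refine sum_pos' (fun x hx => mul_nonneg (hd x hx).le (sq_nonneg _)) ⟨x, x.2, ?_⟩
      rw [hWw]
      exact mul_pos (hd x x.2) (sq_pos_iff.2 hx)
    have e1 : ∑ x ∈ s, W x * ∑ y ∈ s, A x y * W y =
        l * ∑ x ∈ s, (∑ y ∈ s, A x y * h y) / h x * W x ^ 2 := by
      rw [mul_sum]
      exact sum_congr rfl fun x hx => by rw [hW x hx]; ring
    have e2 : ∑ x ∈ s, h x / (∑ y ∈ s, A x y * h y) * (∑ y ∈ s, A x y * W y) ^ 2 =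
        l ^ 2 * ∑ x ∈ s, (∑ y ∈ s, A x y * h y) / h x * W x ^ 2 := by
      rw [mul_sum]
      refine sum_congr rfl fun x hx => ?_
      rw [hW x hx]
      have := (hh x hx).ne'
      have := (hAh x hx).ne'
      field_simp
    have hl1 : 1 ≤ l := by
      have := hboch W
      rw [e1, e2] at this
      have := le_of_mul_le_mul_right this hpos
      nlinarith
    have gap := quad_form_gap s A h hsymm hh W
    rw [e1] at gap
    have hterm : ∀ x ∈ s, ∀ y ∈ s, 0 ≤ A x y * h x * h y * (W x / h x - W y / h y) ^ 2 :=
      fun x hx y hy => mul_nonneg (mul_nonneg (mul_nonneg (hA x hx y hy) (hh x hx).le)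
        (hh y hy).le) (sq_nonneg _)
    have hzero : ∑ x ∈ s, ∑ y ∈ s, A x y * h x * h y * (W x / h x - W y / h y) ^ 2 = 0 := by
      refine le_antisymm ?_ (sum_nonneg fun x hx => sum_nonneg fun y hy => hterm x hx y hy)
      nlinarith
    have hc := hconn (fun x => W x / h x) (by
      intro x hx y hy hxy
      have h1 := (sum_eq_zero_iff_of_nonneg
        (fun x hx => sum_nonneg fun y hy => hterm x hx y hy)).1 hzero x hx
      have h2 := (sum_eq_zero_iff_of_nonneg (fun y hy => hterm x hx y hy)).1 h1 y hy
      have h3 : A x y * h x * h y ≠ 0 := (mul_pos (mul_pos hxy (hh x hx)) (hh y hy)).ne'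
      have h4 := (mul_eq_zero.1 h2).resolve_left h3
      exact sub_eq_zero.1 (pow_eq_zero_iff two_ne_zero |>.1 h4))
    obtain ⟨x0, -⟩ := Function.ne_iff.1 hw0
    refine ⟨W x0 / h x0, fun x => ?_⟩
    have h1 : W x / h x = W x0 / h x0 := hc x x.2 x0 x0.2
    rw [← h1, hWw, div_mul_cancel₀ _ (hh x x.2).ne']
  · rw [← hv, ← sum_coe_sort s (fun x => v x * ∑ y ∈ s, A x y * h y)]
    refine sum_congr rfl fun x _ => ?_
    have := (hh x x.2).ne'
    field_simp

section Moves
open Finset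
open scoped Classical

variable {Q : Type*} [PartialOrder Q]

/-- `Blocks true b a`: `b` prevents `a` from being maximal;
`Blocks false b a`: `b` prevents `a` from being minimal. -/
def Blocks : Bool → Q → Q → Prop
  | true, b, a => a < b
  | false, b, a => b < a

/-- A move `(a, true)` removes a maximal element `a` of `R` that can lie above `z`; a move `(a, false)`
removes a minimal element `a` of `R` that can lie below `z`. -/
noncomputable def availableMoves (z : Q) (R : Finset Q) : Finset (Q × Bool) :=
  (R ×ˢ univ).filter fun x => ∀ b ∈ insert z R, ¬ Blocks x.2 b x.1

/-- Sum over sequences of available moves, the `k`-th move being weighted by the `k`-th direction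
evaluated at its sign. -/
noncomputable def weight (z : Q) : List (Bool → ℝ) → Finset Q → ℝ
  | [], _ => 1
  | h :: hs, R => ∑ x ∈ availableMoves z R, h x.2 * weight z hs (R.erase x.1)

/-- After the move `x`, newly available moves get the value of `x`. -/
noncomputable def inherit (z : Q) (R : Finset Q) (x : Q × Bool) (v : Q × Bool → ℝ) :
    Q × Bool → ℝ :=
  fun y => if y ∈ availableMoves z R then v y else v x

/-- The coefficient of `v x` in `bilin z hs R v w`. -/
noncomputable def bilinRow (z : Q) (hs : List (Bool → ℝ)) (R : Finset Q) (x : Q × Bool)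
    (w : Q × Bool → ℝ) : ℝ :=
  ∑ y ∈ availableMoves z (R.erase x.1),
    inherit z R x w y * weight z hs ((R.erase x.1).erase y.1)

/-- The bilinear form obtained from `weight` by letting the first two directions be arbitrary
functions of the moves. It is the combinatorial analogue of a mixed volume. -/
noncomputable def bilin (z : Q) (hs : List (Bool → ℝ)) (R : Finset Q) (v w : Q × Bool → ℝ) : ℝ :=
  ∑ x ∈ availableMoves z R, v x * bilinRow z hs R x w

/-- The symmetric matrix of `bilin` on the available moves. -/
noncomputable def bilinMatrix (z : Q) (hs : List (Bool → ℝ)) (R : Finset Q) (x y : Q × Bool) : ℝ :=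
  (if y.1 ≠ x.1 then weight z hs ((R.erase x.1).erase y.1) else 0) +
  if x = y then ∑ y' ∈ availableMoves z (R.erase x.1) \ availableMoves z R,
    weight z hs ((R.erase x.1).erase y'.1) else 0

variable {z : Q} {R : Finset Q} {x y w : Q × Bool}

theorem Blocks.swap {s t : Bool} {a b : Q} (h : Blocks s a b) (hst : s ≠ t) : Blocks t b a := by
  cases s <;> cases t <;> simp_all [Blocks]

theorem mem_availableMoves :
    x ∈ availableMoves z R ↔ x.1 ∈ R ∧ ∀ b ∈ insert z R, ¬ Blocks x.2 b x.1 := by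
  simp [availableMoves]

theorem availableMoves_erase (hx : x ∈ availableMoves z R) {a : Q} (ha : x.1 ≠ a) :
    x ∈ availableMoves z (R.erase a) := by
  rw [mem_availableMoves] at hx ⊢
  exact ⟨mem_erase.2 ⟨ha, hx.1⟩,
    fun b hb => hx.2 b (insert_subset_insert _ (erase_subset _ _) hb)⟩

theorem snd_eq_of_newly_available (hx : x ∈ availableMoves z R)
    (hy : y ∈ availableMoves z (R.erase x.1)) (hy' : y ∉ availableMoves z R) : y.2 = x.2 := by
  rw [mem_availableMoves] at hx hy hy'
  have hyR := mem_of_mem_erase hy.1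
  push Not at hy'
  obtain ⟨b, hb, hby⟩ := hy' hyR
  have hbx : b = x.1 := by
    by_contra hne
    refine hy.2 b ?_ hby
    rw [mem_insert] at hb ⊢
    exact hb.imp id fun h => mem_erase.2 ⟨hne, h⟩
  subst hbx
  by_contra hne
  exact hx.2 y.1 (mem_insert_of_mem hyR) (hby.swap hne)

theorem available_of_available_erase (h1 : w ∈ availableMoves z (R.erase x.1))
    (h2 : w ∈ availableMoves z (R.erase y.1)) (hxy : y.1 ≠ x.1) : w ∈ availableMoves z R := by
  rw [mem_availableMoves] at h1 h2 ⊢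
  refine ⟨mem_of_mem_erase h1.1, fun b hb => ?_⟩
  by_cases hbx : b = x.1
  · refine h2.2 b ?_
    rw [mem_insert] at hb ⊢
    exact hb.imp id fun h => mem_erase.2 ⟨by rw [hbx]; exact hxy.symm, h⟩
  · refine h1.2 b ?_
    rw [mem_insert] at hb ⊢
    exact hb.imp id fun h => mem_erase.2 ⟨hbx, h⟩

theorem availableMoves_nonempty (hR : R.Nonempty) : (availableMoves z R).Nonempty := by
  by_cases h : (R.filter fun a => ¬ a < z).Nonempty
  · obtain ⟨a, ha⟩ := (R.filter fun a => ¬ a < z).exists_maximal h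
    have ha' := mem_filter.1 ha.1
    refine ⟨(a, true), mem_availableMoves.2 ⟨ha'.1, fun b hb hab => ?_⟩⟩
    simp only [Blocks] at hab
    rcases mem_insert.1 hb with rfl | hb
    · exact ha'.2 hab
    · exact ha.not_gt (mem_filter.2 ⟨hb, fun hbz => ha'.2 (hab.trans hbz)⟩) hab
  · have hz : ∀ a ∈ R, a < z := by
      intro a ha
      by_contra hc
      exact h ⟨a, mem_filter.2 ⟨ha, hc⟩⟩
    obtain ⟨a, ha⟩ := R.exists_minimal hR
    refine ⟨(a, false), mem_availableMoves.2 ⟨ha.1, fun b hb hab => ?_⟩⟩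
    simp only [Blocks] at hab
    rcases mem_insert.1 hb with rfl | hb
    · exact lt_asymm hab (hz a ha.1)
    · exact ha.not_lt hb hab

theorem weight_nonneg {hs : List (Bool → ℝ)} (hpos : ∀ h ∈ hs, ∀ s, 0 ≤ h s) (R : Finset Q) :
    0 ≤ weight z hs R := by
  induction hs generalizing R with
  | nil => simp [weight]
  | cons h hs ih =>
    simp only [weight]
    exact sum_nonneg fun x _ => mul_nonneg (hpos h (by simp) _)
      (ih (fun g hg => hpos g (by simp [hg])) _)

theorem weight_pos {hs : List (Bool → ℝ)} (hpos : ∀ h ∈ hs, ∀ s, 0 < h s) (R : Finset Q)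
    (hR : hs.length ≤ R.card) : 0 < weight z hs R := by
  induction hs generalizing R with
  | nil => simp [weight]
  | cons h hs ih =>
    simp only [weight, List.length_cons] at hR ⊢
    refine sum_pos (fun x hx => mul_pos (hpos h (by simp) _)
      (ih (fun g hg => hpos g (by simp [hg])) _ ?_))
      (availableMoves_nonempty (card_pos.1 (by omega)))
    rw [card_erase_of_mem (mem_availableMoves.1 hx).1]
    omega

theorem sum_availableMoves_erase (x : Q × Bool) (f : Q × Bool → ℝ) :
    ∑ y ∈ availableMoves z (R.erase x.1), f y =
      ∑ y ∈ (availableMoves z R).filter (fun y => y.1 ≠ x.1), f y +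
      ∑ y ∈ availableMoves z (R.erase x.1) \ availableMoves z R, f y := by
  rw [← sum_inter_add_sum_sdiff (availableMoves z (R.erase x.1)) (availableMoves z R)]
  congr 1
  refine sum_congr ?_ fun _ _ => rfl
  ext y
  simp only [mem_inter, mem_filter]
  exact ⟨fun h => ⟨h.2, (mem_erase.1 (mem_availableMoves.1 h.1).1).1⟩,
    fun h => ⟨availableMoves_erase h.1 h.2, h.1⟩⟩

theorem bilinRow_eq_matrix (hs : List (Bool → ℝ)) (hx : x ∈ availableMoves z R)
    (v : Q × Bool → ℝ) :
    bilinRow z hs R x v = ∑ y ∈ availableMoves z R, bilinMatrix z hs R x y * v y := by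
  simp only [bilinRow, bilinMatrix, add_mul, sum_add_distrib, ite_mul, zero_mul]
  rw [sum_availableMoves_erase, sum_ite_eq, if_pos hx, ← sum_filter, sum_mul]
  congr 1
  · refine sum_congr rfl fun y hy => ?_
    rw [inherit, if_pos (mem_filter.1 hy).1, mul_comm]
  · refine sum_congr rfl fun y hy => ?_
    rw [inherit, if_neg (mem_sdiff.1 hy).2, mul_comm]

theorem bilinMatrix_symm (hs : List (Bool → ℝ)) (x y : Q × Bool) :
    bilinMatrix z hs R x y = bilinMatrix z hs R y x := by
  by_cases h : x = y
  · rw [h]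
  · simp only [bilinMatrix, if_neg h, if_neg (Ne.symm h), erase_right_comm (a := x.1),
      ne_comm (a := y.1)]

theorem bilin_eq_matrix (hs : List (Bool → ℝ)) (v w : Q × Bool → ℝ) :
    bilin z hs R v w = ∑ x ∈ availableMoves z R,
      v x * ∑ y ∈ availableMoves z R, bilinMatrix z hs R x y * w y :=
  sum_congr rfl fun x hx => by rw [bilinRow_eq_matrix hs hx]

theorem bilin_comm (hs : List (Bool → ℝ)) (v w : Q × Bool → ℝ) :
    bilin z hs R v w = bilin z hs R w v := by
  simp only [bilin_eq_matrix, mul_sum]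
  rw [sum_comm]
  refine sum_congr rfl fun x _ => sum_congr rfl fun y _ => ?_
  rw [bilinMatrix_symm]; ring

theorem bilin_linear (hs : List (Bool → ℝ)) (a b : ℝ) (u v w : Q × Bool → ℝ) :
    bilin z hs R (fun x => a * u x - b * v x) w = a * bilin z hs R u w - b * bilin z hs R v w := by
  simp only [bilin, mul_sum, ← sum_sub_distrib]
  exact sum_congr rfl fun x _ => by ring

theorem inherit_sign (h : Bool → ℝ) (hx : x ∈ availableMoves z R)
    (hy : y ∈ availableMoves z (R.erase x.1)) :
    inherit z R x (fun t => h t.2) y = h y.2 := by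
  unfold inherit
  split_ifs with hyR
  · rfl
  · rw [snd_eq_of_newly_available hx hy hyR]

theorem bilinRow_cons (h : Bool → ℝ) (hs : List (Bool → ℝ)) (x : Q × Bool)
    (v : Q × Bool → ℝ) :
    bilinRow z (h :: hs) R x v =
      bilin z hs (R.erase x.1) (inherit z R x v) fun t => h t.2 := by
  refine sum_congr rfl fun y hy => ?_
  rw [bilinRow, weight]
  congr 1
  exact sum_congr rfl fun w hw => by rw [inherit_sign h hy hw]

theorem bilin_sign (h g : Bool → ℝ) (hs : List (Bool → ℝ)) :
    bilin z hs R (fun t => h t.2) (fun t => g t.2) = weight z (h :: g :: hs) R := by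
  simp only [weight, bilin, bilinRow]
  refine sum_congr rfl fun x hx => ?_
  congr 1
  exact sum_congr rfl fun y hy => by rw [inherit_sign g hx hy]

/-- From a negative semidefinite orthogonal complement to the reversed Cauchy–Schwarz inequality. -/
theorem bilin_hyperbolic_of_complement (hs : List (Bool → ℝ)) (h : Q × Bool → ℝ)
    (hneg : ∀ v, bilin z hs R v h = 0 → bilin z hs R v v ≤ 0) (v w : Q × Bool → ℝ)
    (hw : 0 < bilin z hs R w w) :
    bilin z hs R v v * bilin z hs R w w ≤ bilin z hs R v w ^ 2 := by
  have hα : bilin z hs R w h ≠ 0 := fun h0 => absurd (hneg w h0) (not_le.2 hw)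
  set α := bilin z hs R w h
  set β := bilin z hs R v h
  have h1 := hneg (fun x => α * v x - β * w x) (by rw [bilin_linear]; ring)
  rw [bilin_linear, bilin_comm hs v, bilin_comm hs w, bilin_linear, bilin_linear,
    bilin_comm hs w v] at h1
  have hα2 : 0 < α ^ 2 := by positivity
  by_contra hcon
  push Not at hcon
  nlinarith [mul_nonneg hw.le (neg_nonneg.2 h1), mul_pos hα2 (sub_pos.2 hcon),
    sq_nonneg (β * bilin z hs R w w - α * bilin z hs R v w)]

end Moves

section Base
open Finset
open scoped Classical
variable {Q : Type*} [PartialOrder Q] {z : Q} {R : Finset Q} {x y w : Q × Bool}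

theorem bilin_nil_pair_of_incomp {a b : Q} (hab : a ≠ b) (h1 : ¬ a < b) (h2 : ¬ b < a)
    (v w : Q × Bool → ℝ) :
    bilin z [] {a, b} v w =
      ((if a < z then 0 else v (a, true)) + if z < a then 0 else v (a, false)) *
        ((if b < z then 0 else w (b, true)) + if z < b then 0 else w (b, false)) +
      ((if b < z then 0 else v (b, true)) + if z < b then 0 else v (b, false)) *
        ((if a < z then 0 else w (a, true)) + if z < a then 0 else w (a, false)) := by
  have e1 : ({a, b} : Finset Q).erase a = {b} := by
    rw [erase_insert (by simpa using hab)]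
  have e2 : ({a, b} : Finset Q).erase b = {a} := by
    rw [pair_comm, erase_insert (by simpa using hab.symm)]
  simp only [bilin, bilinRow, availableMoves, weight, sum_filter, sum_product, sum_pair hab,
    Fintype.sum_bool, inherit, mem_filter, e1, e2, sum_singleton, Blocks, mem_insert,
    mem_singleton, forall_eq_or_imp, forall_eq, mem_product, mem_univ, and_true, lt_irrefl,
    not_false_eq_true, true_and, h1, h2, hab, hab.symm, true_or, or_true, mul_one, ite_not]
  split_ifs <;> ring

theorem bilin_nil_pair_of_lt {a b : Q} (hab : a < b) (v w : Q × Bool → ℝ) :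
    bilin z [] {a, b} v w =
      (if a < z then 0 else v (b, true) * w (b, true)) +
      (if z < b then 0 else v (a, false) * w (a, false)) +
      (if b < z ∨ z < a then 0 else v (a, false) * w (b, true) + v (b, true) * w (a, false)) := by
  have e1 : ({a, b} : Finset Q).erase a = {b} := by
    rw [erase_insert (by simpa using hab.ne)]
  have e2 : ({a, b} : Finset Q).erase b = {a} := by
    rw [pair_comm, erase_insert (by simpa using hab.ne')]
  have hz1 : b < z → a < z := hab.trans
  have hz2 : z < a → z < b := fun h => h.trans hab
  simp only [bilin, bilinRow, availableMoves, weight, sum_filter, sum_product, sum_pair hab.ne,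
    Fintype.sum_bool, inherit, mem_filter, e1, e2, sum_singleton, Blocks, mem_insert,
    mem_singleton, forall_eq_or_imp, forall_eq, mem_product, mem_univ, and_true, lt_irrefl,
    not_false_eq_true, true_and, hab, hab.not_gt, hab.ne, hab.ne', true_or, or_true, mul_one,
    ite_not, not_true_eq_false, and_false, if_false]
  by_cases h1 : a < z <;> by_cases h2 : b < z <;> by_cases h3 : z < a <;> by_cases h4 : z < b <;>
    simp_all <;> ring

theorem bilin_nil_hyperbolic (hR : R.card = 2) (v w : Q × Bool → ℝ) :
    bilin z [] R v v * bilin z [] R w w ≤ bilin z [] R v w ^ 2 := by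
  have chain : ∀ a b : Q, a < b →
      bilin z [] {a, b} v v * bilin z [] {a, b} w w ≤ bilin z [] {a, b} v w ^ 2 := by
    intro a b hab
    have hz1 : b < z → a < z := hab.trans
    have hz2 : z < a → z < b := fun h => h.trans hab
    simp only [bilin_nil_pair_of_lt hab]
    by_cases h1 : a < z <;> by_cases h2 : b < z <;> by_cases h3 : z < a <;> by_cases h4 : z < b <;>
      simp_all <;>
      nlinarith [sq_nonneg (v (a, false) * w (b, true) - v (b, true) * w (a, false)),
        sq_nonneg (v (a, false) * w (b, true) + v (b, true) * w (a, false))]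
  obtain ⟨a, b, hab, rfl⟩ := card_eq_two.1 hR
  by_cases h1 : a < b
  · exact chain a b h1
  by_cases h2 : b < a
  · rw [pair_comm]; exact chain b a h2
  simp only [bilin_nil_pair_of_incomp hab h1 h2]
  generalize ((if a < z then 0 else v (a, true)) + if z < a then 0 else v (a, false)) = p
  generalize ((if a < z then 0 else w (a, true)) + if z < a then 0 else w (a, false)) = q
  generalize ((if b < z then 0 else v (b, true)) + if z < b then 0 else v (b, false)) = r
  generalize ((if b < z then 0 else w (b, true)) + if z < b then 0 else w (b, false)) = s
  nlinarith [sq_nonneg (p * s - r * q)]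

end Base

section Step
open Finset
open scoped Classical
variable {Q : Type*} [PartialOrder Q] {z : Q} {R : Finset Q} {x y w : Q × Bool}

/-- Total weight of the moves enabled only by performing both `x` and `y`. -/
noncomputable def jointlyEnabled (z : Q) (hs : List (Bool → ℝ)) (R : Finset Q) (x y : Q × Bool) :
    ℝ :=
  ∑ w ∈ (availableMoves z ((R.erase x.1).erase y.1)).filter
      (fun w => w ∉ availableMoves z (R.erase x.1) ∧ w ∉ availableMoves z (R.erase y.1)),
    weight z hs (((R.erase x.1).erase y.1).erase w.1)

theorem jointlyEnabled_comm (hs : List (Bool → ℝ)) (x y : Q × Bool) :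
    jointlyEnabled z hs R x y = jointlyEnabled z hs R y x := by
  simp only [jointlyEnabled, erase_right_comm (a := x.1),
    and_comm (a := _ ∉ availableMoves z (R.erase x.1))]

theorem jointlyEnabled_nonneg {hs : List (Bool → ℝ)} (hpos : ∀ h ∈ hs, ∀ s, 0 ≤ h s)
    (x y : Q × Bool) : 0 ≤ jointlyEnabled z hs R x y :=
  sum_nonneg fun _ _ => weight_nonneg hpos _

theorem jointlyEnabled_eq_zero (hs : List (Bool → ℝ)) (hx : x ∈ availableMoves z R)
    (hy : y ∈ availableMoves z R) (hyx : y.1 ≠ x.1) (hne : x.2 ≠ y.2) :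
    jointlyEnabled z hs R x y = 0 := by
  refine sum_eq_zero fun w hw => absurd ?_ hne
  obtain ⟨h1, h2, h3⟩ := mem_filter.1 hw
  rw [← snd_eq_of_newly_available (availableMoves_erase hy hyx) h1 h2]
  rw [erase_right_comm] at h1
  rw [snd_eq_of_newly_available (availableMoves_erase hx hyx.symm) h1 h3]

theorem bilinRow_inherit_sub (hs : List (Bool → ℝ)) (v : Q × Bool → ℝ)
    (hx : x ∈ availableMoves z R) (hy : y ∈ availableMoves z R) (hyx : y.1 ≠ x.1) :
    bilinRow z hs (R.erase x.1) y (inherit z R x v) -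
      bilinRow z hs (R.erase y.1) x (inherit z R y v) =
    (v y - v x) * jointlyEnabled z hs R x y := by
  have hyv : inherit z R x v y = v y := if_pos hy
  have hxv : inherit z R y v x = v x := if_pos hx
  rw [bilinRow, bilinRow, jointlyEnabled, erase_right_comm (a := y.1), ← sum_sub_distrib,
    sum_filter, mul_sum]
  refine sum_congr rfl fun w hw => ?_
  have hw1 := (mem_availableMoves.1 hw).1
  have hwy : w.1 ≠ y.1 := (mem_erase.1 hw1).1
  have hwx : w.1 ≠ x.1 := (mem_erase.1 (mem_erase.1 hw1).2).1
  rw [inherit, hyv, inherit, inherit, hxv, inherit]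
  by_cases hwR : w ∈ availableMoves z R
  · simp [hwR, availableMoves_erase hwR hwx, availableMoves_erase hwR hwy]
  · by_cases h1 : w ∈ availableMoves z (R.erase x.1) <;>
      by_cases h2 : w ∈ availableMoves z (R.erase y.1)
    · exact absurd (available_of_available_erase h1 h2 hyx) hwR
    · simp [hwR, h1, h2]
    · simp [hwR, h1, h2]
    · simp [h1, h2]; ring

theorem bilin_cons_le_sum (h : Bool → ℝ) (hs : List (Bool → ℝ)) (hh : ∀ s, 0 ≤ h s)
    (hpos : ∀ h ∈ hs, ∀ s, 0 ≤ h s) (v : Q × Bool → ℝ) :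
    bilin z (h :: hs) R v v ≤ ∑ x ∈ availableMoves z R,
      h x.2 * bilin z hs (R.erase x.1) (inherit z R x v) (inherit z R x v) := by
  let Z : Q × Bool → Q × Bool → ℝ := fun x y =>
    bilinRow z hs (R.erase x.1) y (inherit z R x v)
  let s := availableMoves z R
  let N : Q × Bool → ℝ := fun x => ∑ y ∈ availableMoves z (R.erase x.1) \ s, h x.2 * v x * Z x y
  have e1 : bilin z (h :: hs) R v v =
      ∑ x ∈ s, ((∑ y ∈ s, if y.1 ≠ x.1 then v x * h y.2 * Z x y else 0) + N x) := by
    refine sum_congr rfl fun x hx => ?_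
    rw [bilinRow_cons h hs x, bilin_comm, bilin, sum_availableMoves_erase, mul_add, mul_sum,
      mul_sum, ← sum_filter]
    congr 1
    · exact sum_congr rfl fun y _ => by ring
    · refine sum_congr rfl fun y hy => ?_
      rw [snd_eq_of_newly_available hx (mem_sdiff.1 hy).1 (mem_sdiff.1 hy).2]
      ring
  have e2 : ∑ x ∈ s, h x.2 * bilin z hs (R.erase x.1) (inherit z R x v) (inherit z R x v) =
      ∑ x ∈ s, ((∑ y ∈ s, if y.1 ≠ x.1 then h x.2 * v y * Z x y else 0) + N x) := by
    refine sum_congr rfl fun x hx => ?_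
    rw [bilin, sum_availableMoves_erase, mul_add, mul_sum, mul_sum, ← sum_filter]
    congr 1
    · refine sum_congr rfl fun y hy => ?_
      rw [inherit, if_pos (mem_filter.1 hy).1, mul_assoc]
    · refine sum_congr rfl fun y hy => ?_
      rw [inherit, if_neg (mem_sdiff.1 hy).2, mul_assoc]
  have e3 : ∑ x ∈ s, ∑ y ∈ s, (if y.1 ≠ x.1 then v x * h y.2 * Z x y else 0) =
      ∑ x ∈ s, ∑ y ∈ s, (if y.1 ≠ x.1 then h x.2 * v y * Z y x else 0) := by
    rw [sum_comm]
    refine sum_congr rfl fun x _ => sum_congr rfl fun y _ => ?_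
    simp only [ne_comm (a := y.1)]
    split_ifs <;> ring
  let K := jointlyEnabled z hs R
  have e4 : ∑ x ∈ s, ∑ y ∈ s, (if y.1 ≠ x.1 then h x.2 * v y * Z x y else 0) -
      ∑ x ∈ s, ∑ y ∈ s, (if y.1 ≠ x.1 then h x.2 * v y * Z y x else 0) =
      ∑ x ∈ s, ∑ y ∈ s, (if y.1 ≠ x.1 then h x.2 * v y * (v y - v x) * K x y else 0) := by
    rw [← sum_sub_distrib]
    refine sum_congr rfl fun x hx => ?_
    rw [← sum_sub_distrib]
    refine sum_congr rfl fun y hy => ?_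
    split_ifs with hyx
    · rw [← mul_sub, bilinRow_inherit_sub hs v hx hy hyx]
      ring
    · simp
  have e5 : ∑ x ∈ s, ∑ y ∈ s, (if y.1 ≠ x.1 then h x.2 * v y * (v y - v x) * K x y else 0) =
      ∑ x ∈ s, ∑ y ∈ s, (if y.1 ≠ x.1 then h y.2 * v x * (v x - v y) * K x y else 0) := by
    rw [sum_comm]
    refine sum_congr rfl fun x _ => sum_congr rfl fun y _ => ?_
    simp only [ne_comm (a := y.1), K, jointlyEnabled_comm hs y x]
  have e6 : 0 ≤ ∑ x ∈ s, ∑ y ∈ s,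
        (if y.1 ≠ x.1 then h x.2 * v y * (v y - v x) * K x y else 0) +
      ∑ x ∈ s, ∑ y ∈ s, (if y.1 ≠ x.1 then h y.2 * v x * (v x - v y) * K x y else 0) := by
    rw [← sum_add_distrib]
    refine sum_nonneg fun x hx => ?_
    rw [← sum_add_distrib]
    refine sum_nonneg fun y hy => ?_
    split_ifs with hyx
    · by_cases hs2 : x.2 = y.2
      · have := mul_nonneg (mul_nonneg (hh y.2) (sq_nonneg (v y - v x)))
          (jointlyEnabled_nonneg (z := z) (R := R) hpos x y)
        rw [hs2]
        simp only [K]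
        linarith
      · simp [K, jointlyEnabled_eq_zero hs hx hy hyx hs2]
    · simp
  rw [e1, e2, sum_add_distrib, sum_add_distrib, e3]
  linarith

/-- The Alexandrov–Fenchel type inequality for `bilin`. -/
theorem bilin_hyperbolic {hs : List (Bool → ℝ)} (hpos : ∀ h ∈ hs, ∀ s, 0 < h s)
    (hR : R.card = hs.length + 2) (v w : Q × Bool → ℝ) (hw : 0 < bilin z hs R w w) :
    bilin z hs R v v * bilin z hs R w w ≤ bilin z hs R v w ^ 2 := by
  induction hs generalizing R v w with
  | nil => exact bilin_nil_hyperbolic hR v w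
  | cons h hs ih =>
    have hh : ∀ s, 0 < h s := hpos h (by simp)
    have hpos' : ∀ g ∈ hs, ∀ s, 0 < g s := fun g hg => hpos g (by simp [hg])
    simp only [List.length_cons] at hR
    have hcard : ∀ x ∈ availableMoves z R, (R.erase x.1).card = hs.length + 2 := by
      intro x hx
      rw [card_erase_of_mem (mem_availableMoves.1 hx).1]
      omega
    have hrow : ∀ x ∈ availableMoves z R, ∑ y ∈ availableMoves z R,
        bilinMatrix z (h :: hs) R x y * h y.2 = weight z (h :: h :: hs) (R.erase x.1) := by
      intro x hx
      rw [← bilinRow_eq_matrix (h :: hs) hx (fun t => h t.2), bilinRow, weight]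
      exact sum_congr rfl fun y hy => by rw [inherit_sign h hx hy]
    have hrow_pos : ∀ x ∈ availableMoves z R, 0 < weight z (h :: h :: hs) (R.erase x.1) := by
      intro x hx
      refine weight_pos (fun g hg => hpos g ?_) _ (by simp [hcard x hx])
      simpa using hg
    have hmat : ∀ x ∈ availableMoves z R, ∀ y ∈ availableMoves z R, y.1 ≠ x.1 →
        0 < bilinMatrix z (h :: hs) R x y := by
      intro x hx y hy hyx
      rw [bilinMatrix, if_pos hyx, if_neg (fun h => hyx (by rw [h])), add_zero]
      refine weight_pos hpos _ ?_
      rw [card_erase_of_mem (mem_erase.2 ⟨hyx, (mem_availableMoves.1 hy).1⟩), hcard x hx]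
      simp
    refine bilin_hyperbolic_of_complement (h :: hs) (fun t => h t.2) (fun v hv => ?_) v w hw
    rw [bilin_eq_matrix] at hv ⊢
    refine nonpos_of_bochner (availableMoves z R) (bilinMatrix z (h :: hs) R) (fun t => h t.2)
      (fun x _ y _ => bilinMatrix_symm _ x y) ?_ (fun x _ => hh x.2) ?_ ?_ ?_ v hv
    · intro x hx y hy
      have hnn : ∀ g ∈ h :: hs, ∀ s, 0 ≤ g s := fun g hg s => (hpos g hg s).le
      rw [bilinMatrix]
      refine add_nonneg ?_ ?_
      · split_ifs
        · exact weight_nonneg hnn _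
        · exact le_rfl
      · split_ifs
        · exact sum_nonneg fun _ _ => weight_nonneg hnn _
        · exact le_rfl
    · intro x hx
      rw [hrow x hx]
      exact hrow_pos x hx
    · intro u hu x hx y hy
      by_cases hyx : y.1 = x.1
      · by_cases hxy : x = y
        · rw [hxy]
        · have hsnd : x.2 ≠ y.2 := fun hs2 => hxy (Prod.ext hyx.symm hs2)
          obtain ⟨w, hw⟩ : (availableMoves z (R.erase x.1)).Nonempty :=
            availableMoves_nonempty (card_pos.1 (by rw [hcard x hx]; omega))
          have hwR : w ∈ availableMoves z R := by
            by_contra hwR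
            apply hsnd
            rw [← snd_eq_of_newly_available hx hw hwR]
            rw [← hyx] at hw
            exact snd_eq_of_newly_available hy hw hwR
          have hwx : w.1 ≠ x.1 := (mem_erase.1 (mem_availableMoves.1 hw).1).1
          rw [hu x hx w hwR (hmat x hx w hwR hwx),
            hu y hy w hwR (hmat y hy w hwR (by rwa [hyx]))]
      · exact hu x hx y hy (hmat x hx y hy hyx)
    · intro v
      rw [← bilin_eq_matrix]
      refine (bilin_cons_le_sum h hs (fun s => (hh s).le)
        (fun g hg s => (hpos' g hg s).le) v).trans (sum_le_sum fun x hx => ?_)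
      rw [hrow x hx, div_mul_eq_mul_div, mul_div_assoc]
      refine mul_le_mul_of_nonneg_left ?_ (hh x.2).le
      rw [le_div_iff₀ (hrow_pos x hx), ← bilinRow_eq_matrix _ hx, bilinRow_cons h hs x,
        ← bilin_sign]
      refine ih hpos' (hcard x hx) _ _ ?_
      rw [bilin_sign]
      exact hrow_pos x hx

end Step

section Counting
open Finset
open scoped Classical

theorem Blocks.asymm {α : Type*} [PartialOrder α] {s : Bool} {a b : α} (h : Blocks s a b) :
    ¬ Blocks s b a := by
  cases s <;> exact lt_asymm h

theorem Blocks.trans {α : Type*} [PartialOrder α] {s : Bool} {a b c : α} (h : Blocks s a b)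
    (h' : Blocks s b c) : Blocks s a c := by
  cases s
  · exact lt_trans h h'
  · exact lt_trans h' h

theorem blocks_of_ne {α : Type*} [LinearOrder α] {s : Bool} {a b : α} (hne : a ≠ b)
    (h : ¬ Blocks s a b) : Blocks s b a := by
  cases s
  · exact lt_of_le_of_ne (not_lt.1 h) hne.symm
  · exact lt_of_le_of_ne (not_lt.1 h) hne

theorem exists_not_blocked {α : Type*} [LinearOrder α] (s : Bool) {S : Finset α}
    (hS : S.Nonempty) : ∃ m ∈ S, ∀ n ∈ S, ¬ Blocks s n m := by
  cases s
  · exact ⟨S.min' hS, S.min'_mem hS, fun n hn => not_lt.2 (S.min'_le n hn)⟩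
  · exact ⟨S.max' hS, S.max'_mem hS, fun n hn => not_lt.2 (S.le_max' n hn)⟩

variable {Q : Type*} [PartialOrder Q] {z : Q} {c m : ℕ} {s : Bool} {R : Finset Q} {S : Finset ℕ}
  {f : Q → ℕ} {a : Q}

/-- Extensions of the order on `insert z R` in which `z` has value `c` and `R` has value set `S`. -/
def extensions (z : Q) (c : ℕ) (R : Finset Q) (S : Finset ℕ) : Set (Q → ℕ) :=
  {f | Set.BijOn f R S ∧ (∀ a ∉ R, f a = c) ∧
    ∀ a ∈ insert z R, ∀ b ∈ insert z R, a < b → f a < f b}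

theorem mem_extensions_iff_blocks (s : Bool) : f ∈ extensions z c R S ↔
    Set.BijOn f R S ∧ (∀ a ∉ R, f a = c) ∧
      ∀ a ∈ insert z R, ∀ b ∈ insert z R, Blocks s b a → Blocks s (f b) (f a) := by
  cases s
  · exact and_congr_right' (and_congr_right'
      ⟨fun h a ha b hb => h b hb a ha, fun h a ha b hb => h b hb a ha⟩)
  · exact Iff.rfl

theorem extensions_finite (z : Q) (c : ℕ) (R : Finset Q) (S : Finset ℕ) :
    (extensions z c R S).Finite := by
  refine Set.Finite.of_finite_image (f := fun f (a : R) => f a) ?_ ?_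
  · refine (Set.Finite.pi' (t := fun _ : R => (S : Set ℕ)) fun _ => S.finite_toSet).subset ?_
    rintro _ ⟨f, hf, rfl⟩ a
    exact hf.1.mapsTo a.2
  · intro f hf g hg hfg
    funext a
    by_cases ha : a ∈ R
    · exact congrFun hfg ⟨a, ha⟩
    · rw [hf.2.1 a ha, hg.2.1 a ha]

theorem available_of_extreme_value (hz : z ∉ R) (hmc : Blocks s m c)
    (hmS : ∀ n ∈ S, ¬ Blocks s n m) (hf : f ∈ extensions z c R S) (ha : a ∈ R) (hfa : f a = m) :
    (a, s) ∈ availableMoves z R := by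
  have hf' := (mem_extensions_iff_blocks s).1 hf
  refine mem_availableMoves.2 ⟨ha, fun b hb hba => ?_⟩
  have h := hf'.2.2 a (mem_insert_of_mem ha) b hb hba
  rw [hfa] at h
  rcases mem_insert.1 hb with rfl | hb
  · rw [hf.2.1 _ hz] at h
    exact hmc.asymm h
  · exact hmS _ (hf.1.mapsTo hb) h

theorem update_mem_extensions_erase (hz : z ∉ R) (hf : f ∈ extensions z c R S) (ha : a ∈ R)
    (hfa : f a = m) : Function.update f a c ∈ extensions z c (R.erase a) (S.erase m) := by
  have hne : ∀ b ∈ insert z (R.erase a), b ≠ a := by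
    rintro b hb rfl
    rcases mem_insert.1 hb with h | h
    · exact hz (h ▸ ha)
    · exact notMem_erase _ _ h
  refine ⟨?_, fun b hb => ?_, fun b hb d hd hbd => ?_⟩
  · have h1 : Set.BijOn f (R \ {a} : Set Q) (S \ {m} : Set ℕ) := by
      have := hf.1.sdiff_singleton ha
      rwa [hfa] at this
    rw [coe_erase, coe_erase]
    refine h1.congr fun b hb => ?_
    rw [Function.update_of_ne hb.2]
  · by_cases hba : b = a
    · rw [hba, Function.update_self]
    · rw [Function.update_of_ne hba]
      exact hf.2.1 b fun h => hb (mem_erase.2 ⟨hba, h⟩)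
  · rw [Function.update_of_ne (hne b hb), Function.update_of_ne (hne d hd)]
    have hsub := insert_subset_insert z (erase_subset a R)
    exact hf.2.2 b (hsub hb) d (hsub hd) hbd

theorem update_mem_extensions (hz : z ∉ R) (hm : m ∈ S) (hmc : Blocks s m c)
    (hmS : ∀ n ∈ S, ¬ Blocks s n m) (ha : (a, s) ∈ availableMoves z R)
    (hf : f ∈ extensions z c (R.erase a) (S.erase m)) :
    Function.update f a m ∈ extensions z c R S := by
  have haR := (mem_availableMoves.1 ha).1
  rw [mem_extensions_iff_blocks s] at hf ⊢
  refine ⟨?_, fun b hb => ?_, fun p hp q hq hqp => ?_⟩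
  · have h1 : Set.BijOn (Function.update f a m) (R.erase a) (S.erase m) :=
      hf.1.congr fun b hb => by rw [Function.update_of_ne (mem_erase.1 hb).1]
    have h2 := h1.insert (a := a) (by simp)
    rw [Function.update_self, ← coe_insert, ← coe_insert, insert_erase haR, insert_erase hm] at h2
    exact h2
  · have hba : b ≠ a := fun h => hb (h ▸ haR)
    rw [Function.update_of_ne hba]
    exact hf.2.1 b fun h => hb (mem_of_mem_erase h)
  · have hpa : p ≠ a := by
      rintro rfl
      exact (mem_availableMoves.1 ha).2 q hq hqp
    have hmem : ∀ b ∈ insert z R, b ≠ a → b ∈ insert z (R.erase a) := fun b hb hba => by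
      rw [mem_insert] at hb ⊢
      exact hb.imp id fun h => mem_erase.2 ⟨hba, h⟩
    rw [Function.update_of_ne hpa]
    by_cases hqa : q = a
    · rw [hqa, Function.update_self]
      rcases mem_insert.1 hp with rfl | hp
      · rwa [hf.2.1 _ fun h => hz (mem_of_mem_erase h)]
      · have hfp := mem_erase.1 (hf.1.mapsTo (mem_erase.2 ⟨hpa, hp⟩))
        exact blocks_of_ne hfp.1 (hmS _ hfp.2)
    · rw [Function.update_of_ne hqa]
      exact hf.2.2 p (hmem p hp hpa) q (hmem q hq hqa) hqp

theorem ncard_extensions_eq_sum (hz : z ∉ R) (hm : m ∈ S) (hmc : Blocks s m c)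
    (hmS : ∀ n ∈ S, ¬ Blocks s n m) :
    (extensions z c R S).ncard = ∑ x ∈ availableMoves z R with x.2 = s,
      (extensions z c (R.erase x.1) (S.erase m)).ncard := by
  let F : Finset Q → Finset ℕ → Finset (Q → ℕ) := fun R S => (extensions_finite z c R S).toFinset
  have hF : ∀ R S f, f ∈ F R S ↔ f ∈ extensions z c R S := fun R S f => by simp [F]
  have hcard : ∀ R S, (extensions z c R S).ncard = (F R S).card := fun R S =>
    Set.ncard_eq_toFinset_card _ _
  have hmem : ∀ x ∈ {x ∈ availableMoves z R | x.2 = s}, ∀ g ∈ F (R.erase x.1) (S.erase m),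
      Function.update g x.1 m ∈ extensions z c R S := by
    rintro ⟨a, t⟩ hx g hg
    obtain ⟨ha, rfl : t = s⟩ := mem_filter.1 hx
    exact update_mem_extensions hz hm hmc hmS ha ((hF _ _ _).1 hg)
  have hU : F R S = {x ∈ availableMoves z R | x.2 = s}.biUnion fun x =>
      (F (R.erase x.1) (S.erase m)).image fun g => Function.update g x.1 m := by
    ext f
    rw [hF, mem_biUnion]
    constructor
    · intro hf
      obtain ⟨a, ha, hfa⟩ := hf.1.surjOn hm
      refine ⟨(a, s), mem_filter.2 ⟨available_of_extreme_value hz hmc hmS hf ha hfa, rfl⟩,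
        mem_image.2 ⟨Function.update f a c,
          (hF _ _ _).2 (update_mem_extensions_erase hz hf ha hfa), ?_⟩⟩
      rw [Function.update_idem, ← hfa, Function.update_eq_self]
    · rintro ⟨x, hx, hf⟩
      obtain ⟨g, hg, rfl⟩ := mem_image.1 hf
      exact hmem x hx g hg
  rw [hcard, hU, card_biUnion]
  · refine sum_congr rfl fun x hx => ?_
    rw [hcard, card_image_of_injOn]
    intro g hg g' hg' h
    have hval : ∀ g ∈ F (R.erase x.1) (S.erase m), g x.1 = c := fun g hg =>
      ((hF _ _ _).1 hg).2.1 _ (notMem_erase _ _)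
    have := congrArg (fun f => Function.update f x.1 c) h
    simp only [Function.update_idem] at this
    rwa [← hval g hg, Function.update_eq_self, hval g hg, ← hval g' hg',
      Function.update_eq_self] at this
  · intro x hx y hy hxy
    refine disjoint_left.2 fun f hf hf' => hxy ?_
    obtain ⟨g, hg, rfl⟩ := mem_image.1 hf
    obtain ⟨g', hg', h⟩ := mem_image.1 hf'
    have h1 := hmem x hx g hg
    have hx' := mem_filter.1 hx
    have hy' := mem_filter.1 hy
    refine Prod.ext (h1.1.injOn (mem_availableMoves.1 hx'.1).1 (mem_availableMoves.1 hy'.1).1 ?_)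
      (hx'.2.trans hy'.2.symm)
    simp only [Function.update_self]
    rw [← h, Function.update_self]

/-- The direction that gives weight `1` to the moves of sign `s` and `0` to the others. -/
def signDirection (s : Bool) : Bool → ℝ := fun t => if t = s then 1 else 0

theorem weight_signDirection_eq_ncard (l : List Bool) (hz : z ∉ R) (hc : c ∉ S)
    (hRS : R.card = S.card) (hl : ∀ t, l.count t = #{n ∈ S | Blocks t n c}) :
    weight z (l.map signDirection) R = (extensions z c R S).ncard := by
  induction l generalizing R S with
  | nil =>
    have hS : S = ∅ := by
      refine eq_empty_of_forall_notMem fun n hn => ?_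
      have h0 : ∀ t, ¬ Blocks t n c := fun t ht => by
        have := (hl t).symm
        rw [List.count_nil, card_eq_zero] at this
        exact notMem_empty n (this ▸ mem_filter.2 ⟨hn, ht⟩)
      have hnc : n ≠ c := fun h => hc (h ▸ hn)
      exact h0 false ((blocks_of_ne hnc (h0 true)).swap (by simp))
    have hR : R = ∅ := by rw [← card_eq_zero, hRS, hS, card_empty]
    have : extensions z c R S = {fun _ => c} := by
      subst hS hR
      ext f
      simp [extensions, funext_iff]
    rw [this, Set.ncard_singleton]
    simp [weight]
  | cons s l ih =>
    have hpos : (S.filter fun n => Blocks s n c).Nonempty := by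
      rw [← card_pos, ← hl s]
      simp
    obtain ⟨m, hm, hmax⟩ := exists_not_blocked s hpos
    obtain ⟨hmS, hmc⟩ := mem_filter.1 hm
    have hext : ∀ n ∈ S, ¬ Blocks s n m := fun n hn h =>
      hmax n (mem_filter.2 ⟨hn, h.trans hmc⟩) h
    rw [ncard_extensions_eq_sum hz hmS hmc hext, List.map_cons, weight, sum_filter, Nat.cast_sum]
    refine sum_congr rfl fun x hx => ?_
    rw [signDirection]
    split_ifs with hxs
    · rw [one_mul]
      refine ih (fun h => hz (mem_of_mem_erase h)) (fun h => hc (mem_of_mem_erase h)) ?_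
        fun t => ?_
      · rw [card_erase_of_mem (mem_availableMoves.1 hx).1, card_erase_of_mem hmS, hRS]
      · have h := hl t
        rw [filter_erase]
        by_cases hst : s = t
        · subst hst
          rw [card_erase_of_mem hm, ← h]
          simp
        · rw [erase_eq_of_notMem, ← h]
          · simp [hst]
          · exact fun h => hmc.asymm ((mem_filter.1 h).2.swap (Ne.symm hst))
    · simp

end Counting

section Limit
open Finset
open scoped Classical
variable {Q : Type*} [PartialOrder Q] {z : Q} {R : Finset Q}

theorem weight_continuous {ι : Type*} (d : ι → ℝ → Bool → ℝ)
    (hd : ∀ i s, Continuous fun ε => d i ε s) (l : List ι) (R : Finset Q) :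
    Continuous fun ε => weight z (l.map fun i => d i ε) R := by
  induction l generalizing R with
  | nil => exact continuous_const
  | cons i l ih =>
    simp only [List.map_cons, weight]
    exact continuous_finsetSum _ fun x _ => (hd i x.2).mul (ih _)

theorem weight_mul_le_sq {hs : List (Bool → ℝ)} (hpos : ∀ h ∈ hs, ∀ s, 0 < h s)
    (hR : R.card = hs.length + 2) (g : Bool → ℝ) {h : Bool → ℝ} (hh : ∀ s, 0 < h s) :
    weight z (g :: g :: hs) R * weight z (h :: h :: hs) R ≤ weight z (g :: h :: hs) R ^ 2 := by
  simp only [← bilin_sign]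
  refine bilin_hyperbolic hpos hR _ _ ?_
  rw [bilin_sign]
  exact weight_pos (by simpa [hh] using hpos) _ (by simp [hR])

theorem weight_signDirection_mul_le_sq (l : List Bool) (hR : R.card = l.length + 2) (s t : Bool) :
    weight z ((s :: s :: l).map signDirection) R * weight z ((t :: t :: l).map signDirection) R ≤
      weight z ((s :: t :: l).map signDirection) R ^ 2 := by
  let d : Bool → ℝ → Bool → ℝ := fun s ε t => signDirection s t + ε
  have hd : ∀ s t, Continuous fun ε => d s ε t := fun s t => by fun_prop
  have hpos : ∀ s ε, 0 < ε → ∀ t, 0 < d s ε t := fun s ε hε t =>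
    add_pos_of_nonneg_of_pos (by unfold signDirection; split_ifs <;> norm_num) hε
  have hlim : ∀ l : List Bool, Filter.Tendsto (fun ε => weight z (l.map fun s => d s ε) R)
      (nhdsWithin 0 (Set.Ioi 0)) (nhds (weight z (l.map signDirection) R)) := by
    intro l
    have h0 := (weight_continuous (z := z) d hd l R).tendsto 0
    simp only [d, add_zero] at h0
    exact h0.mono_left nhdsWithin_le_nhds
  refine le_of_tendsto_of_tendsto ((hlim _).mul (hlim _)) ((hlim _).pow 2) ?_
  filter_upwards [self_mem_nhdsWithin] with ε hε
  refine weight_mul_le_sq ?_ (by simpa using hR) _ (hpos t ε hε)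
  intro h hh
  obtain ⟨r, -, rfl⟩ := List.mem_map.1 hh
  exact hpos r ε hε

end Limit

section Stanley
open Finset
open scoped Classical

theorem natCard_linearExtensions {Q : Type*} [Fintype Q] [PartialOrder Q] {n : ℕ}
    (hn : Fintype.card Q = n) (x : Q) {c : ℕ} (hc : c < n) :
    Nat.card {e : Q ≃ Fin n // (∀ a b : Q, a < b → e a < e b) ∧ (e x : ℕ) = c} =
      (extensions x c (univ.erase x) ((range n).erase c)).ncard := by
  refine Nat.card_eq_of_bijective (fun e => ⟨fun a => (e.1 a : ℕ), ?_, ?_, ?_⟩) ⟨?_, ?_⟩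
  · have h1 : Set.BijOn (fun a => (e.1 a : ℕ)) (univ : Finset Q) (range n) := by
      refine ⟨fun a _ => by simp, fun a _ b _ h => e.1.injective (Fin.ext h), fun k hk => ?_⟩
      exact ⟨e.1.symm ⟨k, by simpa using hk⟩, by simp, by simp⟩
    have h2 := h1.sdiff_singleton (a := x) (by simp)
    rw [coe_erase, coe_erase]
    simpa only [e.2.2] using h2
  · intro a ha
    have : a = x := by simpa using ha
    simpa only [this] using e.2.2
  · intro a _ b _ hab
    exact e.2.1 a b hab
  · intro e e' h
    refine Subtype.ext (Equiv.ext fun a => Fin.ext ?_)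
    exact congrFun (congrArg Subtype.val h) a
  · rintro ⟨f, hf⟩
    have hfx : f x = c := hf.2.1 x (by simp)
    have h1 := hf.1.insert (a := x) (by simp [hfx])
    rw [hfx, ← coe_insert, ← coe_insert, insert_erase (mem_univ _),
      insert_erase (mem_range.2 hc)] at h1
    have hlt : ∀ a, f a < n := fun a => mem_range.1 (h1.mapsTo (mem_univ a))
    have hinj : Function.Injective fun a => (⟨f a, hlt a⟩ : Fin n) := fun a b h =>
      h1.injOn (mem_univ a) (mem_univ b) (Fin.ext_iff.1 h)
    let e := Equiv.ofBijective _
      ((Fintype.bijective_iff_injective_and_card _).2 ⟨hinj, by rw [hn, Fintype.card_fin]⟩)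
    refine ⟨⟨e, fun a b hab => ?_, hfx⟩, Subtype.ext rfl⟩
    exact hf.2.2 a (by simp [insert_erase]) b (by simp [insert_erase]) hab

theorem weight_eq_natCard_linearExtensions {Q : Type*} [Fintype Q] [PartialOrder Q] {n : ℕ}
    (hn : Fintype.card Q = n) (x : Q) {c : ℕ} (hc : c < n) (l : List Bool)
    (ht : l.count true = n - 1 - c) (hf : l.count false = c) :
    weight x (l.map signDirection) (univ.erase x) =
      Nat.card {e : Q ≃ Fin n // (∀ a b : Q, a < b → e a < e b) ∧ (e x : ℕ) = c} := by
  rw [natCard_linearExtensions hn x hc]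
  refine weight_signDirection_eq_ncard l (by simp) (by simp) ?_ ?_
  · rw [card_erase_of_mem (mem_univ _), card_erase_of_mem (mem_range.2 hc), card_univ, hn,
      card_range]
  · rintro (_ | _)
    · rw [hf]
      have : ((range n).erase c).filter (fun k => Blocks false k c) = range c := by
        ext k
        rw [mem_filter, mem_erase, mem_range, mem_range, Blocks]
        omega
      rw [this, card_range]
    · rw [ht]
      have : ((range n).erase c).filter (fun k => Blocks true k c) = Ico (c + 1) n := by
        ext k
        rw [mem_filter, mem_erase, mem_range, mem_Ico, Blocks]
        omega
      rw [this, Nat.card_Ico]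
      omega

end Stanley

/-- Stanley: let `Q` be a finite poset with `n` elements and, for `x ∈ Q` and
`1 ≤ i ≤ n`, let `N i x` be the number of linear extensions `e : Q ≃ Fin n` (order-preserving
bijections) in which `x` is the `i`-th largest element, i.e. `e x = n − i` in `Fin n`
(equivalently `e x = n + 1 − i` when values are taken in `{1, …, n}`). Then for every `x` and
every `i` with `2 ≤ i ≤ n − 1`, `N i x ^ 2 ≥ N (i−1) x ⬝ N (i+1) x`. -/
theorem stanley_linear_extensions_log_concave {Q : Type*} [Fintype Q] [PartialOrder Q]
    (n : ℕ) (hn : Fintype.card Q = n)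
    (N : ℕ → Q → ℕ)
    (hN : ∀ i x, N i x = Nat.card {e : Q ≃ Fin n //
      (∀ a b : Q, a < b → e a < e b) ∧ ((e x : ℕ) = n - i)})
    (x : Q) (i : ℕ) (h1 : 2 ≤ i) (h2 : i ≤ n - 1) :
    N (i - 1) x * N (i + 1) x ≤ N i x * N i x := by
  have hn1 : i + 1 ≤ n := by omega
  let l := List.replicate (i - 2) true ++ List.replicate (n - i - 1) false
  have hl : l.length = n - 3 := by simp [l]; omega
  have ht : l.count true = i - 2 := by simp [l, List.count_replicate]
  have hf : l.count false = n - i - 1 := by simp [l, List.count_replicate]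
  classical
  have key := weight_signDirection_mul_le_sq (z := x) (R := Finset.univ.erase x) l (by
    rw [Finset.card_erase_of_mem (Finset.mem_univ _), Finset.card_univ, hn, hl]; omega) false true
  rw [weight_eq_natCard_linearExtensions hn x (c := n - (i - 1)) (by omega) _
      (by simp [ht]; omega) (by simp [hf]; omega),
    weight_eq_natCard_linearExtensions hn x (c := n - (i + 1)) (by omega) _
      (by simp [ht]; omega) (by simp [hf]; omega),
    weight_eq_natCard_linearExtensions hn x (c := n - i) (by omega) _
      (by simp [ht]; omega) (by simp [hf]; omega)] at key
  rw [hN, hN, hN, ← sq]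
  exact_mod_cast key
end
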